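/- There exist functions L, G, D : ℕ × ℕ → ℕ with the following property: for every n and every ideal I of ℂ[x_0, …, x_n] generated by k homogeneous polynomials of degree at most r, there is a primary decomposition I = I_1 ∩ … ∩ I_l in which l ≤ L(k, r) and each ideal I_j is primary and is generated by at most G(k, r) polynomials, each of degree at most D(k, r). In particular, the number of components, the numbers of generators, and their degrees are bounded by functions of k and r alone, independently of n. -/

import Mathlib

section
open MvPolynomial

lemma smooth_lift_ring {A C E : Type} [CommRing A] [CommRing C] [CommRing E] [Algebra A C]
    [Algebra.FormallySmooth A C] (p : E →+* C) (hp : Function.Surjective p)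
    (hk : IsNilpotent (RingHom.ker p)) (ψ : A →+* E) (h : p.comp ψ = algebraMap A C) :
    ∃ χ : C →+* E, p.comp χ = RingHom.id C ∧ χ.comp (algebraMap A C) = ψ := by
  let := ψ.toAlgebra
  let g : E →ₐ[A] C := { p with commutes' := fun a => congrArg (fun f => f a) h }
  let χ := Algebra.FormallySmooth.liftOfSurjective (AlgHom.id A C) g hp hk
  refine ⟨χ.toRingHom, ?_, ?_⟩
  · ext x
    have := Algebra.FormallySmooth.liftOfSurjective_apply (AlgHom.id A C) g hp hk x
    exact this
  · ext a
    exact χ.commutes a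

open scoped IntermediateField.algebraAdjoinAdjoin in
lemma smooth_over_adjoin (K0 : Type) [Field K0] [Algebra K0 ℂ] [CharZero K0] {B : Type} (v : B → ℂ)
    (hv : IsTranscendenceBasis K0 v) :
    Algebra.FormallySmooth (Algebra.adjoin K0 (Set.range v)) ℂ := by
  have h1 : Algebra.FormallySmooth (Algebra.adjoin K0 (Set.range v))
      (IntermediateField.adjoin K0 (Set.range v)) :=
    .of_isLocalization (nonZeroDivisors _)
  have h3 : Algebra.IsAlgebraic (IntermediateField.adjoin K0 (Set.range v)) ℂ :=
    hv.isAlgebraic_field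
  have h2 : Algebra.FormallyEtale (IntermediateField.adjoin K0 (Set.range v)) ℂ :=
    Algebra.FormallyEtale.of_isSeparable _ ℂ
  exact .comp _ (IntermediateField.adjoin K0 (Set.range v)) _

/-- extension of derivation -/
lemma exists_deriv_aux (K0 : Type) [Field K0] [Algebra K0 ℂ] [CharZero K0] {B : Type} (v : B → ℂ)
    (hv : IsTranscendenceBasis K0 v) (b0 : B) :
    ∃ δ : Derivation ℤ ℂ ℂ, (∀ z : K0, δ (algebraMap K0 ℂ z) = 0) ∧ δ (v b0) = 1 ∧
      ∀ b, b ≠ b0 → δ (v b) = 0 := by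
  classical
  have hA := smooth_over_adjoin K0 v hv
  let p : DualNumber ℂ →+* ℂ := (TrivSqZeroExt.fstHom ℂ ℂ ℂ).toRingHom
  let ψ0 : MvPolynomial B K0 →+* DualNumber ℂ :=
    eval₂Hom ((TrivSqZeroExt.inlHom ℂ ℂ).comp (algebraMap K0 ℂ))
      (fun b => TrivSqZeroExt.inl (v b) + TrivSqZeroExt.inr (if b = b0 then 1 else 0))
  let ψ : Algebra.adjoin K0 (Set.range v) →+* DualNumber ℂ :=
    ψ0.comp hv.1.aevalEquiv.symm.toRingEquiv.toRingHom
  have key : p.comp ψ0 = (aeval v : MvPolynomial B K0 →ₐ[K0] ℂ).toRingHom := by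
    ext x
    · simp [p, ψ0]
    · by_cases hx : x = b0 <;> simp [p, ψ0, hx]
  have hker : IsNilpotent (RingHom.ker p) := ⟨2, TrivSqZeroExt.kerIdeal_sq ℂ ℂ⟩
  obtain ⟨χ, h1, h2⟩ := smooth_lift_ring p (fun x => ⟨TrivSqZeroExt.inl x, rfl⟩) hker ψ (by
    ext a
    obtain ⟨q, rfl⟩ := hv.1.aevalEquiv.surjective a
    have := congrArg (fun f => f q) key
    simpa [ψ] using this)
  have hf : ∀ x, (χ x).fst = x := fun x => congrArg (fun f => f x) h1
  have hq : ∀ q : MvPolynomial B K0, χ (aeval v q) = ψ0 q := by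
    intro q
    have := congrArg (fun f => f (hv.1.aevalEquiv q)) h2
    simpa [ψ] using this
  obtain ⟨δ, hδ⟩ : ∃ δ : Derivation ℤ ℂ ℂ, ∀ x, δ x = (χ x).snd := by
    refine ⟨Derivation.mk' (AddMonoidHom.toIntLinearMap
      { toFun := fun x => (χ x).snd
        map_zero' := by rw [map_zero]; rfl
        map_add' := by intro a b; rw [map_add]; rfl }) ?_, fun x => rfl⟩
    intro a b
    simp [TrivSqZeroExt.snd_mul, hf, mul_comm]
  refine ⟨δ, ?_, ?_, ?_⟩
  · intro z
    have := hq (C z)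
    simp only [algHom_C, eval₂Hom_C, ψ0] at this
    rw [hδ, this]; rfl
  · have := hq (X b0)
    simp only [aeval_X, eval₂Hom_X', ψ0] at this
    rw [hδ, this]; simp
  · intro b hb
    have := hq (X b)
    simp only [aeval_X, eval₂Hom_X', ψ0] at this
    rw [hδ, this]; simp [hb]

/-- LemmaDer -/
lemma exists_generic (Z : Set ℂ) (hZ : Z.Countable) (τ : Type) [Finite τ] :
    ∃ t : τ → ℂ, ∀ i, ∃ δ : Derivation ℤ ℂ ℂ, (∀ z ∈ Z, δ z = 0) ∧ δ (t i) = 1 ∧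
      ∀ j, j ≠ i → δ (t j) = 0 := by
  let K0 := IntermediateField.adjoin ℚ Z
  have hc : Cardinal.mk K0 ≤ Cardinal.aleph0 := by
    refine (IntermediateField.cardinalMk_adjoin_le ℚ Z).trans ?_
    have := Cardinal.le_aleph0_iff_set_countable.2 hZ
    simp [this]
  obtain ⟨B, hB⟩ := exists_isTranscendenceBasis K0 ℂ
  have h1 := IsAlgClosed.cardinal_eq_cardinal_transcendence_basis_of_aleph0_lt' _ hB hc
    (by rw [Cardinal.mk_complex]; exact Cardinal.aleph0_lt_continuum)
  have hinf : Infinite B := by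
    rw [Cardinal.infinite_iff, ← h1, Cardinal.mk_complex]; exact Cardinal.aleph0_le_continuum
  obtain ⟨k, ⟨e⟩⟩ := Finite.exists_equiv_fin τ
  let emb : τ → B := fun i => Infinite.natEmbedding B (e i)
  have hemb : Function.Injective emb := by
    intro i j h
    have := (Infinite.natEmbedding B).injective h
    exact e.injective (Fin.ext this)
  refine ⟨fun i => (emb i : ℂ), fun i => ?_⟩
  obtain ⟨δ, a, b, c⟩ := exists_deriv_aux K0 _ hB (emb i)
  exact ⟨δ, fun z hz => a ⟨z, IntermediateField.subset_adjoin _ _ hz⟩, b,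
    fun j hj => c _ (fun h => hj (hemb h))⟩
end

section
open MvPolynomial
set_option linter.unusedSectionVars false

/-- Leibniz rule -/
def IsDer {A : Type} [CommRing A] (E : A →+ A) : Prop := ∀ a b, E (a * b) = a * E b + b * E a

lemma IsDer.one {A : Type} [CommRing A] {E : A →+ A} (h : IsDer E) : E 1 = 0 := by
  have := h 1 1
  simpa using this

lemma IsDer.eqOn {A : Type} [CommRing A] {E E' : A →+ A} (h : IsDer E) (h' : IsDer E') (s : Set A)
    (hs : Set.EqOn E E' s) (x : A) (hx : x ∈ Subring.closure s) : E x = E' x := by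
  induction hx using Subring.closure_induction with
  | mem x hx => exact hs hx
  | zero => simp
  | one => rw [h.one, h'.one]
  | add x y _ _ h1 h2 => simp [h1, h2]
  | neg x _ h1 => simp [h1]
  | mul x y _ _ h1 h2 => rw [h, h', h1, h2]

lemma exists_sumDer {A ι : Type} [CommRing A] [Fintype ι] (x : ι → A) (E : ι → A →+ A)
    (h : ∀ i, IsDer (E i)) : ∃ D : A →+ A, IsDer D ∧ ∀ F, D F = ∑ i, x i * E i F := by
  have hap : ∀ F, (∑ i, (AddMonoidHom.mulLeft (x i)).comp (E i)) F =
      ∑ i, x i * E i F := by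
    intro F; rw [AddMonoidHom.finsetSum_apply]; rfl
  refine ⟨_, ?_, hap⟩
  intro F G
  simp only [hap, Finset.mul_sum, ← Finset.sum_add_distrib]
  exact Finset.sum_congr rfl fun i _ => by rw [h i]; ring

lemma exists_cder {A : Type} (τ : Type) [CommRing A] (δ : A →+ A) (hd : IsDer δ) :
    ∃ E : MvPolynomial τ A →+ MvPolynomial τ A, IsDer E ∧ ∀ F α,
      coeff α (E F) = δ (coeff α F) := by
  classical
  have hlin : ∃ E : MvPolynomial τ A →+ MvPolynomial τ A, ∀ F α,
      coeff α (E F) = δ (coeff α F) := by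
    let f : MvPolynomial τ A → MvPolynomial τ A := fun F =>
        AddMonoidAlgebra.ofCoeff ((AddMonoidAlgebra.coeff F).mapRange δ (map_zero δ))
    have hf : ∀ F α, coeff α (f F) = δ (coeff α F) := fun F α => rfl
    refine ⟨⟨⟨f, ?_⟩, ?_⟩, hf⟩
    · ext α; rw [hf]; simp
    · intro F G; ext α; simp only [hf, coeff_add, map_add]
  obtain ⟨E, hE⟩ := hlin
  refine ⟨E, ?_, hE⟩
  intro F G
  ext α
  simp only [hE, coeff_add, coeff_mul, map_sum]
  simp only [hd _ _]
  rw [Finset.sum_add_distrib]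
  congr 1
  exact (Finsupp.sum_antidiagonal_swap α fun a b => coeff b G * δ (coeff a F))

section
variable {σ τ : Type} [Fintype σ] [Fintype τ]

lemma weight_one_eq {σ : Type} (m : σ →₀ ℕ) : (Finsupp.weight 1) m = m.degree := by
  have := Finsupp.degree_eq_weight_one (σ := σ) (R := ℕ)
  rw [this]; rfl

lemma exists_E (δ : σ → ℂ →+ ℂ) (hd : ∀ i, IsDer (δ i)) :
    ∃ E : MvPolynomial σ ℂ →+ MvPolynomial σ ℂ, IsDer E ∧
      (∀ i, E (X i) = 0) ∧ (∀ c, E (C c) = ∑ i, X i * C (δ i c)) ∧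
      ∀ F e, F.IsHomogeneous e → (E F).IsHomogeneous (e + 1) := by
  classical
  choose E hEd hE using fun i => exists_cder σ (δ i) (hd i)
  have hC : ∀ i c, E i (C c) = C (δ i c) := by
    intro i c; ext α; rw [hE]; simp only [coeff_C]; split_ifs <;> simp
  have hX : ∀ i j, E i (X j) = 0 := by
    intro i j; ext α; rw [hE]; simp only [coeff_X]; split_ifs <;> simp [(hd i).one]
  obtain ⟨D, hD, hap⟩ := exists_sumDer (fun i => (X i : MvPolynomial σ ℂ)) E hEd
  refine ⟨D, hD, ?_, ?_, ?_⟩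
  · intro j; simp [hap, hX]
  · intro c; simp [hap, hC]
  · intro F e hF
    rw [hap]
    refine IsHomogeneous.sum _ _ _ fun i _ => ?_
    rw [add_comm]
    refine (isHomogeneous_X _ _).mul ?_
    intro α hα
    rw [hE] at hα
    apply hF
    intro h0
    rw [h0] at hα; simp at hα

/-- translation -/
noncomputable def Phi (v : τ → σ → ℂ) :
    MvPolynomial σ ℂ →ₐ[ℂ] MvPolynomial τ (MvPolynomial σ ℂ) :=
  aeval (fun i => C (X i) + ∑ b, X b * C (C (v b i)))

/-- bihomogeneous -/
def BiHom (e : ℕ) (F : MvPolynomial τ (MvPolynomial σ ℂ)) : Prop :=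
  ∀ α m, coeff m (coeff α F) ≠ 0 → m.degree + α.degree = e

lemma BiHom.mul {e e' : ℕ} {F G : MvPolynomial τ (MvPolynomial σ ℂ)} (hF : BiHom e F)
    (hG : BiHom e' G) : BiHom (e + e') (F * G) := by
  classical
  intro α m h
  rw [coeff_mul, coeff_sum] at h
  obtain ⟨p, hp, h⟩ := Finset.exists_ne_zero_of_sum_ne_zero h
  rw [coeff_mul] at h
  obtain ⟨q, hq, h⟩ := Finset.exists_ne_zero_of_sum_ne_zero h
  have h1 := hF _ _ (left_ne_zero_of_mul h)
  have h2 := hG _ _ (right_ne_zero_of_mul h)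
  rw [Finset.HasAntidiagonal.mem_antidiagonal] at hp hq
  rw [← hp, ← hq, map_add, map_add]
  omega

lemma BiHom.sum {ι : Type} (s : Finset ι) {e : ℕ} {F : ι → MvPolynomial τ (MvPolynomial σ ℂ)}
    (hF : ∀ i ∈ s, BiHom e (F i)) : BiHom e (∑ i ∈ s, F i) := by
  intro α m h
  rw [coeff_sum, coeff_sum] at h
  obtain ⟨p, hp, h⟩ := Finset.exists_ne_zero_of_sum_ne_zero h
  exact hF p hp _ _ h

lemma BiHom.add {e : ℕ} {F G : MvPolynomial τ (MvPolynomial σ ℂ)} (hF : BiHom e F)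
    (hG : BiHom e G) : BiHom e (F + G) := by
  intro α m h
  rw [coeff_add, coeff_add] at h
  by_cases h1 : coeff m (coeff α F) = 0
  · rw [h1, zero_add] at h; exact hG _ _ h
  · exact hF _ _ h1

lemma BiHom.CC (c : ℂ) : BiHom 0 (C (C c) : MvPolynomial τ (MvPolynomial σ ℂ)) := by
  classical
  intro α m h
  rw [coeff_C] at h
  split_ifs at h with h1
  · rw [coeff_C] at h
    split_ifs at h with h2
    · simp [← h1, ← h2]
    · simp at h
  · simp at h

lemma BiHom.CX (i : σ) : BiHom 1 (C (X i) : MvPolynomial τ (MvPolynomial σ ℂ)) := by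
  classical
  intro α m h
  rw [coeff_C] at h
  split_ifs at h with h1
  · rw [coeff_X] at h
    split_ifs at h with h2
    · simp [← h1, ← h2]
    · simp at h
  · simp at h

lemma BiHom.T (i : τ) : BiHom 1 (X i : MvPolynomial τ (MvPolynomial σ ℂ)) := by
  classical
  intro α m h
  rw [coeff_X] at h
  split_ifs at h with h1
  · rw [coeff_one] at h
    split_ifs at h with h2
    · simp [← h1, ← h2]
    · simp at h
  · simp at h

lemma BiHom.pow {e : ℕ} {F : MvPolynomial τ (MvPolynomial σ ℂ)} (hF : BiHom e F) (k : ℕ) :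
    BiHom (k * e) (F ^ k) := by
  induction k with
  | zero => simpa using BiHom.CC (σ := σ) (τ := τ) 1
  | succ k ih => rw [pow_succ, add_mul, one_mul]; exact ih.mul hF

lemma BiHom.prod {ι : Type} (s : Finset ι) {e : ι → ℕ}
    {F : ι → MvPolynomial τ (MvPolynomial σ ℂ)}
    (hF : ∀ i ∈ s, BiHom (e i) (F i)) : BiHom (∑ i ∈ s, e i) (∏ i ∈ s, F i) := by
  classical
  induction s using Finset.induction_on with
  | empty => simpa using BiHom.CC (σ := σ) (τ := τ) 1
  | insert a s ha ih =>
    rw [Finset.sum_insert ha, Finset.prod_insert ha]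
    exact (hF a (by simp)).mul (ih fun i hi => hF i (by simp [hi]))

lemma Phi_biHom (v : τ → σ → ℂ) (f : MvPolynomial σ ℂ) (e : ℕ) (hf : f.IsHomogeneous e) :
    BiHom e (Phi v f) := by
  classical
  conv in f => rw [f.as_sum]
  rw [map_sum]
  refine BiHom.sum _ fun m hm => ?_
  have hd : m.degree = e := by
    have := hf (mem_support_iff.1 hm)
    rwa [weight_one_eq] at this
  rw [Phi, aeval_monomial, ← zero_add e]
  refine BiHom.mul (BiHom.CC _) ?_
  rw [← hd, Finsupp.prod, Finsupp.degree]
  refine BiHom.prod _ fun i _ => ?_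
  have : BiHom 1 (C (X i) + ∑ b, X b * C (C (v b i)) : MvPolynomial τ (MvPolynomial σ ℂ)) :=
    (BiHom.CX i).add (BiHom.sum _ fun b _ => (BiHom.T b).mul (BiHom.CC _))
  simpa using this.pow (m i)

lemma Dop_hom (v : τ → σ → ℂ) (f : MvPolynomial σ ℂ) (e : ℕ) (hf : f.IsHomogeneous e)
    (α : τ →₀ ℕ) (k : ℕ) (h : k + α.degree = e) : (coeff α (Phi v f)).IsHomogeneous k := by
  intro m hm
  have := Phi_biHom v f e hf α m hm
  rw [weight_one_eq]
  omega

lemma Dop_zero_of_lt (v : τ → σ → ℂ) (f : MvPolynomial σ ℂ) (e : ℕ) (hf : f.IsHomogeneous e)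
    (α : τ →₀ ℕ) (h : e < α.degree) : (coeff α (Phi v f)) = 0 := by
  ext m
  rw [coeff_zero]
  by_contra hm
  have := Phi_biHom v f e hf α m hm
  omega

end
end

section
open MvPolynomial
set_option linter.unusedSectionVars false

section
variable {σ τ : Type} [Fintype σ] [Fintype τ]

lemma E_Phi [DecidableEq τ] (E : MvPolynomial σ ℂ →+ MvPolynomial σ ℂ) (hD : IsDer E)
    (hX : ∀ i, E (X i) = 0) (v : τ → σ → ℂ) (a : τ)
    (hv : ∀ b i, E (C (v b i)) = if b = a then X i else 0) (f : MvPolynomial σ ℂ)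
    (hZ : ∀ m, E (C (coeff m f)) = 0)
    (E1 E2 : MvPolynomial τ (MvPolynomial σ ℂ) →+ MvPolynomial τ (MvPolynomial σ ℂ))
    (hD1 : IsDer E1) (hD2 : IsDer E2)
    (hE1 : ∀ F α, coeff α (E1 F) = E (coeff α F))
    (hE2 : ∀ F α, coeff α (E2 F) = ∑ i, X i * pderiv i (coeff α F)) :
    E1 (Phi v f) = X a * E2 (Phi v f) := by
  classical
  let s : Set (MvPolynomial τ (MvPolynomial σ ℂ)) :=
    {F | (∃ i, F = Phi v (X i)) ∨ ∃ c, E (C c) = 0 ∧ F = C (C c)}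
  have E1C : ∀ p, E1 (C p) = C (E p) := by
    intro p; ext1 α; rw [hE1]; simp only [coeff_C]; split_ifs <;> simp
  have E2C : ∀ p, E2 (C p) = C (∑ i, X i * pderiv i p) := by
    intro p; ext1 α; rw [hE2]; simp only [coeff_C]; split_ifs <;> simp
  have E1X : ∀ b, E1 (X b) = 0 := by
    intro p; ext1 α; rw [hE1]; simp only [coeff_X]; split_ifs <;> simp [hD.one]
  have E2X : ∀ b, E2 (X b) = 0 := by
    intro p; ext1 α; rw [hE2]; simp only [coeff_X]; split_ifs <;> simp
  have hs : Set.EqOn E1 ((AddMonoidHom.mulLeft (X a)).comp E2) s := by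
    rintro F (⟨i, rfl⟩ | ⟨c, hc, rfl⟩)
    · simp only [Phi, aeval_X, map_add, map_sum, hD1 _ _, hD2 _ _, E1C, E1X, hX, hv, E2C, E2X,
        AddMonoidHom.comp_apply, AddMonoidHom.coe_mulLeft]
      simp [pderiv_X, Pi.single_apply, apply_ite (C : _ → MvPolynomial τ (MvPolynomial σ ℂ))]
    · simp [E1C, E2C, hc]
  have hmem : Phi v f ∈ Subring.closure s := by
    have h1 : ∀ i, Phi v (X i) ∈ Subring.closure s := fun i =>
      Subring.subset_closure (Or.inl ⟨i, rfl⟩)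
    conv in f => rw [f.as_sum]
    rw [map_sum]
    refine sum_mem fun m _ => ?_
    rw [monomial_eq, map_mul, Finsupp.prod, map_prod]
    refine mul_mem ?_ (prod_mem fun i _ => ?_)
    · refine Subring.subset_closure (Or.inr ⟨coeff m f, hZ m, ?_⟩)
      rw [Phi, aeval_C]; rfl
    · rw [map_pow]; exact pow_mem (h1 i) _
  refine IsDer.eqOn hD1 (E' := (AddMonoidHom.mulLeft (X a)).comp E2) ?_ s hs _ hmem
  intro F G
  simp only [AddMonoidHom.comp_apply, AddMonoidHom.coe_mulLeft, hD2 _ _]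
  ring

lemma E_Dop [DecidableEq τ] (E : MvPolynomial σ ℂ →+ MvPolynomial σ ℂ) (hD : IsDer E)
    (hX : ∀ i, E (X i) = 0) (v : τ → σ → ℂ) (a : τ)
    (hv : ∀ b i, E (C (v b i)) = if b = a then X i else 0) (f : MvPolynomial σ ℂ)
    (hZ : ∀ m, E (C (coeff m f)) = 0) (e : ℕ) (hf : f.IsHomogeneous e) (α : τ →₀ ℕ) (k : ℕ)
    (hk : k + α.degree = e) :
    E (coeff α (Phi v f)) = if α a = 0 then 0 else
      C ((k + 1 : ℕ) : ℂ) * coeff (α - Finsupp.single a 1) (Phi v f) := by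
  obtain ⟨E1, hD1, hE1⟩ := exists_cder τ E hD
  obtain ⟨pd, hpd1, hpd⟩ : ∃ pd : σ → MvPolynomial σ ℂ →+ MvPolynomial σ ℂ, (∀ i, IsDer (pd i)) ∧
      ∀ i F, pd i F = pderiv i F := by
    refine ⟨fun i => ⟨⟨fun F => pderiv i F, map_zero _⟩, fun a b => map_add _ a b⟩, ?_,
      fun i F => rfl⟩
    intro i F G
    have := (pderiv (R := ℂ) i).leibniz F G
    simpa using this
  obtain ⟨D, hD', hap⟩ := exists_sumDer (fun i => (X i : MvPolynomial σ ℂ)) pd hpd1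
  obtain ⟨E2, hD2, hE2⟩ := exists_cder τ D hD'
  have hE2' : ∀ F α, coeff α (E2 F) = ∑ i, X i * pderiv i (coeff α F) := by
    intro F α; rw [hE2, hap]; simp only [hpd]
  have := E_Phi E hD hX v a hv f hZ E1 E2 hD1 hD2 hE1 hE2'
  rw [← hE1, this, coeff_X_mul', hE2']
  by_cases h : α a = 0
  · simp [h]
  · have h' : a ∈ α.support := by simpa using h
    rw [if_pos h', if_neg h]
    have hle : Finsupp.single a 1 ≤ α := by
      rw [Finsupp.single_le_iff]; omega
    have hdeg : (α - Finsupp.single a 1).degree + 1 = α.degree := by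
      conv_rhs => rw [← tsub_add_cancel_of_le hle]
      simp
    have hh := Dop_hom v f e hf (α - Finsupp.single a 1) (k + 1) (by omega)
    have := hh.sum_X_mul_pderiv
    rw [this]; simp
end

section
variable {σ : Type} [Fintype σ]

/-- bounded strength -/
def LowStr (K e : ℕ) (F : MvPolynomial σ ℂ) : Prop :=
  ∃ l : List (MvPolynomial σ ℂ × MvPolynomial σ ℂ), l.length ≤ K ∧
    (∀ p ∈ l, ∃ a b, 1 ≤ a ∧ 1 ≤ b ∧ a + b = e ∧ p.1.IsHomogeneous a ∧ p.2.IsHomogeneous b) ∧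
    F = (l.map fun p => p.1 * p.2).sum

/-- strong families -/
def Strong {ι : Type} [Fintype ι] (N : ℕ) (e : ι → ℕ) (f : ι → MvPolynomial σ ℂ) : Prop :=
  ∀ (e0 : ℕ) (c : ι → ℂ), (∀ j, e j ≠ e0 → c j = 0) → c ≠ 0 →
    ¬ LowStr N e0 (∑ j, C (c j) * f j)

lemma LowStr.zero (e : ℕ) : LowStr 0 e (0 : MvPolynomial σ ℂ) := ⟨[], by simp⟩

lemma LowStr.mono {K K' e : ℕ} {F : MvPolynomial σ ℂ} (h : LowStr K e F) (hK : K ≤ K') :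
    LowStr K' e F := by
  obtain ⟨l, h1, h2⟩ := h
  exact ⟨l, h1.trans hK, h2⟩

lemma LowStr.add {K K' e : ℕ} {F G : MvPolynomial σ ℂ} (h : LowStr K e F) (h' : LowStr K' e G) :
    LowStr (K + K') e (F + G) := by
  obtain ⟨l, h1, h2, h3⟩ := h
  obtain ⟨l', h1', h2', h3'⟩ := h'
  refine ⟨l ++ l', by simp; omega, ?_, by simp [h3, h3']⟩
  intro p hp
  rcases List.mem_append.1 hp with hp | hp
  · exact h2 p hp
  · exact h2' p hp

lemma LowStr.mul_left {K e : ℕ} {F : MvPolynomial σ ℂ} (h : LowStr K e F) (c : ℂ) :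
    LowStr K e (C c * F) := by
  obtain ⟨l, h1, h2, h3⟩ := h
  refine ⟨l.map fun p => (C c * p.1, p.2), by simpa using h1, ?_, ?_⟩
  · intro p hp
    obtain ⟨q, hq, rfl⟩ := List.mem_map.1 hp
    obtain ⟨a, b, ha, hb, hab, h4, h5⟩ := h2 q hq
    refine ⟨a, b, ha, hb, hab, ?_, h5⟩
    simpa using (isHomogeneous_C σ c).mul h4
  · rw [h3, ← List.sum_map_mul_left]; simp [Function.comp_def, mul_assoc]

lemma LowStr.single {a b : ℕ} {g h : MvPolynomial σ ℂ} (ha : 1 ≤ a) (hb : 1 ≤ b)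
    (hg : g.IsHomogeneous a) (hh : h.IsHomogeneous b) : LowStr 1 (a + b) (g * h) :=
  ⟨[(g, h)], by simp, by simpa using ⟨a, ha, b, hb, rfl, hg, hh⟩, by simp⟩

lemma LowStr.sum {ι : Type} (s : Finset ι) {e : ℕ} {F : ι → MvPolynomial σ ℂ}
    (h : ∀ i ∈ s, LowStr 1 e (F i)) : LowStr s.card e (∑ i ∈ s, F i) := by
  classical
  induction s using Finset.induction_on with
  | empty => simpa using LowStr.zero e
  | insert a s ha ih =>
    rw [Finset.sum_insert ha, Finset.card_insert_of_notMem ha, add_comm s.card]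
    exact (h a (by simp)).add (ih fun i hi => h i (by simp [hi]))

lemma LowStr.der (E : MvPolynomial σ ℂ →+ MvPolynomial σ ℂ) (hD : IsDer E)
    (hE : ∀ F e, F.IsHomogeneous e → (E F).IsHomogeneous (e + 1))
    {K e : ℕ} {F : MvPolynomial σ ℂ} (h : LowStr K e F) : LowStr (2 * K) (e + 1) (E F) := by
  obtain ⟨l, h1, h2, rfl⟩ := h
  suffices h : LowStr (2 * l.length) (e + 1) (E (l.map fun p => p.1 * p.2).sum) from
    h.mono (by omega)
  clear h1
  induction l with
  | nil => simpa using LowStr.zero (e + 1)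
  | cons p l ih =>
    obtain ⟨a, b, ha, hb, hab, h4, h5⟩ := h2 p (by simp)
    have := ih fun q hq => h2 q (by simp [hq])
    simp only [List.map_cons, List.sum_cons, map_add, hD _ _,
      List.length_cons]
    have h6 := (LowStr.single ha (by omega) h4 (hE _ _ h5))
    have h7 := (LowStr.single hb (by omega) h5 (hE _ _ h4))
    rw [show a + (b + 1) = e + 1 by omega] at h6
    rw [show b + (a + 1) = e + 1 by omega] at h7
    exact ((h6.add h7).add this).mono (by omega)
end
end

section
open MvPolynomial
set_option linter.unusedSectionVars false

/-- iteration bound -/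
def kk (W : ℕ) : ℕ → ℕ → ℕ
  | 0, K => K
  | p + 1, K => kk W p (2 * K + W)

lemma kk_mono (W p : ℕ) : ∀ K K', K ≤ K' → kk W p K ≤ kk W p K' := by
  induction p with
  | zero => intro K K' h; exact h
  | succ p ih => intro K K' h; exact ih _ _ (by omega)

lemma kk_mono_W (W W' p : ℕ) (hW : W ≤ W') : ∀ K, kk W p K ≤ kk W' p K := by
  induction p with
  | zero => intro K; exact le_rfl
  | succ p ih => intro K; exact (ih _).trans (kk_mono _ _ _ _ (by omega))

/-- multiindices of bounded degree -/
noncomputable def Bx (τ : Type) [Fintype τ] (d : ℕ) : Finset (τ →₀ ℕ) :=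
  (Finsupp.finite_of_degree_le (σ := τ) d).toFinset

lemma mem_Bx {τ : Type} [Fintype τ] {d : ℕ} {α : τ →₀ ℕ} : α ∈ Bx τ d ↔ α.degree ≤ d := by
  simp [Bx]

section
variable {σ τ ι : Type} [Fintype σ] [Fintype τ] [Fintype ι]

lemma coeff_zero_Phi (v : τ → σ → ℂ) (f : MvPolynomial σ ℂ) : coeff 0 (Phi v f) = f := by
  have : (constantCoeff.comp (Phi v).toRingHom) = RingHom.id (MvPolynomial σ ℂ) := by
    ext i
    · simp [Phi]
    · simp [Phi]
  exact congrArg (fun g => g f) this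

lemma Strong.mono {N N' : ℕ} {e : ι → ℕ} {f : ι → MvPolynomial σ ℂ} (h : Strong N' e f)
    (hN : N ≤ N') : Strong N e f :=
  fun e0 c h1 h2 h3 => h e0 c h1 h2 (h3.mono hN)

/-- Generic data for a family -/
def GenVec [DecidableEq τ] (f : ι → MvPolynomial σ ℂ) (v : τ → σ → ℂ) : Prop :=
  ∀ a, ∃ E : MvPolynomial σ ℂ →+ MvPolynomial σ ℂ, IsDer E ∧ (∀ i, E (X i) = 0) ∧
    (∀ F e, F.IsHomogeneous e → (E F).IsHomogeneous (e + 1)) ∧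
    (∀ b i, E (C (v b i)) = if b = a then X i else 0) ∧ (∀ j m, E (C (coeff m (f j))) = 0)

lemma exists_genVec [DecidableEq τ] (f : ι → MvPolynomial σ ℂ) : ∃ v : τ → σ → ℂ, GenVec f v := by
  classical
  let Z : Set ℂ := ⋃ j, ((f j).coeffs : Set ℂ)
  have hZ : Z.Countable := Set.countable_iUnion fun j => (f j).coeffs.countable_toSet
  obtain ⟨t, ht⟩ := exists_generic Z hZ (τ × σ)
  refine ⟨fun b i => t (b, i), fun a => ?_⟩
  choose δ h0 h1 h2 using fun i : σ => ht (a, i)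
  obtain ⟨E, hD, hX, hC, hh⟩ := exists_E (fun i => ((δ i).toLinearMap.toAddMonoidHom))
    (fun i x y => (δ i).leibniz x y)
  refine ⟨E, hD, hX, hh, ?_, ?_⟩
  · intro b i
    rw [hC]
    have : ∀ x, (δ x) (t (b, i)) = if b = a ∧ i = x then 1 else 0 := by
      intro x
      split_ifs with h
      · rw [h.1, h.2, h1]
      · rw [h2]; intro h'; exact h (by simpa using h')
    have h3 : ∀ x, (δ x).toLinearMap.toAddMonoidHom (t (b, i)) = if b = a ∧ i = x then 1 else 0 :=
      this
    simp only [h3]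
    by_cases hb : b = a <;> simp [hb, apply_ite (C : ℂ → MvPolynomial σ ℂ)]
  · intro j m
    rw [hC]
    refine Finset.sum_eq_zero fun i _ => ?_
    by_cases hm : coeff m (f j) = 0
    · simp [hm]
    · have : coeff m (f j) ∈ Z := by
        refine Set.mem_iUnion.2 ⟨j, ?_⟩
        exact coeff_mem_coeffs m hm
      have h3 : (δ i).toLinearMap.toAddMonoidHom (coeff m (f j)) = 0 := h0 i _ this
      simp [h3]

lemma D_iter [DecidableEq τ] (e : ι → ℕ) (f : ι → MvPolynomial σ ℂ)
    (hf : ∀ j, (f j).IsHomogeneous (e j))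
    (d : ℕ) (hd : ∀ j, e j ≤ d) (v : τ → σ → ℂ) (hv : GenVec f v) (p : ℕ) :
    ∀ (K e0 : ℕ) (c : ι → (τ →₀ ℕ) → ℂ), 1 ≤ e0 →
      (∀ j α, c j α ≠ 0 → e0 + α.degree = e j ∧ α.degree ≤ p) → (∃ j α, c j α ≠ 0) →
      LowStr K e0 (∑ j, ∑ α ∈ Bx τ d, C (c j α) * coeff α (Phi v (f j))) →
      ¬ Strong (kk (Fintype.card ι * (Bx τ d).card) p K) e f := by
  classical
  induction p with
  | zero =>
    intro K e0 c he0 hc hne hlow hstr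
    have h0 : ∀ j α, α ≠ 0 → c j α = 0 := by
      intro j α hα
      by_contra h
      have := (hc j α h).2
      apply hα
      have h2 : α.degree = 0 := by omega
      rwa [Finsupp.degree_eq_zero_iff] at h2
    refine hstr e0 (fun j => c j 0) ?_ ?_ ?_
    · intro j hj
      by_contra h
      have := (hc j 0 h).1
      simp at this; omega
    · obtain ⟨j, α, h⟩ := hne
      intro h'
      have : α = 0 := by by_contra hα; exact h (h0 j α hα)
      subst this
      exact h (congrFun h' j)
    · convert! hlow using 2 with j
      rw [Finset.sum_eq_single 0]
      · rw [coeff_zero_Phi]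
      · intro α _ hα; rw [h0 j α hα]; simp
      · intro h; exact absurd (mem_Bx.2 (by simp)) h
  | succ p ih =>
    intro K e0 c he0 hc hne hlow hstr
    by_cases hp : ∀ j α, c j α ≠ 0 → α.degree ≤ p
    · exact ih (2 * K + Fintype.card ι * (Bx τ d).card) e0 c he0
        (fun j α h => ⟨(hc j α h).1, hp j α h⟩) hne (hlow.mono (by omega)) hstr
    push Not at hp
    obtain ⟨j0, α0, h0, hα0⟩ := hp
    obtain ⟨a, ha⟩ : ∃ a, α0 a ≠ 0 := by
      by_contra h
      push Not at h
      have : α0 = 0 := Finsupp.ext h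
      simp [this] at hα0
    obtain ⟨E, hD, hX, hh, hEv, hEf⟩ := hv a
    have hdeg : ∀ β : τ →₀ ℕ, (β + Finsupp.single a 1).degree = β.degree + 1 := by
      intro β; simp
    have hsub : ∀ α : τ →₀ ℕ, α a ≠ 0 → α - Finsupp.single a 1 + Finsupp.single a 1 = α := by
      intro α h
      apply tsub_add_cancel_of_le
      rw [Finsupp.single_le_iff]; omega
    let c' : ι → (τ →₀ ℕ) → ℂ := fun j β => (((e0 + 1 : ℕ)) : ℂ) * c j (β + Finsupp.single a 1)
    have hcc : ∀ j β, c' j β ≠ 0 → c j (β + Finsupp.single a 1) ≠ 0 :=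
      fun j β h => right_ne_zero_of_mul h
    refine ih (2 * K + Fintype.card ι * (Bx τ d).card) (e0 + 1) c' (by omega) ?_ ?_ ?_ hstr
    · intro j β h
      have := hc j _ (hcc j β h)
      rw [hdeg] at this
      omega
    · refine ⟨j0, α0 - Finsupp.single a 1, ?_⟩
      have : c' j0 (α0 - Finsupp.single a 1) = ((e0 + 1 : ℕ) : ℂ) * c j0 α0 := by
        simp only [c', hsub _ ha]
      rw [this]
      exact mul_ne_zero (by exact_mod_cast Nat.succ_ne_zero e0) h0
    · have key : ∑ j, ∑ α ∈ Bx τ d, C (c' j α) * coeff α (Phi v (f j)) =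
          E (∑ j, ∑ α ∈ Bx τ d, C (c j α) * coeff α (Phi v (f j))) +
          ∑ x ∈ (Finset.univ ×ˢ Bx τ d), (C (-1) * E (C (c x.1 x.2))) *
            coeff x.2 (Phi v (f x.1)) := by
        rw [Finset.sum_product, map_sum, ← Finset.sum_add_distrib]
        refine Finset.sum_congr rfl fun j _ => ?_
        rw [map_sum, ← Finset.sum_add_distrib]
        have : ∀ α ∈ Bx τ d, E (C (c j α) * coeff α (Phi v (f j))) +
            (C (-1) * E (C (c j α))) * coeff α (Phi v (f j)) =
            C (c j α) * (if α a = 0 then 0 else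
      C ((e0 + 1 : ℕ) : ℂ) * coeff (α - Finsupp.single a 1) (Phi v (f j))) := by
          intro α _
          by_cases hz : c j α = 0
          · simp [hz]
          · rw [hD, E_Dop E hD hX v a hEv (f j) (hEf j) (e j) (hf j) α e0 (hc j α hz).1]
            simp; ring
        rw [Finset.sum_congr rfl this]
        symm
        have hz : ∀ α, C (c j α) * (if α a = 0 then 0 else C ((e0 + 1 : ℕ) : ℂ) *
            coeff (α - Finsupp.single a 1) (Phi v (f j))) ≠ 0 → c j α ≠ 0 ∧ α a ≠ 0 := by
          intro α h
          constructor
          · intro h'; simp [h'] at h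
          · intro h'; simp [h'] at h
        refine Finset.sum_bij_ne_zero (fun α _ _ => α - Finsupp.single a 1) ?_ ?_ ?_ ?_
        · intro α hα h
          have h1 := hdeg (α - Finsupp.single a 1)
          rw [hsub α (hz α h).2] at h1
          rw [mem_Bx] at hα ⊢
          omega
        · intro α _ h α' _ h' heq
          rw [← hsub α (hz α h).2, heq, hsub α' (hz α' h').2]
        · intro β hβ h
          have h1 : c' j β ≠ 0 := by
            intro h'; simp [h'] at h
          have h2 := hcc j β h1
          have h4 : C (c j (β + Finsupp.single a 1)) * (if (β + Finsupp.single a 1 : τ →₀ ℕ) a = 0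
              then 0 else
            C ((e0 + 1 : ℕ) : ℂ) *
            coeff (β + Finsupp.single a 1 - Finsupp.single a 1) (Phi v (f j)))
             = C (c' j β) * coeff β (Phi v (f j)) := by
            rw [if_neg (by simp), add_tsub_cancel_right]; simp only [c', map_mul]; ring
          refine ⟨β + Finsupp.single a 1, ?_, ?_, by simp⟩
          · rw [mem_Bx]
            have := (hc j _ h2).1
            have := hd j
            omega
          · rw [h4]; exact h
        · intro α _ h
          rw [if_neg (hz α h).2]
          simp only [c', hsub α (hz α h).2, map_mul]
          ring
      rw [key]
      refine (hlow.der E hD hh).add ?_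
      have hcard : Fintype.card ι * (Bx τ d).card = ((Finset.univ : Finset ι) ×ˢ Bx τ d).card := by
        rw [Finset.card_product]; rfl
      rw [hcard]
      refine LowStr.sum _ fun x hx => ?_
      by_cases hz : c x.1 x.2 = 0
      · rw [hz]; simpa using (LowStr.zero (e0 + 1)).mono (Nat.zero_le 1)
      · rw [add_comm e0]
        refine LowStr.single le_rfl he0 ?_ (Dop_hom v _ (e x.1) (hf _) _ _ (hc _ _ hz).1)
        simpa using (isHomogeneous_C σ (-1 : ℂ)).mul (hh _ _ (isHomogeneous_C σ (c x.1 x.2)))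
end
end

section
open MvPolynomial
set_option linter.unusedSectionVars false

lemma height_origin (τ : Type) [Fintype τ] :
    (Fintype.card τ : ℕ∞) ≤ (vanishingIdeal ℂ {(0 : τ → ℂ)} : Ideal (MvPolynomial τ ℂ)).height := by
  have hdim : ringKrullDim (MvPolynomial τ ℂ) = Fintype.card τ := by
    rw [MvPolynomial.ringKrullDim_of_isNoetherianRing]; simp
  have : FiniteRingKrullDim (MvPolynomial τ ℂ) := by
    rw [finiteRingKrullDim_iff_ne_bot_and_top, hdim]
    exact ⟨by simp, by rw [← WithBot.coe_natCast]; intro h; exact ENat.natCast_ne_top _ (WithBot.coe_injective h)⟩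
  obtain ⟨p, hp, hh⟩ := Ideal.exists_isMaximal_height (R := MvPolynomial τ ℂ)
  obtain ⟨x, rfl⟩ := isMaximal_iff_eq_vanishingIdeal_singleton.1 hp
  let e : MvPolynomial τ ℂ ≃ₐ[ℂ] MvPolynomial τ ℂ := AlgEquiv.ofAlgHom
    (aeval fun i => X i + C (x i)) (aeval fun i => X i - C (x i))
    (by ext i; simp [← algebraMap_eq]) (by ext i; simp [← algebraMap_eq])
  have : (vanishingIdeal ℂ {(0 : τ → ℂ)} : Ideal (MvPolynomial τ ℂ)).comap e.toRingEquiv =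
      vanishingIdeal ℂ {x} := by
    ext p
    rw [Ideal.mem_comap, mem_vanishingIdeal_singleton_iff, mem_vanishingIdeal_singleton_iff]
    have : ((aeval (0 : τ → ℂ)).comp e.toAlgHom) = aeval (R := ℂ) x := by
      ext i; simp [e]
    rw [← this]; rfl
  rw [← RingEquiv.height_comap e.toRingEquiv, this]
  rw [hdim] at hh
  apply le_of_eq
  exact_mod_cast hh.symm

lemma common_zero {τ ι : Type} [Fintype τ] [Fintype ι] (hc : Fintype.card ι < Fintype.card τ)
    (e : ι → ℕ) (he : ∀ j, 1 ≤ e j) (g : ι → MvPolynomial τ ℂ)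
    (hg : ∀ j, (g j).IsHomogeneous (e j)) : ∃ B : τ → ℂ, B ≠ 0 ∧ ∀ j, eval B (g j) = 0 := by
  by_contra hcon
  push Not at hcon
  set I := Ideal.span (Set.range g)
  have h0 : zeroLocus ℂ I = {0} := by
    rw [zeroLocus_span]
    ext x
    simp only [Set.mem_range, forall_exists_index, forall_apply_eq_imp_iff, Set.mem_ofPred_eq,
      Set.mem_singleton_iff]
    constructor
    · intro h
      by_contra hx
      obtain ⟨j, hj⟩ := hcon x hx
      exact hj (h j)
    · rintro rfl j
      rw [aeval_zero, constantCoeff_eq, (hg j).coeff_eq_zero (by have := he j; simp; omega), map_zero]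
  have hr := vanishingIdeal_zeroLocus_eq_radical (K := ℂ) I
  rw [h0] at hr
  have hm : (vanishingIdeal ℂ {(0 : τ → ℂ)} : Ideal (MvPolynomial τ ℂ)) ∈ I.minimalPrimes := by
    have hmax : (vanishingIdeal ℂ {(0 : τ → ℂ)} : Ideal (MvPolynomial τ ℂ)).IsMaximal :=
      isMaximal_iff_eq_vanishingIdeal_singleton.2 ⟨_, rfl⟩
    refine ⟨⟨hmax.isPrime, hr ▸ Ideal.le_radical⟩, ?_⟩
    rintro q ⟨hq, hq'⟩ _
    rw [hr]
    exact hq.radical_le_iff.2 hq'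
  have h1 := Ideal.height_le_card_of_mem_minimalPrimes_span (Set.finite_range g) hm
  have h2 := (height_origin τ).trans h1
  have h3 : (Set.range g).ncard ≤ Fintype.card ι := by
    rw [← Set.image_univ]
    refine (Set.ncard_image_le Set.finite_univ).trans ?_
    simp [Set.ncard_univ]
  have : Fintype.card τ ≤ (Set.range g).ncard := by exact_mod_cast h2
  omega

section
variable {σ τ ι : Type} [Fintype σ] [Fintype τ] [Fintype ι]

/-- Taylor expansion in a direction -/
noncomputable def Psi (v : σ → ℂ) : MvPolynomial σ ℂ →ₐ[ℂ] Polynomial (MvPolynomial σ ℂ) :=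
  aeval (fun i => Polynomial.C (X i) + Polynomial.X * Polynomial.C (C (v i)))

lemma Psi_eq (v : τ → σ → ℂ) (B : τ → ℂ) (f : MvPolynomial σ ℂ) :
    Psi (fun i => ∑ b, B b * v b i) f =
      eval₂ Polynomial.C (fun b => Polynomial.C (C (B b)) * Polynomial.X) (Phi v f) := by
  have : (Psi (fun i => ∑ b, B b * v b i)).toRingHom =
    (eval₂Hom Polynomial.C (fun b => Polynomial.C (C (B b)) * Polynomial.X)).comp
      (Phi v).toRingHom := by
    refine MvPolynomial.ringHom_ext (fun r => ?_) (fun i => ?_)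
    · simp [Psi, Phi]
    · simp only [Psi, Phi, AlgHom.toRingHom_eq_coe, RingHom.coe_coe, aeval_X, RingHom.comp_apply,
        map_add, map_sum, map_mul, coe_eval₂Hom, eval₂_C, eval₂_X, Finset.mul_sum]
      refine congrArg _ (Finset.sum_congr rfl fun b _ => ?_)
      rw [← mul_assoc, mul_comm Polynomial.X]
  exact congrArg (fun g => g f) this

lemma Psi_coeff (v : τ → σ → ℂ) (B : τ → ℂ) (f : MvPolynomial σ ℂ) (d p : ℕ) (hp : p ≤ d) :
    (Psi (fun i => ∑ b, B b * v b i) f).coeff p =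
      ∑ α ∈ Bx τ d, if α.degree = p then C (α.prod fun b n => B b ^ n) * coeff α (Phi v f)
        else 0 := by
  classical
  rw [Psi_eq, eval₂_eq', Polynomial.finsetSum_coeff]
  have key : ∀ α : τ →₀ ℕ, (Polynomial.C (coeff α (Phi v f)) *
      ∏ i, (Polynomial.C (C (B i)) * Polynomial.X) ^ α i).coeff p =
      if α.degree = p then C (α.prod fun b n => B b ^ n) * coeff α (Phi v f) else 0 := by
    intro α
    have : ∏ i, (Polynomial.C (C (B i)) * Polynomial.X) ^ α i =
      Polynomial.C (C (α.prod fun b n => B b ^ n)) *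
        (Polynomial.X : Polynomial (MvPolynomial σ ℂ)) ^ α.degree := by
      simp only [mul_pow, Finset.prod_mul_distrib]
      rw [Finset.prod_pow_eq_pow_sum, Finsupp.degree_eq_sum, Finsupp.prod_fintype _ _ (by simp)]
      simp [map_prod]
    rw [this, Polynomial.coeff_C_mul, Polynomial.coeff_C_mul_X_pow]
    simp only [eq_comm (a := p)]
    split_ifs <;> ring
  simp only [key]
  rw [Finset.sum_subset (Finset.subset_union_left (s₂ := Bx τ d))]
  · symm
    refine Finset.sum_subset Finset.subset_union_right ?_
    intro α _ h2
    rw [if_neg]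
    intro h; exact h2 (mem_Bx.2 (by omega))
  · intro α _ h2
    rw [notMem_support_iff.1 h2]; simp

lemma Psi_subst {S : Type} [CommRing S] [Algebra ℂ S] (ψ : σ → S) (u : S) (v : σ → ℂ)
    (f : MvPolynomial σ ℂ) :
    aeval (fun i => ψ i + u * algebraMap ℂ S (v i)) f =
      Polynomial.eval₂ (aeval ψ : MvPolynomial σ ℂ →ₐ[ℂ] S).toRingHom u (Psi v f) := by
  have : (aeval (fun i => ψ i + u * algebraMap ℂ S (v i)) : MvPolynomial σ ℂ →ₐ[ℂ] S).toRingHom =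
    (Polynomial.eval₂RingHom (aeval ψ : MvPolynomial σ ℂ →ₐ[ℂ] S).toRingHom u).comp
      (Psi v).toRingHom := by
    ext i : 2
    · simp [Psi]
    · simp [Psi]; ring
  exact congrArg (fun g => g f) this

lemma Psi_hom (v : σ → ℂ) (f : MvPolynomial σ ℂ) (e : ℕ) (hf : f.IsHomogeneous e) (p k : ℕ)
    (h : k + p = e) : ((Psi v f).coeff p).IsHomogeneous k := by
  have := Psi_coeff (τ := Unit) (fun _ => v) (fun _ => 1) f p p le_rfl
  simp only [Finset.univ_unique, one_mul, Finset.sum_singleton] at this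
  change (Psi v f).coeff p = _ at this
  rw [this]
  refine IsHomogeneous.sum _ _ _ fun α _ => ?_
  split_ifs with hα
  · rw [← zero_add k]
    exact (isHomogeneous_C _ _).mul (Dop_hom _ _ e hf _ _ (by omega))
  · exact isHomogeneous_zero _ _ _

lemma Psi_zero_of_lt (v : σ → ℂ) (f : MvPolynomial σ ℂ) (e : ℕ) (hf : f.IsHomogeneous e) (p : ℕ)
    (h : e < p) : (Psi v f).coeff p = 0 := by
  have := Psi_coeff (τ := Unit) (fun _ => v) (fun _ => 1) f p p le_rfl
  simp only [Finset.univ_unique, one_mul, Finset.sum_singleton] at this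
  change (Psi v f).coeff p = _ at this
  rw [this]
  refine Finset.sum_eq_zero fun α _ => ?_
  split_ifs with hα
  · rw [Dop_zero_of_lt _ _ e hf _ (by omega), mul_zero]
  · rfl

lemma Psi_coeff_zero (v : σ → ℂ) (f : MvPolynomial σ ℂ) : (Psi v f).coeff 0 = f := by
  have := Psi_subst (S := MvPolynomial σ ℂ) X 0 v f
  simp only [zero_mul, add_zero, aeval_X_left, AlgHom.id_apply] at this
  rw [Polynomial.eval₂_at_zero] at this
  exact this.symm

lemma Psi_coeff_top (v : σ → ℂ) (f : MvPolynomial σ ℂ) (e : ℕ) (hf : f.IsHomogeneous e)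
    (h0 : eval v f = 0) : (Psi v f).coeff e = 0 := by
  have h1 := Psi_hom v f e hf e 0 (by omega)
  have hC : (Psi v f).coeff e = C (coeff 0 ((Psi v f).coeff e)) :=
    totalDegree_eq_zero_iff_eq_C.1 (by
      rcases eq_or_ne ((Psi v f).coeff e) 0 with h | h
      · simp [h]
      · exact h1.totalDegree h)
  have := Psi_subst (S := ℂ) (fun _ => 0) 1 v f
  simp only [one_mul, zero_add, Algebra.algebraMap_self, RingHom.id_apply] at this
  have hev : aeval (fun i => v i) f = eval v f := by rw [← MvPolynomial.coe_aeval_eq_eval]; rfl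
  rw [hev, h0, Polynomial.eval₂_eq_sum_range' _ (n := e + 1)] at this
  · rw [Finset.sum_eq_single e] at this
    · rw [hC] at this ⊢
      simp at this
      rw [← this]; simp
    · intro p hp hne
      have hh := Psi_hom v f e hf p (e - p) (by simp at hp; omega)
      simp only [one_pow, mul_one]
      have h3 : (aeval (fun _ => 0) : MvPolynomial σ ℂ →ₐ[ℂ] ℂ) ((Psi v f).coeff p) =
        constantCoeff ((Psi v f).coeff p) := by
        have := aeval_zero' (S₁ := ℂ) ((Psi v f).coeff p)
        simpa using this
      refine h3.trans ?_
      rw [constantCoeff_eq, hh.coeff_eq_zero]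
      simp at hp ⊢; omega
    · simp
  · refine lt_of_le_of_lt (Polynomial.natDegree_le_iff_coeff_eq_zero.2 fun N hN => ?_)
      (Nat.lt_succ_self e)
    exact Psi_zero_of_lt v f e hf N hN

end

lemma V1 (s d N : ℕ) : ∃ N', ∀ (σ ι : Type) [Fintype σ] [Fintype ι] (e : ι → ℕ)
    (f : ι → MvPolynomial σ ℂ), Fintype.card ι ≤ s → (∀ j, 1 ≤ e j) → (∀ j, e j ≤ d) →
    (∀ j, (f j).IsHomogeneous (e j)) → Strong N' e f →
    ∃ v : σ → ℂ, (∀ j, eval v (f j) = 0) ∧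
      Strong N (fun x : Σ j, Fin (e j) => e x.1 - x.2)
        (fun x : Σ j, Fin (e j) => (Psi v (f x.1)).coeff x.2) := by
  classical
  refine ⟨kk (s * (Bx (Fin (s+1)) d).card) d N, ?_⟩
  intro σ ι _ _ e f hs he1 hd hf hS
  obtain ⟨v, hv⟩ := exists_genVec (τ := Fin (s+1)) f
  obtain ⟨B, hB, hz⟩ := common_zero (τ := Fin (s+1)) (ι := ι) (by simp; omega) e he1
    (fun j => aeval (fun i => ∑ b, X b * C (v b i)) (f j)) (fun j => by
      have := (hf j).aeval (φ := f j) (g := fun i => ∑ b : Fin (s+1), X b * C (v b i)) (n := 1) (fun i =>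
        IsHomogeneous.sum _ _ _ fun b _ => by
          simpa using (isHomogeneous_X ℂ b).mul (isHomogeneous_C (Fin (s+1)) (v b i)))
      simpa using this)
  refine ⟨fun i => ∑ b, B b * v b i, fun j => ?_, ?_⟩
  · rw [← hz j]
    rw [← MvPolynomial.coe_aeval_eq_eval, ← MvPolynomial.coe_aeval_eq_eval]
    have : (aeval (fun i => ∑ b, B b * v b i) : MvPolynomial σ ℂ →ₐ[ℂ] ℂ) =
      (aeval B).comp (aeval (fun i => ∑ b, X b * C (v b i))) := by
      ext i; simp
    exact congrArg (fun g => g (f j)) this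
  intro e0 c hc hc0 hL
  obtain ⟨⟨j0, p0⟩, hjp⟩ := Function.ne_iff.1 hc0
  simp only [Pi.zero_apply] at hjp
  have hdeg : ∀ x, c x ≠ 0 → e x.1 - x.2 = e0 := fun x hx => by
    by_contra h; exact hx (hc x h)
  obtain ⟨b0, hb0⟩ := Function.ne_iff.1 hB
  simp only [Pi.zero_apply] at hb0
  set c' : ι → (Fin (s+1) →₀ ℕ) → ℂ := fun j α =>
    if h : α.degree < e j then c ⟨j, ⟨α.degree, h⟩⟩ * α.prod (fun b n => B b ^ n) else 0 with hc'
  refine D_iter e f hf d hd v hv d N e0 c' ?_ ?_ ?_ ?_ (hS.mono (kk_mono_W _ _ _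
    (Nat.mul_le_mul_right _ hs) _))
  · have := hdeg _ hjp
    have := p0.2
    simp at *; omega
  · intro j α h
    simp only [hc'] at h
    split_ifs at h with h1
    · have := hdeg _ (left_ne_zero_of_mul h)
      have := hd j
      simp at *; omega
    · exact absurd rfl h
  · refine ⟨j0, Finsupp.single b0 p0, ?_⟩
    have h1 : (Finsupp.single b0 (p0 : ℕ)).degree = p0 := by simp
    simp only [hc', h1, p0.2, dite_true, Fin.eta]
    refine mul_ne_zero hjp ?_
    rw [Finsupp.prod_single_index (by simp)]
    exact pow_ne_zero _ hb0
  · convert! hL using 1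
    rw [Fintype.sum_sigma]
    refine Finset.sum_congr rfl fun j _ => ?_
    simp only
    have : ∀ p : Fin (e j), (Psi (fun i => ∑ b, B b * v b i) (f j)).coeff p = _ :=
      fun p => Psi_coeff v B (f j) d p (by have := p.2; have := hd j; omega)
    simp only [this, Finset.mul_sum]
    rw [Finset.sum_comm]
    refine Finset.sum_congr rfl fun α _ => ?_
    by_cases h : α.degree < e j
    · rw [Finset.sum_eq_single ⟨α.degree, h⟩]
      · simp only [hc', h, dite_true, if_true, map_mul]; ring
      · intro p _ hp
        rw [if_neg, mul_zero]
        intro h5; exact hp (Fin.ext h5.symm)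
      · simp
    · simp only [hc', h, dite_false, map_zero, zero_mul]
      refine (Finset.sum_eq_zero fun p _ => ?_).symm
      rw [if_neg, mul_zero]
      have := p.2; omega
end

section
open MvPolynomial
set_option linter.unusedSectionVars false

lemma Strong.comp {σ ι κ : Type} [Fintype σ] [Fintype ι] [Fintype κ] {N : ℕ} {e : ι → ℕ}
    {f : ι → MvPolynomial σ ℂ} (h : Strong N e f) (u : κ → ι) (hu : Function.Injective u) :
    Strong N (fun x => e (u x)) (fun x => f (u x)) := by
  classical
  intro e0 c h1 h2 h3
  have hs : ∀ x, Function.extend u c 0 (u x) = c x := fun x => hu.extend_apply _ _ _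
  have hs' : ∀ j, (¬ ∃ x, u x = j) → Function.extend u c 0 j = 0 := fun j hj => by
    rw [Function.extend_apply' _ _ _ hj]; rfl
  refine h e0 (Function.extend u c 0) ?_ ?_ ?_
  · intro j hj
    by_cases hx : ∃ x, u x = j
    · obtain ⟨x, rfl⟩ := hx
      rw [hs]; exact h1 x hj
    · exact hs' j hx
  · obtain ⟨x, hx⟩ := Function.ne_iff.1 h2
    refine Function.ne_iff.2 ⟨u x, ?_⟩
    rw [hs]; exact hx
  · convert! h3 using 1
    rw [← Finset.sum_subset (Finset.subset_univ (Finset.univ.image u)), Finset.sum_image hu.injOn]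
    · simp only [hs]
    · intro j _ hj
      rw [hs' j (by simpa using hj)]; simp

/-- universality in degree at most `d` -/
def Uni (d : ℕ) : Prop := ∀ s m : ℕ, ∃ N, ∀ (σ ι : Type) [Fintype σ] [Fintype ι] (e : ι → ℕ)
    (f : ι → MvPolynomial σ ℂ), Fintype.card ι ≤ s → (∀ j, 1 ≤ e j) → (∀ j, e j ≤ d) →
    (∀ j, (f j).IsHomogeneous (e j)) → Strong N e f →
    ∀ g : ι → MvPolynomial (Fin m) ℂ, (∀ j, (g j).IsHomogeneous (e j)) →
    ∃ φ : σ → MvPolynomial (Fin m) ℂ, (∀ i, (φ i).IsHomogeneous 1) ∧ ∀ j, aeval φ (f j) = g j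

lemma deg_one {σ : Type} (m : σ →₀ ℕ) (hm : m.degree = 1) : ∃ i, m = Finsupp.single i 1 := by
  classical
  obtain ⟨i, hi⟩ : ∃ i, m i ≠ 0 := by
    by_contra hcon
    push Not at hcon
    have : m = 0 := Finsupp.ext hcon
    rw [this] at hm; simp at hm
  have h1 : (m - Finsupp.single i 1) + Finsupp.single i 1 = m :=
    tsub_add_cancel_of_le (by simp; omega)
  have h2 := congrArg Finsupp.degree h1
  rw [map_add, Finsupp.degree_single, hm] at h2
  have h3 : (m - Finsupp.single i 1) = 0 := (Finsupp.degree_eq_zero_iff _).1 (by omega)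
  rw [h3, zero_add] at h1
  exact ⟨i, h1.symm⟩

lemma hom_aux {σ : Type} (a b : ℂ) (i : σ) :
    (C a * X i * algebraMap ℂ (MvPolynomial σ ℂ) b).IsHomogeneous 1 := by
  have := ((isHomogeneous_C σ a).mul (isHomogeneous_X ℂ i)).mul (isHomogeneous_C σ b)
  exact this

lemma lin_eq {σ : Type} [Fintype σ] (f : MvPolynomial σ ℂ) (hf : f.IsHomogeneous 1) :
    f = ∑ i, C (coeff (Finsupp.single i 1) f) * X i := by
  classical
  ext m
  simp only [coeff_sum, coeff_C_mul, coeff_X]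
  by_cases hm : m.degree = 1
  · obtain ⟨i, rfl⟩ := deg_one m hm
    rw [Finset.sum_eq_single i]
    · simp
    · intro b _ hb
      rw [if_neg, mul_zero]
      intro h; exact hb ((Finsupp.single_left_inj one_ne_zero).1 h)
    · simp
  · rw [hf.coeff_eq_zero hm, Finset.sum_eq_zero]
    intro i _
    rw [if_neg, mul_zero]
    rintro rfl; simp at hm

lemma Uni_one : Uni 1 := by
  classical
  intro s m
  refine ⟨0, ?_⟩
  intro σ ι _ _ e f _ he1 hd hf hS g hg
  have he : ∀ j, e j = 1 := fun j => le_antisymm (hd j) (he1 j)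
  obtain rfl : e = fun _ => 1 := funext he
  let A : Matrix ι σ ℂ := fun j i => coeff (Finsupp.single i 1) (f j)
  have hli : LinearIndependent ℂ A.row := by
    rw [Fintype.linearIndependent_iff]
    intro c hc
    by_contra hne
    push Not at hne
    obtain ⟨j0, hj0⟩ := hne
    refine hS 1 c (fun j h => absurd rfl h) (Function.ne_iff.2 ⟨j0, hj0⟩) ?_
    have : ∑ j, C (c j) * f j = 0 := by
      have : ∀ j, C (c j) * f j = ∑ i, C (c j * A j i) * X i := by
        intro j
        conv_lhs => rw [lin_eq (f j) (hf j), Finset.mul_sum]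
        simp [A, mul_assoc]
      simp only [this]
      rw [Finset.sum_comm]
      refine Finset.sum_eq_zero fun i _ => ?_
      rw [← Finset.sum_mul, ← map_sum]
      have := congrFun hc i
      simp only [Finset.sum_apply, Pi.smul_apply, smul_eq_mul, Pi.zero_apply, Matrix.row] at this
      rw [this]; simp
    rw [this]; exact LowStr.zero 1
  have hsurj : Function.Surjective A.mulVecLin := by
    rw [← LinearMap.range_eq_top]
    apply Submodule.eq_top_of_finrank_eq
    have := hli.rank_matrix
    rw [Matrix.rank] at this
    simpa using this
  choose u hu using fun j : ι => hsurj (Pi.single j 1)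
  refine ⟨fun i => ∑ j, C (u j i) * g j, fun i => IsHomogeneous.sum _ _ _ fun j _ => ?_, fun j => ?_⟩
  · simpa using (isHomogeneous_C _ _).mul (hg j)
  · conv_lhs => rw [lin_eq (f j) (hf j)]
    simp only [map_sum, map_mul, aeval_X, aeval_C, Finset.mul_sum]
    rw [Finset.sum_comm]
    have : ∀ j', ∑ i, A j i * u j' i = if j' = j then 1 else 0 := by
      intro j'
      have := congrFun (hu j') j
      simpa [Matrix.mulVec, dotProduct, Pi.single_apply, eq_comm] using this
    have h2 : ∀ j', ∑ i, (algebraMap ℂ (MvPolynomial (Fin m) ℂ)) (coeff (Finsupp.single i 1) (f j)) *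
        (C (u j' i) * g j') = C (∑ i, A j i * u j' i) * g j' := by
      intro j'
      rw [map_sum, Finset.sum_mul]
      refine Finset.sum_congr rfl fun i _ => ?_
      simp [A, mul_assoc, algebraMap_eq]
    simp only [h2, this]
    simp

set_option maxHeartbeats 800000 in
lemma Uni_step (d : ℕ) (hd2 : 2 ≤ d) (ih : Uni (d - 1)) : Uni d := by
  classical
  intro s0 m
  have inner : ∀ q s : ℕ, ∃ N, ∀ (σ ι : Type) [Fintype σ] [Fintype ι] (e : ι → ℕ)
    (f : ι → MvPolynomial σ ℂ), Fintype.card ι ≤ s → (∀ j, 1 ≤ e j) → (∀ j, e j ≤ d) →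
    (∀ j, (f j).IsHomogeneous (e j)) → Strong N e f →
    ∀ g : ι → MvPolynomial (Fin m) ℂ, (∀ j, (g j).IsHomogeneous (e j)) →
    ∀ Rs : Finset (ι × (Fin m →₀ ℕ)), Rs.card = q → (∀ x ∈ Rs, e x.1 = d ∧ x.2.degree = d) →
    ∃ φ : σ → MvPolynomial (Fin m) ℂ, (∀ i, (φ i).IsHomogeneous 1) ∧
      (∀ j, e j < d → aeval φ (f j) = g j) ∧
      ∀ x ∈ Rs, coeff x.2 (aeval φ (f x.1)) = coeff x.2 (g x.1) := by
    intro q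
    induction q with
    | zero =>
      intro s
      obtain ⟨N, hN⟩ := ih s m
      refine ⟨N, ?_⟩
      intro σ ι _ _ e f hs he1 hd hf hS g hg Rs hRs _
      obtain ⟨φ, h1, h2⟩ := hN σ {j : ι // e j < d} (fun x => e x.1) (fun x => f x.1)
        ((Fintype.card_subtype_le _).trans hs) (fun _ => he1 _) (fun x => by have := x.2; omega)
        (fun _ => hf _) (hS.comp _ Subtype.val_injective) (fun x => g x.1) (fun _ => hg _)
      refine ⟨φ, h1, fun j hj => h2 ⟨j, hj⟩, ?_⟩
      rw [Finset.card_eq_zero] at hRs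
      simp [hRs]
    | succ q ihq =>
      intro s
      obtain ⟨N1, hN1⟩ := ihq (s * d)
      obtain ⟨N', hN'⟩ := V1 s d N1
      refine ⟨N', ?_⟩
      intro σ ι _ _ e f hs he1 hd hf hS g hg Rs hRs hRd
      obtain ⟨v, hv0, hvS⟩ := hN' σ ι e f hs he1 hd hf hS
      obtain ⟨⟨j0, γ0⟩, hx0⟩ : Rs.Nonempty := Finset.card_pos.1 (by omega)
      obtain ⟨hj0, hγ0⟩ := hRd _ hx0
      simp only at hj0 hγ0
      obtain ⟨i0, hi0⟩ : ∃ i, γ0 i ≠ 0 := by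
        by_contra hcon
        push Not at hcon
        have : γ0 = 0 := Finsupp.ext hcon
        rw [this] at hγ0; simp at hγ0; omega
      have hγ : (γ0 - Finsupp.single i0 1) + Finsupp.single i0 1 = γ0 :=
        tsub_add_cancel_of_le (by simp; omega)
      have hγd : (γ0 - Finsupp.single i0 1).degree + 1 = d := by
        have := congrArg Finsupp.degree hγ
        rw [map_add, Finsupp.degree_single] at this; omega
      let g' : (Σ j, Fin (e j)) → MvPolynomial (Fin m) ℂ := fun x =>
        if (x.2 : ℕ) = 0 then g x.1 else if x.1 = j0 ∧ (x.2 : ℕ) = 1 then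
          monomial (γ0 - Finsupp.single i0 1) 1 else 0
      obtain ⟨φ, hφ, h1, h2⟩ := hN1 σ (Σ j, Fin (e j)) (fun x => e x.1 - x.2)
        (fun x => (Psi v (f x.1)).coeff x.2)
        (by
          rw [Fintype.card_sigma]
          simp only [Fintype.card_fin]
          refine (Finset.sum_le_card_nsmul _ _ d (fun j _ => hd j)).trans ?_
          simpa using Nat.mul_le_mul_right d hs)
        (fun x => by have := x.2.2; omega) (fun x => by have := hd x.1; omega)
        (fun x => Psi_hom v _ (e x.1) (hf _) _ _ (by have := x.2.2; omega)) hvS g'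
        (by
          rintro ⟨j, p⟩
          simp only [g']
          split_ifs with h3 h4
          · rw [h3]; exact hg j
          · obtain ⟨rfl, h5⟩ := h4
            refine isHomogeneous_monomial _ ?_
            omega
          · exact isHomogeneous_zero _ _ _)
        ((Rs.erase (j0, γ0)).image (fun x : ι × (Fin m →₀ ℕ) =>
          ((⟨x.1, ⟨0, he1 x.1⟩⟩ : Σ j, Fin (e j)), x.2)))
        (by
          rw [Finset.card_image_of_injOn, Finset.card_erase_of_mem hx0, hRs]; · rfl
          rintro ⟨a, b⟩ _ ⟨a', b'⟩ _ h
          simp only [Prod.mk.injEq, Sigma.mk.injEq] at h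
          exact Prod.ext h.1.1 h.2)
        (by
          intro x hx
          obtain ⟨y, hy, rfl⟩ := Finset.mem_image.1 hx
          have := hRd y (Finset.mem_of_mem_erase hy)
          simpa using this)
      have hmon : ∀ lam : ℂ, C lam * X i0 * monomial (γ0 - Finsupp.single i0 1) 1 =
          monomial γ0 lam := by
        intro lam
        rw [X, C_mul_monomial, monomial_mul, mul_one, mul_one, add_comm, hγ]
      have hsub : ∀ (lam : ℂ) j, aeval (fun i => φ i + (C lam * X i0) *
          algebraMap ℂ (MvPolynomial (Fin m) ℂ) (v i)) (f j) =
          aeval φ (f j) + if j = j0 then monomial γ0 lam else 0 := by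
        intro lam j
        have hdeg : (Psi v (f j)).natDegree < e j := by
          have : (Psi v (f j)).natDegree ≤ e j - 1 := by
            refine Polynomial.natDegree_le_iff_coeff_eq_zero.2 fun N hN => ?_
            rcases lt_or_eq_of_le (show e j ≤ N by omega) with h | h
            · exact Psi_zero_of_lt v (f j) (e j) (hf j) N h
            · rw [← h]; exact Psi_coeff_top v (f j) (e j) (hf j) (hv0 j)
          have := he1 j
          omega
        rw [Psi_subst, Polynomial.eval₂_eq_sum_range' _ hdeg]
        have hterm : ∀ p ∈ Finset.range (e j),
            (aeval φ : MvPolynomial σ ℂ →ₐ[ℂ] MvPolynomial (Fin m) ℂ).toRingHom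
              ((Psi v (f j)).coeff p) * (C lam * X i0) ^ p =
            (if p = 0 then aeval φ (f j) else 0) +
              (if p = 1 then (if j = j0 then monomial γ0 lam else 0) else 0) := by
          intro p hp
          rw [Finset.mem_range] at hp
          by_cases hp0 : p = 0
          · subst hp0
            simp [Psi_coeff_zero]
          · have h3 := h1 ⟨j, ⟨p, hp⟩⟩ (by have := hd j; simp; omega)
            simp only [g', hp0, if_false] at h3
            have h4 : (aeval φ : MvPolynomial σ ℂ →ₐ[ℂ] MvPolynomial (Fin m) ℂ).toRingHom
              ((Psi v (f j)).coeff p) = _ := h3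
            rw [h4, if_neg hp0, zero_add]
            by_cases hp1 : p = 1
            · subst hp1
              by_cases hj : j = j0
              · rw [if_pos ⟨hj, rfl⟩, if_pos rfl, if_pos hj, pow_one, mul_comm, hmon]
              · simp [hj]
            · simp [hp1]
        rw [Finset.sum_congr rfl hterm, Finset.sum_add_distrib, Finset.sum_ite_eq',
          Finset.sum_ite_eq', if_pos (Finset.mem_range.2 (he1 j))]
        congr 1
        by_cases hj : j = j0
        · rw [if_pos]
          subst hj
          rw [Finset.mem_range]; omega
        · simp [hj]
      refine ⟨fun i => φ i + (C (coeff γ0 (g j0) - coeff γ0 (aeval φ (f j0))) * X i0) *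
          algebraMap ℂ (MvPolynomial (Fin m) ℂ) (v i), fun i => (hφ i).add ?_, ?_, ?_⟩
      · exact hom_aux _ _ _
      · intro j hj
        rw [hsub, if_neg (by rintro rfl; omega), add_zero]
        have := h1 ⟨j, ⟨0, he1 j⟩⟩ (by simpa using hj)
        simpa [g', Psi_coeff_zero] using this
      · rintro ⟨j, γ⟩ hx
        simp only [hsub, coeff_add]
        by_cases hxx : (j, γ) = (j0, γ0)
        · simp only [Prod.mk.injEq] at hxx
          obtain ⟨rfl, rfl⟩ := hxx
          simp
        · have h3 := h2 (⟨j, ⟨0, he1 j⟩⟩, γ)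
            (Finset.mem_image.2 ⟨(j, γ), Finset.mem_erase.2 ⟨hxx, hx⟩, rfl⟩)
          simp only [g', Psi_coeff_zero, if_true] at h3
          rw [h3]
          split_ifs with hj
          · subst hj
            rw [coeff_monomial, if_neg, add_zero]
            rintro rfl; exact hxx rfl
          · simp
  obtain ⟨N, hN⟩ : ∃ N, ∀ q ≤ s0 * (Bx (Fin m) d).card, (inner q s0).choose ≤ N :=
    ⟨∑ q ∈ Finset.range (s0 * (Bx (Fin m) d).card + 1), (inner q s0).choose, fun q hq =>
      Finset.single_le_sum (f := fun q => (inner q s0).choose) (fun _ _ => Nat.zero_le _)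
        (by simp; omega)⟩
  refine ⟨N, ?_⟩
  intro σ ι _ _ e f hs he1 hd hf hS g hg
  let Rs : Finset (ι × (Fin m →₀ ℕ)) :=
    (Finset.univ.filter (fun j => e j = d)) ×ˢ ((Bx (Fin m) d).filter fun γ => γ.degree = d)
  have hc : Rs.card ≤ s0 * (Bx (Fin m) d).card := by
    rw [Finset.card_product]
    exact Nat.mul_le_mul ((Finset.card_filter_le _ _).trans hs) (Finset.card_filter_le _ _)
  obtain ⟨φ, hφ, h1, h2⟩ := (inner Rs.card s0).choose_spec σ ι e f hs he1 hd hf (hS.mono (hN _ hc))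
    g hg Rs rfl (by
      rintro ⟨j, γ⟩ hx
      simp only [Rs, Finset.mem_product, Finset.mem_filter] at hx
      exact ⟨hx.1.2, hx.2.2⟩)
  refine ⟨φ, hφ, fun j => ?_⟩
  rcases (hd j).lt_or_eq with hj | hj
  · exact h1 j hj
  · ext γ
    by_cases hγ : γ.degree = d
    · exact h2 (j, γ) (by simp [Rs, hj, hγ, mem_Bx])
    · rw [(hg j).coeff_eq_zero (by omega)]
      have := (hf j).aeval φ hφ
      rw [one_mul] at this
      exact this.coeff_eq_zero (by omega)

lemma Uni_all (d : ℕ) (hd : 1 ≤ d) : Uni d := by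
  induction d, hd using Nat.le_induction with
  | base => exact Uni_one
  | succ n hn ih => exact Uni_step (n + 1) (by omega) (by simpa using ih)
end

section
open MvPolynomial
set_option linter.unusedSectionVars false

/-- multiset of degrees -/
def degs {ι : Type} [Fintype ι] (e : ι → ℕ) : Multiset ℕ := ∑ i, ({e i} : Multiset ℕ)

lemma mem_degs {ι : Type} [Fintype ι] {e : ι → ℕ} {a : ℕ} : a ∈ degs e ↔ ∃ i, e i = a := by
  simp [degs, Multiset.mem_sum, eq_comm]

lemma card_degs {ι : Type} [Fintype ι] (e : ι → ℕ) : (degs e).card = Fintype.card ι := by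
  simp [degs]

def SS (N : ℕ → ℕ) (r : ℕ) (B : ℕ) {σ ι : Type} [Fintype σ] (f : ι → MvPolynomial σ ℂ) : Prop :=
  ∃ (κ : Type) (_ : Fintype κ) (e' : κ → ℕ) (g : κ → MvPolynomial σ ℂ), Fintype.card κ ≤ B ∧
    (∀ j, 1 ≤ e' j ∧ e' j ≤ r ∧ (g j).IsHomogeneous (e' j)) ∧ Strong (N (Fintype.card κ)) e' g ∧
    ∀ j, f j ∈ Algebra.adjoin ℂ (Set.range g)

lemma small_aux (N : ℕ → ℕ) (r : ℕ) (δ : Multiset ℕ) : ∃ B, ∀ (σ ι : Type) [Fintype σ] [Fintype ι]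
    (e : ι → ℕ) (f : ι → MvPolynomial σ ℂ), degs e = δ →
    (∀ j, 1 ≤ e j ∧ e j ≤ r ∧ (f j).IsHomogeneous (e j)) → SS N r B f := by
  classical
  induction δ using (Multiset.wellFounded_isDershowitzMannaLT (α := ℕ)).induction with
  | _ δ ih =>
  set n := N δ.card
  let T : Finset (Multiset ℕ) := ((2 * n) • (Finset.range (r + 1)).val).powerset.toFinset
  let F : ℕ → Multiset ℕ → ℕ := fun e0 m =>
    if h : Multiset.IsDershowitzMannaLT (δ.erase e0 + m) δ then (ih _ h).choose else 0
  refine ⟨δ.card + ∑ e0 ∈ δ.toFinset, ∑ m ∈ T, F e0 m, ?_⟩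
  intro σ ι _ _ e f hδ hf
  by_cases hS : Strong n e f
  · refine ⟨ι, inferInstance, e, f, ?_, hf, ?_, fun j => Algebra.subset_adjoin ⟨j, rfl⟩⟩
    · rw [← hδ, card_degs]; omega
    · rw [← card_degs e, hδ]; exact hS
  simp only [Strong, not_forall, not_not] at hS
  obtain ⟨e0, c, hc, hc0, l, hln, hl, hsum⟩ := hS
  obtain ⟨j0, hj0⟩ := Function.ne_iff.1 hc0
  simp only [Pi.zero_apply] at hj0
  have he0 : e j0 = e0 := by
    by_contra h; exact hj0 (hc _ h)
  choose a b ha hb hab hga hgb using hl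
  let e' : {j // j ≠ j0} ⊕ (Fin l.length ⊕ Fin l.length) → ℕ :=
    Sum.elim (fun j => e j) (Sum.elim (fun i => a _ (l.get_mem i)) (fun i => b _ (l.get_mem i)))
  let f' : {j // j ≠ j0} ⊕ (Fin l.length ⊕ Fin l.length) → MvPolynomial σ ℂ :=
    Sum.elim (fun j => f j) (Sum.elim (fun i => (l.get i).1) (fun i => (l.get i).2))
  set m : Multiset ℕ := degs (Sum.elim (fun i => a _ (l.get_mem i)) (fun i => b _ (l.get_mem i)))
    with hm
  have hδe : δ = ∑ j : {j // j ≠ j0}, ({e j} : Multiset ℕ) + {e0} := by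
    rw [← hδ, degs, Fintype.sum_eq_add_sum_subtype_ne _ j0, he0, add_comm]
  have hδe' : δ.erase e0 = ∑ j : {j // j ≠ j0}, ({e j} : Multiset ℕ) := by
    rw [hδe, add_comm, Multiset.singleton_add, Multiset.erase_cons_head]
  have hdeg' : degs e' = δ.erase e0 + m := by
    rw [degs, Fintype.sum_sum_type, hδe']; rfl
  have hml : ∀ y ∈ m, 1 ≤ y ∧ y < e0 := by
    intro y hy
    obtain ⟨i, rfl⟩ := mem_degs.1 hy
    rcases i with i | i
    · have := ha _ (l.get_mem i); have := hb _ (l.get_mem i); have := hab _ (l.get_mem i)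
      simp only [Sum.elim_inl]; omega
    · have := ha _ (l.get_mem i); have := hb _ (l.get_mem i); have := hab _ (l.get_mem i)
      simp only [Sum.elim_inr]; omega
  have he0r : e0 ≤ r := he0 ▸ (hf j0).2.1
  have hDM : Multiset.IsDershowitzMannaLT (δ.erase e0 + m) δ := by
    refine ⟨δ.erase e0, m, {e0}, by simp, rfl, ?_, ?_⟩
    · rw [hδe']; exact hδe
    · intro y hy; exact ⟨e0, by simp, (hml y hy).2⟩
  have hmT : m ∈ T := by
    simp only [T, Multiset.mem_toFinset, Multiset.mem_powerset]
    rw [Multiset.le_iff_count]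
    intro y
    by_cases hy : y ∈ m
    · rw [Multiset.count_nsmul, Multiset.count_eq_one_of_mem (Finset.range (r+1)).nodup
        (by have := hml y hy; rw [Finset.mem_val, Finset.mem_range]; omega), mul_one]
      refine (Multiset.count_le_card _ _).trans ?_
      rw [hm, card_degs]
      simp; omega
    · rw [Multiset.count_eq_zero_of_notMem hy]; omega
  have hB : F e0 m ≤ ∑ e0 ∈ δ.toFinset, ∑ m ∈ T, F e0 m :=
    (Finset.single_le_sum (f := fun m => F e0 m) (fun _ _ => Nat.zero_le _) hmT).trans
      (Finset.single_le_sum (f := fun e0 => ∑ m ∈ T, F e0 m) (fun _ _ => Nat.zero_le _)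
        (by rw [hδe]; simp))
  obtain ⟨κ, _, ek, g, hcard, hg, hSg, hadj⟩ := (ih _ hDM).choose_spec σ _ e' f' hdeg' (by
    rintro (j | i | i)
    · exact hf j
    · exact ⟨ha _ _, by have := hb _ (l.get_mem i); have := hab _ (l.get_mem i); simp only [e', Sum.elim_inl, Sum.elim_inr]; omega, hga _ _⟩
    · exact ⟨hb _ _, by have := ha _ (l.get_mem i); have := hab _ (l.get_mem i); simp only [e', Sum.elim_inl, Sum.elim_inr]; omega, hgb _ _⟩)
  refine ⟨κ, inferInstance, ek, g, ?_, hg, hSg, ?_⟩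
  · have : F e0 m = (ih _ hDM).choose := by simp only [F, hDM, dite_true]
    omega
  have hne : ∀ j, j ≠ j0 → f j ∈ Algebra.adjoin ℂ (Set.range g) := fun j hj => hadj (Sum.inl ⟨j, hj⟩)
  intro j
  by_cases hj : j = j0
  · subst hj
    have h1 : f j = C (c j)⁻¹ * ((l.map fun p => p.1 * p.2).sum -
        ∑ i : {i // i ≠ j}, C (c i) * f i) := by
      rw [← hsum, Fintype.sum_eq_add_sum_subtype_ne _ j, add_sub_cancel_right, ← mul_assoc,
        ← C_mul, inv_mul_cancel₀ hj0, C_1, one_mul]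
    rw [h1]
    refine mul_mem (Subalgebra.algebraMap_mem _ _) (sub_mem (list_sum_mem ?_)
      (sum_mem fun i _ => mul_mem (Subalgebra.algebraMap_mem _ _) (hne _ i.2)))
    intro x hx
    obtain ⟨p, hp, rfl⟩ := List.mem_map.1 hx
    obtain ⟨i, rfl⟩ := List.mem_iff_get.1 hp
    exact mul_mem (hadj (Sum.inr (Sum.inl i))) (hadj (Sum.inr (Sum.inr i)))
  · exact hne j hj

lemma SS.mono {N : ℕ → ℕ} {r B B' : ℕ} {σ ι : Type} [Fintype σ] {f : ι → MvPolynomial σ ℂ}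
    (h : SS N r B f) (hB : B ≤ B') : SS N r B' f := by
  obtain ⟨κ, i, ek, g, hcard, h⟩ := h
  exact ⟨κ, i, ek, g, hcard.trans hB, h⟩

lemma small_subalg (N : ℕ → ℕ) (r k : ℕ) : ∃ B, ∀ (σ ι : Type) [Fintype σ] [Fintype ι]
    (e : ι → ℕ) (f : ι → MvPolynomial σ ℂ), Fintype.card ι ≤ k →
    (∀ j, 1 ≤ e j ∧ e j ≤ r ∧ (f j).IsHomogeneous (e j)) → SS N r B f := by
  classical
  choose B hB using small_aux N r
  let T : Finset (Multiset ℕ) := (k • (Finset.range (r + 1)).val).powerset.toFinset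
  refine ⟨∑ m ∈ T, B m, ?_⟩
  intro σ ι _ _ e f hk hf
  refine (hB _ σ ι e f rfl hf).mono (Finset.single_le_sum (f := fun m => B m)
    (fun _ _ => Nat.zero_le _) ?_)
  simp only [T, Multiset.mem_toFinset, Multiset.mem_powerset]
  rw [Multiset.le_iff_count]
  intro y
  by_cases hy : y ∈ degs e
  · obtain ⟨i, rfl⟩ := mem_degs.1 hy
    rw [Multiset.count_nsmul, Multiset.count_eq_one_of_mem (Finset.range (r+1)).nodup
      (by have := hf i; rw [Finset.mem_val, Finset.mem_range]; omega), mul_one]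
    refine (Multiset.count_le_card _ _).trans ?_
    rwa [card_degs]
  · rw [Multiset.count_eq_zero_of_notMem hy]; omega
end

section
open MvPolynomial
set_option linter.unusedSectionVars false

section
variable {κ : Type} [Fintype κ] {Λ : Type} [CommRing Λ]

def LTd (n : ℕ) (F : MvPolynomial κ Λ) : Prop := ∀ m, coeff m F ≠ 0 → m.degree < n

lemma LTd.add {n : ℕ} {F G : MvPolynomial κ Λ} (hF : LTd n F) (hG : LTd n G) : LTd n (F + G) := by
  intro m hm
  by_contra h
  have h1 : coeff m F = 0 := by by_contra h1; exact h (hF m h1)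
  have h2 : coeff m G = 0 := by by_contra h1; exact h (hG m h1)
  exact hm (by rw [coeff_add, h1, h2, add_zero])

lemma LTd.mul {a b : ℕ} {F G : MvPolynomial κ Λ} (hF : LTd a F) (hG : LTd (b + 1) G) :
    LTd (a + b) (F * G) := by
  classical
  intro m hm
  rw [coeff_mul] at hm
  obtain ⟨⟨x, y⟩, hx, hxy⟩ := Finset.exists_ne_zero_of_sum_ne_zero hm
  have := hF x (left_ne_zero_of_mul hxy)
  have := hG y (right_ne_zero_of_mul hxy)
  rw [Finset.HasAntidiagonal.mem_antidiagonal] at hx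
  rw [← hx, map_add]
  simp only at *
  omega

lemma LTd_monomial (m : κ →₀ ℕ) (c : Λ) : LTd (m.degree + 1) (monomial m c) := by
  classical
  intro m' h
  rw [coeff_monomial] at h
  split_ifs at h with h1
  · subst h1; omega
  · exact absurd rfl h

lemma LTd.mono {a b : ℕ} {F : MvPolynomial κ Λ} (hF : LTd a F) (h : a ≤ b) : LTd b F :=
  fun m hm => (hF m hm).trans_le h

/-- `F` has top term the monomial `m` -/
def TopM (m : κ →₀ ℕ) (F : MvPolynomial κ Λ) : Prop := LTd m.degree (F - monomial m 1)

lemma TopM.mul {m m' : κ →₀ ℕ} {F F' : MvPolynomial κ Λ} (h : TopM m F) (h' : TopM m' F') :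
    TopM (m + m') (F * F') := by
  have : F * F' - monomial (m + m') 1 = (F - monomial m 1) * (F' - monomial m' 1) +
      (F' - monomial m' 1) * monomial m 1 + (F - monomial m 1) * monomial m' 1 := by
    have : (monomial (m + m') 1 : MvPolynomial κ Λ) = monomial m 1 * monomial m' 1 := by
      rw [monomial_mul, one_mul]
    rw [this]; ring
  rw [TopM, this, map_add]
  refine ((LTd.mul h (h'.mono (Nat.le_succ _))).add ?_).add (LTd.mul h (LTd_monomial _ _))
  rw [add_comm]
  exact LTd.mul h' (LTd_monomial _ _)

lemma TopM_one : TopM (0 : κ →₀ ℕ) (1 : MvPolynomial κ Λ) := by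
  intro m hm
  simp at hm

lemma TopM.pow {m : κ →₀ ℕ} {F : MvPolynomial κ Λ} (h : TopM m F) (n : ℕ) : TopM (n • m) (F ^ n) := by
  induction n with
  | zero => simpa using TopM_one
  | succ n ih => rw [succ_nsmul, pow_succ]; exact ih.mul h

lemma TopM_prod {ι : Type} (s : Finset ι) (m : ι → κ →₀ ℕ) (F : ι → MvPolynomial κ Λ)
    (h : ∀ i, TopM (m i) (F i)) : TopM (∑ i ∈ s, m i) (∏ i ∈ s, F i) := by
  classical
  induction s using Finset.induction_on with
  | empty => simpa using TopM_one
  | insert a s ha ih => rw [Finset.sum_insert ha, Finset.prod_insert ha]; exact (h a).mul ih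

/-- monic-type families -/
def TopW (d : κ → ℕ) (h : κ → MvPolynomial κ Λ) : Prop :=
  ∀ j, 1 ≤ d j ∧ TopM (Finsupp.single j (d j)) (h j)

noncomputable def tm (d : κ → ℕ) (h : κ → MvPolynomial κ Λ) (m : κ →₀ ℕ) : MvPolynomial κ Λ :=
  ∏ j, (h j ^ (m j / d j) * X j ^ (m j % d j))

lemma TopM_tm (d : κ → ℕ) (h : κ → MvPolynomial κ Λ) (hT : TopW d h) (m : κ →₀ ℕ) :
    TopM m (tm d h m) := by
  classical
  have := TopM_prod Finset.univ (fun j => (m j / d j) • Finsupp.single j (d j) +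
    (m j % d j) • Finsupp.single j 1) (fun j => h j ^ (m j / d j) * X j ^ (m j % d j))
    (fun j => ((hT j).2.pow _).mul (TopM.pow (by
      intro m' hm'; exact absurd (by simp [X]) hm') _))
  convert! this using 1
  ext j
  simp only [Finsupp.finsetSum_apply, Finsupp.add_apply, Finsupp.smul_apply, Finsupp.single_apply,
    smul_eq_mul]
  rw [Finset.sum_eq_single j]
  · simp [Nat.div_add_mod']
  · intro b _ hb; simp [hb]
  · simp

noncomputable def Tm (d : κ → ℕ) (h : κ → MvPolynomial κ Λ) : MvPolynomial κ Λ →ₗ[Λ] MvPolynomial κ Λ :=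
  (basisMonomials κ Λ).constr Λ (tm d h)

lemma Tm_monomial (d : κ → ℕ) (h : κ → MvPolynomial κ Λ) (m : κ →₀ ℕ) :
    Tm d h (monomial m 1) = tm d h m := by
  have := (basisMonomials κ Λ).constr_basis Λ (tm d h) m
  rwa [coe_basisMonomials] at this

lemma mono_smul (m : κ →₀ ℕ) (c : Λ) : (monomial m c : MvPolynomial κ Λ) = c • monomial m 1 := by
  simp [smul_monomial]

lemma Tm_monomial' (d : κ → ℕ) (h : κ → MvPolynomial κ Λ) (m : κ →₀ ℕ) (c : Λ) :
    Tm d h (monomial m c) = c • tm d h m := by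
  rw [mono_smul, map_smul, Tm_monomial]

lemma Tm_inj (d : κ → ℕ) (h : κ → MvPolynomial κ Λ) (hT : TopW d h) (F : MvPolynomial κ Λ)
    (hF : Tm d h F = 0) : F = 0 := by
  classical
  by_contra hne
  obtain ⟨m, hm, hmax⟩ := Finset.exists_max_image F.support (fun m => m.degree)
    (support_nonempty.2 hne)
  have h1 : coeff m (Tm d h F) = ∑ m' ∈ F.support, coeff m' F * coeff m (tm d h m') := by
    conv_lhs => rw [F.as_sum, map_sum, coeff_sum]
    simp only [Tm_monomial', coeff_smul, smul_eq_mul]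
  have h2 : ∀ m' ∈ F.support, coeff m (tm d h m') = if m' = m then 1 else 0 := by
    intro m' hm'
    have h3 : coeff m (tm d h m' - monomial m' 1) = 0 := by
      by_contra hc
      have h4 := TopM_tm d h hT m' m hc
      have := hmax m' hm'
      omega
    rw [coeff_sub, coeff_monomial, sub_eq_zero] at h3
    exact h3
  rw [Finset.sum_congr rfl (fun m' hm' => by rw [h2 m' hm']), hF] at h1
  simp at h1
  exact mem_support_iff.1 hm (h1 (mem_support_iff.1 hm)).symm

lemma Tm_surj (d : κ → ℕ) (h : κ → MvPolynomial κ Λ) (hT : TopW d h) (n : ℕ) :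
    ∀ F : MvPolynomial κ Λ, LTd n F → F ∈ LinearMap.range (Tm d h) := by
  induction n with
  | zero =>
    intro F hF
    have : F = 0 := by
      ext m; by_contra hm; exact absurd (hF m hm) (by omega)
    rw [this]; exact zero_mem _
  | succ n ih =>
    intro F hF
    rw [F.as_sum]
    refine sum_mem fun m hm => ?_
    have h1 := hF m (mem_support_iff.1 hm)
    rw [mono_smul]
    refine Submodule.smul_mem _ _ ?_
    have h2 := ih _ ((TopM_tm d h hT m).mono (Nat.lt_succ_iff.1 h1))
    have h3 : (monomial m 1 : MvPolynomial κ Λ) = Tm d h (monomial m 1) - (tm d h m - monomial m 1) := by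
      rw [Tm_monomial]; ring
    rw [h3]
    exact sub_mem ⟨_, rfl⟩ h2

/-- reduced polynomials -/
def Low (d : κ → ℕ) (F : MvPolynomial κ Λ) : Prop := ∀ m, coeff m F ≠ 0 → ∀ j, m j < d j

lemma Low.smul {d : κ → ℕ} {F : MvPolynomial κ Λ} (hF : Low d F) (c : Λ) : Low d (C c * F) := by
  intro m hm
  rw [coeff_C_mul] at hm
  exact hF m (right_ne_zero_of_mul hm)

lemma Low.map {Λ' : Type} [CommRing Λ'] (π : Λ →+* Λ') {d : κ → ℕ} {F : MvPolynomial κ Λ}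
    (hF : Low d F) : Low d (MvPolynomial.map π F) := by
  intro m hm
  rw [coeff_map] at hm
  exact hF m (by rintro h; rw [h, map_zero] at hm; exact hm rfl)

lemma TopW.map {Λ' : Type} [CommRing Λ'] (π : Λ →+* Λ') {d : κ → ℕ} {h : κ → MvPolynomial κ Λ}
    (hT : TopW d h) : TopW d (fun j => MvPolynomial.map π (h j)) := by
  intro j
  refine ⟨(hT j).1, fun m hm => (hT j).2 m ?_⟩
  have : MvPolynomial.map π (h j) - monomial (Finsupp.single j (d j)) 1 =
    MvPolynomial.map π (h j - monomial (Finsupp.single j (d j)) 1) := by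
    rw [map_sub, map_monomial, RingHom.map_one π]
  rw [this, coeff_map] at hm
  intro h0; rw [h0, map_zero] at hm; exact hm rfl

lemma tm_low (d : κ → ℕ) (h : κ → MvPolynomial κ Λ) (m : κ →₀ ℕ) (hm : ∀ j, m j < d j) :
    tm d h m = monomial m 1 := by
  rw [tm, monomial_eq, Finsupp.prod_fintype _ _ (by simp)]
  simp [fun j => Nat.div_eq_of_lt (hm j), fun j => Nat.mod_eq_of_lt (hm j)]

lemma tm_high (d : κ → ℕ) (h : κ → MvPolynomial κ Λ) (m : κ →₀ ℕ) (j : κ) (hj : 1 ≤ d j) :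
    tm d h (m + Finsupp.single j (d j)) = h j * tm d h m := by
  classical
  rw [tm, tm, ← Finset.mul_prod_erase _ _ (Finset.mem_univ j),
    ← Finset.mul_prod_erase _ _ (Finset.mem_univ j)]
  rw [← mul_assoc, ← mul_assoc]
  congr 1
  · simp only [Finsupp.add_apply, Finsupp.single_eq_same]
    rw [Nat.add_div_right _ hj, Nat.add_mod_right, pow_succ]; ring
  · refine Finset.prod_congr rfl fun i hi => ?_
    have : i ≠ j := Finset.ne_of_mem_erase hi
    simp [this.symm]

lemma Tm_low (d : κ → ℕ) (h : κ → MvPolynomial κ Λ) (F : MvPolynomial κ Λ) (hF : Low d F) :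
    Tm d h F = F := by
  conv_lhs => rw [F.as_sum, map_sum]
  conv_rhs => rw [F.as_sum]
  refine Finset.sum_congr rfl fun m hm => ?_
  rw [Tm_monomial', tm_low d h m (hF m (mem_support_iff.1 hm)), ← mono_smul]

lemma nf_exists (d : κ → ℕ) (h : κ → MvPolynomial κ Λ) (hT : TopW d h) (F : MvPolynomial κ Λ) :
    ∃ c, Low d c ∧ F - c ∈ Ideal.span (Set.range h) := by
  classical
  obtain ⟨n, hn⟩ : ∃ n, LTd n F := ⟨F.totalDegree + 1, fun m hm =>
    Nat.lt_succ_of_le (by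
      have := le_totalDegree (mem_support_iff.2 hm)
      exact this)⟩
  obtain ⟨G, rfl⟩ := Tm_surj d h hT n F hn
  rw [G.as_sum, map_sum]
  refine Finset.sum_induction _ (fun F => ∃ c, Low d c ∧ F - c ∈ Ideal.span (Set.range h)) ?_ ?_ ?_
  · rintro a b ⟨c, h1, h2⟩ ⟨c', h1', h2'⟩
    refine ⟨c + c', ?_, by convert! add_mem h2 h2' using 1; ring⟩
    intro m hm
    by_cases hc : coeff m c = 0
    · exact h1' m (by rintro h; rw [coeff_add, h, hc, add_zero] at hm; exact hm rfl)
    · exact h1 m hc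
  · exact ⟨0, fun m hm => absurd (coeff_zero m) hm, by simp⟩
  · intro m _
    by_cases hm : ∀ j, m j < d j
    · refine ⟨monomial m (coeff m G), ?_, ?_⟩
      · intro m' hm'
        rw [coeff_monomial] at hm'
        split_ifs at hm' with hh
        · subst hh; exact hm
        · exact absurd rfl hm'
      · rw [Tm_monomial', tm_low d h m hm, ← mono_smul, sub_self]; exact zero_mem _
    · push Not at hm
      obtain ⟨j, hj⟩ := hm
      refine ⟨0, fun m hm => absurd (coeff_zero m) hm, ?_⟩
      rw [sub_zero, Tm_monomial']
      have : m = (m - Finsupp.single j (d j)) + Finsupp.single j (d j) :=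
        (tsub_add_cancel_of_le (by simpa using hj)).symm
      rw [this, tm_high d h _ j (hT j).1, smul_eq_C_mul]
      exact Ideal.mul_mem_left _ _ (Ideal.mul_mem_right _ _ (Ideal.subset_span ⟨j, rfl⟩))

lemma nf_unique (d : κ → ℕ) (h : κ → MvPolynomial κ Λ) (hT : TopW d h) (c : MvPolynomial κ Λ)
    (hc : Low d c) (hI : c ∈ Ideal.span (Set.range h)) : c = 0 := by
  classical
  have key : ∀ F ∈ Ideal.span (Set.range h), ∃ G : MvPolynomial κ Λ,
      (∀ m, coeff m G ≠ 0 → ∃ j, d j ≤ m j) ∧ Tm d h G = F := by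
    intro F hF
    obtain ⟨a, rfl⟩ := (Ideal.mem_span_range_iff_exists_fun).1 hF
    have : ∀ j, ∃ G : MvPolynomial κ Λ, Tm d h G = a j := fun j => by
      obtain ⟨n, hn⟩ : ∃ n, LTd n (a j) := ⟨(a j).totalDegree + 1, fun m hm =>
        Nat.lt_succ_of_le (by
          have := le_totalDegree (mem_support_iff.2 hm)
          exact this)⟩
      exact Tm_surj d h hT n _ hn
    choose G hG using this
    refine ⟨∑ j, G j * monomial (Finsupp.single j (d j)) 1, ?_, ?_⟩
    · intro m hm
      rw [coeff_sum] at hm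
      obtain ⟨j, -, hj⟩ := Finset.exists_ne_zero_of_sum_ne_zero hm
      rw [coeff_mul_monomial'] at hj
      split_ifs at hj with h1
      · exact ⟨j, by simpa using h1⟩
      · exact absurd rfl hj
    · rw [map_sum]
      refine Finset.sum_congr rfl fun j _ => ?_
      rw [← hG j]
      conv_lhs => rw [(G j).as_sum]
      conv_rhs => rw [(G j).as_sum]
      rw [Finset.sum_mul, map_sum, map_sum, Finset.sum_mul]
      refine Finset.sum_congr rfl fun m _ => ?_
      rw [monomial_mul, mul_one, Tm_monomial', Tm_monomial', tm_high d h m j (hT j).1,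
        smul_mul_assoc, mul_comm]
  obtain ⟨G, hG, hGc⟩ := key c hI
  have : G = c := by
    have := Tm_inj d h hT (G - c) (by rw [map_sub, hGc, Tm_low d h c hc, sub_self])
    exact sub_eq_zero.1 this
  subst this
  ext m
  by_contra hm
  obtain ⟨j, hj⟩ := hG m hm
  have := hc m hm j
  omega

lemma nzd_mod (d : κ → ℕ) (h : κ → MvPolynomial κ Λ) (hT : TopW d h) (l : Λ)
    (hl : ∀ a, l * a = 0 → a = 0) (F : MvPolynomial κ Λ)
    (hF : C l * F ∈ Ideal.span (Set.range h)) : F ∈ Ideal.span (Set.range h) := by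
  obtain ⟨c, hc, hFc⟩ := nf_exists d h hT F
  have h1 : C l * c ∈ Ideal.span (Set.range h) := by
    have := sub_mem hF (Ideal.mul_mem_left _ (C l) hFc)
    convert! this using 1; ring
  have h2 := nf_unique d h hT _ (hc.smul l) h1
  have h3 : c = 0 := by
    ext m
    have := congrArg (coeff m) h2
    rw [coeff_C_mul, coeff_zero] at this
    simpa using hl _ this
  simpa [h3] using hFc

end
end

section
open MvPolynomial
set_option linter.unusedSectionVars false

section
variable {κ : Type} [Fintype κ]

lemma map_span_mem {Λ Λ' : Type} [CommRing Λ] [CommRing Λ'] (π : Λ →+* Λ')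
    (h : κ → MvPolynomial κ Λ) (F : MvPolynomial κ Λ) (hF : F ∈ Ideal.span (Set.range h)) :
    MvPolynomial.map π F ∈ Ideal.span (Set.range fun j => MvPolynomial.map π (h j)) := by
  have := Ideal.mem_map_of_mem (MvPolynomial.map π) hF
  rwa [Ideal.map_span, ← Set.range_comp] at this

lemma dom_step {Λ Λ1 : Type} [CommRing Λ] [CommRing Λ1] (π : Λ →+* Λ1) (l : Λ)
    (hker : ∀ a, π a = 0 → l ∣ a) (hnz : ∀ a, l * a = 0 → a = 0)
    (hsep : ∀ a, a ≠ 0 → ∃ k, ¬ l ^ k ∣ a) (d : κ → ℕ) (h : κ → MvPolynomial κ Λ) (hT : TopW d h)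
    (hp : (Ideal.span (Set.range fun j => MvPolynomial.map π (h j))).IsPrime) :
    (Ideal.span (Set.range h)).IsPrime := by
  classical
  have hnz' : ∀ k a, l ^ k * a = 0 → a = 0 := by
    intro k
    induction k with
    | zero => intro a ha; simpa using ha
    | succ k ih => intro a ha; exact ih a (hnz _ (by rw [← mul_assoc, ← pow_succ']; exact ha))
  have key : ∀ F, F ∉ Ideal.span (Set.range h) → ∃ k F', F - C (l ^ k) * F' ∈ Ideal.span (Set.range h)
      ∧ MvPolynomial.map π F' ∉ Ideal.span (Set.range fun j => MvPolynomial.map π (h j)) := by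
    intro F hF
    obtain ⟨c, hc, hFc⟩ := nf_exists d h hT F
    have hc0 : c ≠ 0 := by rintro rfl; exact hF (by simpa using hFc)
    have hex : ∃ k, ¬ C (l ^ k) ∣ c := by
      obtain ⟨m, hm⟩ := MvPolynomial.ne_zero_iff.1 hc0
      obtain ⟨k, hk⟩ := hsep _ hm
      exact ⟨k, fun hd => hk (C_dvd_iff_dvd_coeff _ _ |>.1 hd m)⟩
    have h1 := Nat.find_spec hex
    obtain ⟨k, hk⟩ : ∃ k, Nat.find hex = k + 1 := Nat.exists_eq_succ_of_ne_zero (by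
      intro h0; rw [h0] at h1; exact h1 (by simp))
    have h2 : C (l ^ k) ∣ c := by
      by_contra h3
      exact Nat.find_min hex (m := k) (by omega) h3
    rw [hk] at h1
    obtain ⟨F', rfl⟩ := h2
    refine ⟨k, F', hFc, fun hmem => h1 ?_⟩
    have hlow : Low d F' := by
      intro m hm
      refine hc m ?_
      rw [coeff_C_mul]
      intro h0; exact hm (hnz' k _ h0)
    have h4 := nf_unique d _ (hT.map π) _ (hlow.map π) hmem
    have h5 : C l ∣ F' := by
      rw [C_dvd_iff_dvd_coeff]
      intro m
      apply hker
      rw [← coeff_map, h4, coeff_zero]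
    rw [pow_succ, C_mul]
    exact mul_dvd_mul_left _ h5
  constructor
  · intro h0
    rw [Ideal.eq_top_iff_one] at h0
    have := map_span_mem π h 1 h0
    rw [map_one] at this
    exact hp.ne_top ((Ideal.eq_top_iff_one _).2 this)
  · intro F G hFG
    by_contra hcon
    push Not at hcon
    obtain ⟨k, F', hF1, hF2⟩ := key F hcon.1
    obtain ⟨m, G', hG1, hG2⟩ := key G hcon.2
    have h1 : C (l ^ k * l ^ m) * (F' * G') ∈ Ideal.span (Set.range h) := by
      have h2 : C (l ^ k * l ^ m) * (F' * G') = F * G - ((F - C (l ^ k) * F') * G +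
        C (l ^ k) * F' * (G - C (l ^ m) * G')) := by rw [C_mul]; ring
      rw [h2]
      exact sub_mem hFG (add_mem (Ideal.mul_mem_right _ _ hF1) (Ideal.mul_mem_left _ _ hG1))
    have h2 := nzd_mod d h hT _ (fun a ha => hnz' m _ (hnz' k _ (by rw [← mul_assoc]; exact ha))) _ h1
    have h3 := map_span_mem π h _ h2
    rw [map_mul] at h3
    exact (hp.mem_or_mem h3).elim hF2 hG2

lemma dom_iso {Λ Λ' : Type} [CommRing Λ] [CommRing Λ'] (e : Λ →+* Λ') (e' : Λ' →+* Λ)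
    (he : e'.comp e = RingHom.id Λ) (h : κ → MvPolynomial κ Λ)
    (hp : (Ideal.span (Set.range fun j => MvPolynomial.map e (h j))).IsPrime) :
    (Ideal.span (Set.range h)).IsPrime := by
  have : Ideal.span (Set.range h) =
      Ideal.comap (MvPolynomial.map e) (Ideal.span (Set.range fun j => MvPolynomial.map e (h j))) := by
    refine le_antisymm (fun F hF => map_span_mem e h F hF) fun F hF => ?_
    have h1 := map_span_mem e' _ _ (Ideal.mem_comap.1 hF)
    have h2 : ∀ G : MvPolynomial κ Λ, MvPolynomial.map e' (MvPolynomial.map e G) = G := by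
      intro G; rw [map_map, he, MvPolynomial.map_id]
    simpa only [h2] using h1
  rw [this]
  exact Ideal.IsPrime.comap _

lemma dom_x0 {Λ0 : Type} [CommRing Λ0] (h : κ → MvPolynomial κ (MvPolynomial (Fin 0) Λ0))
    (hp : (Ideal.span (Set.range fun j => MvPolynomial.map constantCoeff (h j))).IsPrime) :
    (Ideal.span (Set.range h)).IsPrime := by
  have he : (C : Λ0 →+* MvPolynomial (Fin 0) Λ0).comp constantCoeff = RingHom.id _ := by
    refine MvPolynomial.ringHom_ext (fun r => ?_) (fun i => i.elim0)
    simp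
  obtain ⟨π, hπ⟩ : ∃ π : MvPolynomial (Fin 0) Λ0 →+* Λ0, π = constantCoeff := ⟨_, rfl⟩
  rw [← hπ] at he hp
  exact dom_iso π C he h hp

lemma dom_x (n : ℕ) : ∀ {Λ0 : Type} [CommRing Λ0] (d : κ → ℕ)
    (h : κ → MvPolynomial κ (MvPolynomial (Fin n) Λ0)), TopW d h →
    (Ideal.span (Set.range fun j => MvPolynomial.map constantCoeff (h j))).IsPrime →
    (Ideal.span (Set.range h)).IsPrime := by
  induction n with
  | zero =>
    intro Λ0 _ d h hT hp
    exact dom_x0 h hp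
  | succ n ih =>
    intro Λ0 _ d h hT hp
    let E := finSuccEquiv Λ0 n
    let π : MvPolynomial (Fin (n + 1)) Λ0 →+* MvPolynomial (Fin n) Λ0 :=
      Polynomial.constantCoeff.comp (E : MvPolynomial (Fin (n + 1)) Λ0 →+* _)
    have hE : E (X 0) = Polynomial.X := finSuccEquiv_X_zero
    have hdvd : ∀ k a, Polynomial.X ^ k ∣ E a ↔ X 0 ^ k ∣ a := by
      intro k a
      rw [← hE, ← map_pow]
      exact map_dvd_iff E
    refine dom_step π (X 0) ?_ ?_ ?_ d h hT (ih d _ (hT.map π) ?_)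
    · intro a ha
      have := (hdvd 1 a).1 (by rw [pow_one]; exact Polynomial.X_dvd_iff.2 ha)
      simpa using this
    · intro a ha
      apply E.injective
      have := congrArg E ha
      rw [map_mul, hE, map_zero] at this
      rw [map_zero]
      exact (Polynomial.monic_X.mul_right_eq_zero_iff).1 this
    · intro a ha
      refine ⟨(E a).natDegree + 1, fun hd => ha ?_⟩
      rw [← hdvd] at hd
      have : E a = 0 := by
        ext1 i
        by_cases hi : i < (E a).natDegree + 1
        · rw [Polynomial.X_pow_dvd_iff.1 hd i hi, Polynomial.coeff_zero]
        · rw [Polynomial.coeff_eq_zero_of_natDegree_lt (by omega), Polynomial.coeff_zero]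
      simpa using this
    · have hc : (constantCoeff : MvPolynomial (Fin n) Λ0 →+* Λ0).comp π = constantCoeff := by
        refine MvPolynomial.ringHom_ext (fun r => ?_) (fun i => ?_)
        · have : E (C r) = Polynomial.C (C r) := by
            rw [← MvPolynomial.algebraMap_eq, AlgEquiv.commutes]; rfl
          simp [π, this]
        · refine Fin.cases ?_ (fun i => ?_) i
          · simp [π, hE]
          · have : E (X i.succ) = Polynomial.C (X i) := finSuccEquiv_X_succ
            simp [π, this]
      simp only [map_map, hc]
      exact hp

lemma dom_homs {B K : Type} [CommRing B] [Field K] (am : MvPolynomial (κ ⊕ κ) B →+* K) (u : κ → K) :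
    ∃ (ε : MvPolynomial κ (MvPolynomial (κ ⊕ κ) B) →+* K)
      (η : MvPolynomial (κ ⊕ κ) B →+* MvPolynomial κ (MvPolynomial (κ ⊕ κ) B)),
      (∀ b, ε (C (C b)) = am (C b)) ∧ (∀ j, ε (C (X (Sum.inl j))) = u j) ∧
      (∀ j, ε (C (X (Sum.inr j))) = am (X (Sum.inr j))) ∧ (∀ j, ε (X j) = am (X (Sum.inl j))) ∧
      (∀ b, η (C b) = C (C b)) ∧ (∀ j, η (X (Sum.inl j)) = X j) ∧
      (∀ j, η (X (Sum.inr j)) = C (X (Sum.inr j))) := by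
  refine ⟨eval₂Hom (eval₂Hom (am.comp C) (Sum.elim u (fun j => am (X (Sum.inr j)))))
    (fun j => am (X (Sum.inl j))), eval₂Hom (C.comp C) (Sum.elim (fun j => X j)
    (fun j => C (X (Sum.inr j)))), ?_, ?_, ?_, ?_, ?_, ?_, ?_⟩ <;> intro <;> simp

lemma dom_base {B : Type} [CommRing B] [IsDomain B] (c : κ → B) (d : κ → ℕ)
    (h : κ → MvPolynomial κ (MvPolynomial (κ ⊕ κ) B)) (hT : TopW d h)
    (hh : ∀ j, h j = X j ^ d j + C (X (Sum.inl j) * X (Sum.inr j) ^ (d j - 1)) - C (C (c j))) :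
    (Ideal.span (Set.range h)).IsPrime := by
  classical
  obtain ⟨K, _, am, hinj⟩ : ∃ (K : Type) (_ : Field K) (am : MvPolynomial (κ ⊕ κ) B →+* K),
      Function.Injective am := ⟨FractionRing (MvPolynomial (κ ⊕ κ) B), inferInstance,
        algebraMap _ _, IsFractionRing.injective _ _⟩
  obtain ⟨ε, η, e1, e2, e3, e4, n1, n2, n3⟩ := dom_homs am
    (fun j => (am (C (c j)) - am (X (Sum.inl j)) ^ d j) / am (X (Sum.inr j)) ^ (d j - 1))
  have hεη : ∀ F, ε (η F) = am F := by
    intro F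
    have : ε.comp η = am := by
      refine MvPolynomial.ringHom_ext (fun r => ?_) (fun i => ?_)
      · rw [RingHom.comp_apply, n1, e1]
      · rcases i with j | j
        · rw [RingHom.comp_apply, n2, e4]
        · rw [RingHom.comp_apply, n3, e3]
    exact congrArg (fun g => g F) this
  have hX : ∀ j, am (X (Sum.inr j)) ≠ 0 := fun j h0 =>
    X_ne_zero (R := B) (Sum.inr j : κ ⊕ κ) (hinj (by rw [h0, map_zero]))
  have hIε : ∀ F ∈ Ideal.span (Set.range h), ε F = 0 := by
    intro F hF
    have : Ideal.span (Set.range h) ≤ RingHom.ker ε := by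
      rw [Ideal.span_le]
      rintro _ ⟨j, rfl⟩
      rw [SetLike.mem_coe, RingHom.mem_ker, hh]
      have := hX j
      rw [map_sub, map_add, map_pow, C_mul, C_pow, map_mul, map_pow, e1, e2, e3, e4,
        div_mul_cancel₀ _ (pow_ne_zero _ this)]
      ring
    exact this hF
  obtain ⟨s, hsd⟩ : ∃ s : MvPolynomial (κ ⊕ κ) B, s = ∏ j, X (Sum.inr j) ^ (d j - 1) := ⟨_, rfl⟩
  have hs : s ≠ 0 := hsd ▸ Finset.prod_ne_zero_iff.2 fun j _ => pow_ne_zero _ (X_ne_zero _)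
  have hηs : η s = C s := by simp only [hsd, map_prod, map_pow, n3]
  have hclaim : ∀ F : MvPolynomial κ (MvPolynomial (κ ⊕ κ) B), ∃ N F', C (s ^ N) * F - η F' ∈ Ideal.span (Set.range h) := by
    have hadd : ∀ F G : MvPolynomial κ (MvPolynomial (κ ⊕ κ) B),
        (∃ N F', C (s ^ N) * F - η F' ∈ Ideal.span (Set.range h)) →
        (∃ N F', C (s ^ N) * G - η F' ∈ Ideal.span (Set.range h)) →
        (∃ N F', C (s ^ N) * (F + G) - η F' ∈ Ideal.span (Set.range h)) := by
      rintro F G ⟨N, F', h1⟩ ⟨M, G', h2⟩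
      refine ⟨N + M, s ^ M * F' + s ^ N * G', ?_⟩
      have := add_mem (Ideal.mul_mem_left _ (C (s ^ M)) h1) (Ideal.mul_mem_left _ (C (s ^ N)) h2)
      have e : C (s ^ (N + M)) * (F + G) - η (s ^ M * F' + s ^ N * G') =
        C (s ^ M) * (C (s ^ N) * F - η F') + C (s ^ N) * (C (s ^ M) * G - η G') := by
        simp only [map_add, map_mul, map_pow, hηs, pow_add]; ring
      rw [e]; exact this
    have hmul : ∀ F G : MvPolynomial κ (MvPolynomial (κ ⊕ κ) B),
        (∃ N F', C (s ^ N) * F - η F' ∈ Ideal.span (Set.range h)) →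
        (∃ N F', C (s ^ N) * G - η F' ∈ Ideal.span (Set.range h)) →
        (∃ N F', C (s ^ N) * (F * G) - η F' ∈ Ideal.span (Set.range h)) := by
      rintro F G ⟨N, F', h1⟩ ⟨M, G', h2⟩
      refine ⟨N + M, F' * G', ?_⟩
      have := add_mem (Ideal.mul_mem_right (C (s ^ M) * G) _ h1) (Ideal.mul_mem_left _ (η F') h2)
      have e : C (s ^ (N + M)) * (F * G) - η (F' * G') =
        (C (s ^ N) * F - η F') * (C (s ^ M) * G) + η F' * (C (s ^ M) * G - η G') := by
        rw [map_mul, pow_add, C_mul]; ring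
      rw [e]; exact this
    have hXw : ∀ j, ∃ N F', C (s ^ N) * (X j : MvPolynomial κ (MvPolynomial (κ ⊕ κ) B)) - η F' ∈ Ideal.span (Set.range h) :=
      fun j => ⟨0, X (Sum.inl j), by rw [n2, pow_zero, C_1, one_mul, sub_self]; exact zero_mem _⟩
    have hXz : ∀ i, ∃ N F', C (s ^ N) * (C (X i) : MvPolynomial κ (MvPolynomial (κ ⊕ κ) B)) - η F' ∈ Ideal.span (Set.range h) := by
      rintro (j | j)
      · refine ⟨1, (∏ i ∈ Finset.univ.erase j, X (Sum.inr i) ^ (d i - 1)) *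
          (C (c j) - X (Sum.inl j) ^ d j), ?_⟩
        have h1 : s = X (Sum.inr j) ^ (d j - 1) *
          ∏ i ∈ Finset.univ.erase j, X (Sum.inr i) ^ (d i - 1) :=
          hsd.trans (Finset.mul_prod_erase _ _ (Finset.mem_univ j)).symm
        have h2 : h j ∈ Ideal.span (Set.range h) := Ideal.subset_span ⟨j, rfl⟩
        have h3 := Ideal.mul_mem_left _ (C (∏ i ∈ Finset.univ.erase j, X (Sum.inr i) ^ (d i - 1))) h2
        have h4 : η (∏ i ∈ Finset.univ.erase j, X (Sum.inr i) ^ (d i - 1)) =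
          C (∏ i ∈ Finset.univ.erase j, X (Sum.inr i) ^ (d i - 1)) := by
          simp only [map_prod, map_pow, n3]
        have e : C (s ^ 1) * C (X (Sum.inl j)) - η ((∏ i ∈ Finset.univ.erase j, X (Sum.inr i) ^ (d i - 1)) *
          (C (c j) - X (Sum.inl j) ^ d j)) = C (∏ i ∈ Finset.univ.erase j, X (Sum.inr i) ^ (d i - 1)) * h j := by
          rw [map_mul, h4, map_sub, hh, pow_one, h1]; simp only [map_mul, map_pow, n1, n2]; ring
        rw [e]; exact h3
      · exact ⟨0, X (Sum.inr j), by rw [n3, pow_zero, C_1, one_mul, sub_self]; exact zero_mem _⟩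
    intro F
    induction F using MvPolynomial.induction_on with
    | C a =>
      induction a using MvPolynomial.induction_on with
      | C b => exact ⟨0, C b, by rw [n1, pow_zero, C_1, one_mul, sub_self]; exact zero_mem _⟩
      | add p q hp hq => rw [C_add]; exact hadd _ _ hp hq
      | mul_X p i hp => rw [C_mul]; exact hmul _ _ hp (hXz i)
    | add p q hp hq => exact hadd _ _ hp hq
    | mul_X p i hp => exact hmul _ _ hp (hXw i)
  have hker : Ideal.span (Set.range h) = RingHom.ker ε := by
    refine le_antisymm (fun F hF => hIε F hF) fun F hF => ?_
    rw [RingHom.mem_ker] at hF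
    obtain ⟨N, F', hN⟩ := hclaim F
    have h1 := hIε _ hN
    rw [map_sub, map_mul, hF, mul_zero, hεη, zero_sub, neg_eq_zero] at h1
    have h2 : F' = 0 := hinj (by rw [h1, map_zero])
    rw [h2, map_zero, sub_zero] at hN
    refine nzd_mod d h hT _ (fun a ha => ?_) _ hN
    exact (mul_eq_zero.1 ha).resolve_left (pow_ne_zero _ hs)
  rw [hker]
  exact RingHom.ker_isPrime ε

end
end

section
open MvPolynomial
set_option linter.unusedSectionVars false

section
variable {A S ι : Type} [CommRing A] [CommRing S] [Algebra A S]

lemma mem_map_basis (b : Module.Basis ι A S) (J : Ideal A) (F : S) :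
    F ∈ J.map (algebraMap A S) ↔ ∀ i, b.repr F i ∈ J := by
  constructor
  · intro hF i
    have h1 : F ∈ (J • ⊤ : Submodule A S) := by rw [Ideal.smul_top_eq_map]; exact hF
    refine Submodule.smul_induction_on h1 ?_ ?_
    · intro r hr n _
      rw [map_smul, Finsupp.smul_apply, smul_eq_mul]
      exact J.mul_mem_right _ hr
    · intro x y hx hy
      rw [map_add, Finsupp.add_apply]
      exact add_mem hx hy
  · intro h
    rw [← b.linearCombination_repr F, Finsupp.linearCombination_apply, Finsupp.sum]
    refine sum_mem fun i _ => ?_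
    rw [Algebra.smul_def]
    exact Ideal.mul_mem_right _ _ (Ideal.mem_map_of_mem _ (h i))

lemma map_iInf_basis (b : Module.Basis ι A S) {l : Type} (J : l → Ideal A) :
    (⨅ j, J j).map (algebraMap A S) = ⨅ j, (J j).map (algebraMap A S) := by
  ext F
  simp only [Ideal.mem_iInf, mem_map_basis b]
  exact forall_comm

lemma smul_mem_map_of_mul (Q P : Ideal A) (m : A) (hm : ∀ p ∈ P, p * m ∈ Q) (x : S)
    (hx : x ∈ P.map (algebraMap A S)) : m • x ∈ Q.map (algebraMap A S) := by
  have h1 : x ∈ (P • ⊤ : Submodule A S) := by rw [Ideal.smul_top_eq_map]; exact hx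
  refine Submodule.smul_induction_on h1 ?_ ?_
  · intro r hr n _
    rw [smul_smul, mul_comm, Algebra.smul_def]
    exact Ideal.mul_mem_right _ _ (Ideal.mem_map_of_mem _ (hm r hr))
  · intro x y hx hy
    rw [smul_add]; exact add_mem hx hy

lemma indep_rel (Q P : Ideal A) (hP : P.IsPrime) (m : ι → A) (s : Finset ι)
    (hm : ∀ i, ∀ p ∈ P, p * m i ∈ Q) :
    ∃ (L : Finset ι) (t : A) (d : ι → ι → A), t ∉ P ∧
      (∀ e : ι → A, ∑ l ∈ L, e l * m l ∈ Q → ∀ l ∈ L, e l ∈ P) ∧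
      ∀ i ∈ s, t * m i - ∑ l ∈ L, d i l * m l ∈ Q := by
  classical
  let ind : Finset ι → Prop := fun L => ∀ e : ι → A, ∑ l ∈ L, e l * m l ∈ Q → ∀ l ∈ L, e l ∈ P
  obtain ⟨L, hL, hmax⟩ := Finset.exists_max_image (s.powerset.filter ind) Finset.card
    ⟨∅, by simp [ind]⟩
  rw [Finset.mem_filter, Finset.mem_powerset] at hL
  have key : ∀ i ∈ s, ∃ (t : A) (d : ι → A), t ∉ P ∧ t * m i - ∑ l ∈ L, d l * m l ∈ Q := by
    intro i hi
    by_cases hiL : i ∈ L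
    · refine ⟨1, fun l => if l = i then 1 else 0, fun h => hP.ne_top ((Ideal.eq_top_iff_one _).2 h), ?_⟩
      simp [hiL]
    · have h1 : ¬ ind (insert i L) := by
        intro h
        have := hmax (insert i L) (by
          rw [Finset.mem_filter, Finset.mem_powerset]
          exact ⟨Finset.insert_subset hi hL.1, h⟩)
        rw [Finset.card_insert_of_notMem hiL] at this
        omega
      simp only [ind, not_forall] at h1
      obtain ⟨e, he, l, hl, hel⟩ := h1
      rw [Finset.sum_insert hiL] at he
      refine ⟨e i, fun l => - e l, ?_, ?_⟩
      · intro hei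
        have h2 : ∑ l ∈ L, e l * m l ∈ Q := by
          have := sub_mem he (hm i _ hei)
          rwa [add_sub_cancel_left] at this
        rcases Finset.mem_insert.1 hl with rfl | hl
        · exact hel hei
        · exact hel (hL.2 e h2 l hl)
      · simpa [Finset.sum_neg_distrib] using he
  choose! t d ht hd using key
  refine ⟨L, ∏ i ∈ s, t i, fun i l => (∏ i' ∈ s.erase i, t i') * d i l, ?_, hL.2, ?_⟩
  · intro h
    obtain ⟨i, hi, h⟩ := (hP.prod_mem_iff).1 h
    exact ht i hi h
  · intro i hi
    have := Q.mul_mem_left (∏ i' ∈ s.erase i, t i') (hd i hi)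
    rw [mul_sub, Finset.mul_sum, ← mul_assoc, Finset.prod_erase_mul _ _ hi] at this
    simpa only [mul_assoc] using this

lemma free_key (b : Module.Basis ι A S) (Q P : Ideal A) (hP : P.IsPrime) (hQ : ∀ t m, t * m ∈ Q → t ∉ P → m ∈ Q)
    (hPS : (P.map (algebraMap A S)).IsPrime) (a c : S) (hc : c ∉ P.map (algebraMap A S))
    (hac : c * a ∈ Q.map (algebraMap A S)) (ha : ∀ p ∈ P, p • a ∈ Q.map (algebraMap A S)) :
    a ∈ Q.map (algebraMap A S) := by
  classical
  have hm : ∀ i, ∀ p ∈ P, p * b.repr a i ∈ Q := by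
    intro i p hp
    have := (mem_map_basis b Q _).1 (ha p hp) i
    rwa [map_smul, Finsupp.smul_apply, smul_eq_mul] at this
  obtain ⟨L, t, d, ht, hind, hrel⟩ := indep_rel Q P hP (fun i => b.repr a i) (b.repr a).support hm
  let u : ι → S := fun l => ∑ i ∈ (b.repr a).support, d i l • b i
  have h1 : t • a - ∑ l ∈ L, b.repr a l • u l ∈ Q.map (algebraMap A S) := by
    have e : t • a - ∑ l ∈ L, b.repr a l • u l =
        ∑ i ∈ (b.repr a).support, (t * b.repr a i - ∑ l ∈ L, d i l * b.repr a l) • b i := by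
      conv_lhs => enter [1]; rw [← b.linearCombination_repr a, Finsupp.linearCombination_apply, Finsupp.sum]
      simp only [u, Finset.smul_sum, sub_smul, Finset.sum_smul, Finset.sum_sub_distrib, smul_smul]
      congr 1
      rw [Finset.sum_comm]
      simp only [mul_comm]
    rw [e]
    refine sum_mem fun i hi => ?_
    rw [Algebra.smul_def]
    exact Ideal.mul_mem_right _ _ (Ideal.mem_map_of_mem _ (hrel i hi))
  have h2 : ∑ l ∈ L, b.repr a l • (c * u l) ∈ Q.map (algebraMap A S) := by
    have h3 := sub_mem (Ideal.mul_mem_left _ (algebraMap A S t) hac) (Ideal.mul_mem_left _ c h1)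
    have e : algebraMap A S t * (c * a) - c * (t • a - ∑ l ∈ L, b.repr a l • u l) =
      ∑ l ∈ L, b.repr a l • (c * u l) := by
      rw [mul_sub, Finset.mul_sum]
      simp only [Algebra.smul_def]
      rw [show algebraMap A S t * (c * a) = c * (algebraMap A S t * a) by ring, sub_sub_cancel]
      refine Finset.sum_congr rfl fun l _ => by ring
    rwa [e] at h3
  have h3 : ∀ l ∈ L, u l ∈ P.map (algebraMap A S) := by
    intro l hl
    have h4 : c * u l ∈ P.map (algebraMap A S) := by
      rw [mem_map_basis b]
      intro i
      refine hind (fun l => b.repr (c * u l) i) ?_ l hl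
      have := (mem_map_basis b Q _).1 h2 i
      simp only [map_sum, map_smul, Finsupp.finsetSum_apply, Finsupp.smul_apply, smul_eq_mul] at this
      simpa only [mul_comm] using this
    exact (hPS.mem_or_mem h4).resolve_left hc
  have h4 : t • a ∈ Q.map (algebraMap A S) := by
    have := add_mem h1 (sum_mem (fun l hl => smul_mem_map_of_mul Q P _ (hm l) _ (h3 l hl)) :
      ∑ l ∈ L, b.repr a l • u l ∈ _)
    rwa [sub_add_cancel] at this
  rw [mem_map_basis b]
  intro i
  refine hQ t _ ?_ ht
  have := (mem_map_basis b Q _).1 h4 i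
  rwa [map_smul, Finsupp.smul_apply, smul_eq_mul] at this

lemma free_primary (b : Module.Basis ι A S) [IsNoetherianRing A] (Q : Ideal A) (hQ : Q.IsPrimary)
    (hPS : (Q.radical.map (algebraMap A S)).IsPrime) :
    (Q.map (algebraMap A S)).IsPrimary := by
  have hP := Ideal.isPrime_radical hQ
  have hQ' : ∀ t m, t * m ∈ Q → t ∉ Q.radical → m ∈ Q := by
    intro t m htm ht
    rw [mul_comm] at htm
    exact ((Ideal.isPrimary_iff.1 hQ).2 htm).resolve_right ht
  obtain ⟨N, hN⟩ := Q.exists_radical_pow_le_of_fg (IsNoetherian.noetherian _)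
  rw [Ideal.isPrimary_iff]
  refine ⟨fun h => hPS.ne_top (top_le_iff.1 (h ▸ Ideal.map_mono Ideal.le_radical)), ?_⟩
  intro x y hxy
  by_cases hy : y ∈ Q.radical.map (algebraMap A S)
  · right
    refine ⟨N, ?_⟩
    have := Ideal.pow_mem_pow hy N
    rw [← Ideal.map_pow] at this
    exact Ideal.map_mono hN this
  left
  have key : ∀ k, ∀ a, y * a ∈ Q.map (algebraMap A S) →
      (∀ p ∈ Q.radical ^ k, p • a ∈ Q.map (algebraMap A S)) → a ∈ Q.map (algebraMap A S) := by
    intro k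
    induction k with
    | zero => intro a _ h; simpa using h 1 (by simp)
    | succ k ih =>
      intro a ha h
      refine ih a ha fun p hp => ?_
      refine free_key b Q _ hP hQ' hPS _ y hy ?_ ?_
      · rw [mul_smul_comm, Algebra.smul_def]; exact Ideal.mul_mem_left _ _ ha
      · intro p' hp'
        rw [smul_smul]
        refine h _ ?_
        rw [pow_succ']
        exact Ideal.mul_mem_mul hp' hp
  refine key N x (by rwa [mul_comm]) fun p hp => ?_
  rw [Algebra.smul_def]
  exact Ideal.mul_mem_right _ _ (Ideal.mem_map_of_mem _ (hN hp))
end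
end

section
open MvPolynomial
set_option linter.unusedSectionVars false
set_option linter.style.haveILetI false
set_option linter.unusedSimpArgs false

section
variable {A S S' ι : Type} [CommRing A] [CommRing S] [CommRing S']

def FreeHom (φ : A →+* S) : Prop := @Module.Free A S _ _ φ.toAlgebra.toModule

lemma FreeHom.primary {φ : A →+* S} (hφ : FreeHom φ) [IsNoetherianRing A] (Q : Ideal A)
    (hQ : Q.IsPrimary) (hPS : (Q.radical.map φ).IsPrime) : (Q.map φ).IsPrimary := by
  letI := φ.toAlgebra
  haveI : Module.Free A S := hφ
  exact free_primary (Module.Free.chooseBasis A S) Q hQ hPS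

lemma FreeHom.iInf {φ : A →+* S} (hφ : FreeHom φ) {l : Type} (J : l → Ideal A) :
    (⨅ j, J j).map φ = ⨅ j, (J j).map φ := by
  letI := φ.toAlgebra
  haveI : Module.Free A S := hφ
  exact map_iInf_basis (Module.Free.chooseBasis A S) J

lemma FreeHom.comp {φ : A →+* S} (hφ : FreeHom φ) {ψ : S →+* S'} (hψ : FreeHom ψ) :
    FreeHom (ψ.comp φ) := by
  letI := φ.toAlgebra
  letI := ψ.toAlgebra
  letI := (ψ.comp φ).toAlgebra
  haveI : Module.Free A S := hφ
  haveI : Module.Free S S' := hψ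
  haveI : IsScalarTower A S S' := IsScalarTower.of_algebraMap_eq (fun _ => rfl)
  exact Module.Free.trans (S := S)

lemma FreeHom.of (φ : A →+* S) (e : ι → S)
    (hi : ∀ (t : Finset ι) (a : ι → A), ∑ i ∈ t, φ (a i) * e i = 0 → ∀ i ∈ t, a i = 0)
    (hs : ∀ F, ∃ (t : Finset ι) (a : ι → A), F = ∑ i ∈ t, φ (a i) * e i) : FreeHom φ := by
  letI := φ.toAlgebra
  refine Module.Free.of_basis (Module.Basis.mk (v := e) ?_ ?_ : Module.Basis ι A S)
  · rw [linearIndependent_iff']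
    intro t a h
    exact hi t a h
  · intro F _
    obtain ⟨t, a, rfl⟩ := hs F
    refine sum_mem fun i _ => ?_
    exact Submodule.smul_mem _ (a i) (Submodule.subset_span ⟨i, rfl⟩)

lemma prime_ext (φ : A →+* S) (P : Ideal A) (θ : S →+* S') (γ : A ⧸ P →+* S')
    (ψ : S' →+* S ⧸ (P.map φ)) (J : Ideal S') (hJ : J.IsPrime)
    (h1 : ∀ a, θ (φ a) - γ (Ideal.Quotient.mk P a) ∈ J) (h2 : ∀ x ∈ J, ψ x = 0)
    (h3 : ∀ x, ψ (θ x) = Ideal.Quotient.mk _ x) : (P.map φ).IsPrime := by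
  have : P.map φ = J.comap θ := by
    refine le_antisymm ?_ ?_
    · rw [Ideal.map_le_iff_le_comap]
      intro p hp
      have := h1 p
      rw [Ideal.Quotient.eq_zero_iff_mem.2 hp, map_zero, sub_zero] at this
      exact this
    · intro x hx
      have := h2 _ (Ideal.mem_comap.1 hx)
      rwa [h3, Ideal.Quotient.eq_zero_iff_mem] at this
  rw [this]
  exact Ideal.IsPrime.comap _
end

section
variable {κ : Type} [Fintype κ]

lemma free_mapC {ζ B : Type} [CommRing B] :
    FreeHom (MvPolynomial.map (C : B →+* MvPolynomial ζ B) :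
      MvPolynomial κ B →+* MvPolynomial κ (MvPolynomial ζ B)) := by
  classical
  have hx : ∀ (a : MvPolynomial κ B) (μ' μ : ζ →₀ ℕ) (m : κ →₀ ℕ), coeff μ (coeff m
      (MvPolynomial.map (C : B →+* MvPolynomial ζ B) a * C (monomial μ' 1))) =
      if μ' = μ then coeff m a else 0 := by
    intro a μ' μ m
    rw [mul_comm, coeff_C_mul, coeff_map, mul_comm, coeff_C_mul, coeff_monomial]
    split_ifs <;> simp
  refine FreeHom.of _ (fun μ : ζ →₀ ℕ => C (monomial μ 1)) ?_ ?_
  · intro t a h μ hμ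
    ext m
    have h1 := congrArg (fun F => coeff μ (coeff m F)) h
    simp only [coeff_sum, hx, coeff_zero] at h1
    simpa [hμ] using h1
  · intro F
    refine ⟨F.support.biUnion fun m => (coeff m F).support, fun μ => ∑ m ∈ F.support,
      monomial m (coeff μ (coeff m F)), ?_⟩
    ext m μ
    simp only [coeff_sum, hx, coeff_monomial, Finset.sum_ite_eq']
    by_cases hm : m ∈ F.support
    · simp only [hm, if_true]
      split_ifs with h1
      · rfl
      · by_contra h3
        exact h1 (Finset.mem_biUnion.2 ⟨m, hm, mem_support_iff.2 (fun h => h3 h)⟩)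
    · simp [hm, notMem_support_iff.1 hm]

lemma free_low {Λ : Type} [CommRing Λ] (d : κ → ℕ) (h : κ → MvPolynomial κ Λ) (hT : TopW d h) :
    FreeHom (eval₂Hom C h : MvPolynomial κ Λ →+* MvPolynomial κ Λ) := by
  classical
  obtain ⟨φ, hφC, hφX⟩ : ∃ φ : MvPolynomial κ Λ →+* MvPolynomial κ Λ, (∀ a, φ (C a) = C a) ∧
    ∀ j, φ (X j) = h j := ⟨eval₂Hom C h, by simp, by simp⟩
  have hφ : eval₂Hom C h = φ := by
    refine MvPolynomial.ringHom_ext (fun r => ?_) (fun i => ?_)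
    · simp [hφC]
    · simp [hφX]
  rw [hφ]
  obtain ⟨ev, hevC, hevX⟩ : ∃ ev : MvPolynomial κ (MvPolynomial κ Λ) →+* MvPolynomial κ Λ,
    (∀ a, ev (C a) = φ a) ∧ ∀ j, ev (X j) = X j := ⟨eval₂Hom φ X, by simp, by simp⟩
  let h' : κ → MvPolynomial κ (MvPolynomial κ Λ) := fun j => MvPolynomial.map C (h j) - C (X j)
  have hT' : TopW d h' := by
    intro j
    refine ⟨(hT j).1, ?_⟩
    have h1 := ((hT.map (C : Λ →+* MvPolynomial κ Λ)) j).2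
    intro m hm
    have h2 : LTd (Finsupp.single j (d j)).degree (-C (X j) : MvPolynomial κ (MvPolynomial κ Λ)) := by
      intro m hm
      rw [coeff_neg, coeff_C] at hm
      split_ifs at hm with h0
      · subst h0
        have := (hT j).1
        simpa using (by omega : 0 < d j)
      · simp at hm
    refine (LTd.add h1 h2) m ?_
    convert! hm using 2
    simp only [h']; ring
  have hsp : ∀ F, ev F = 0 → F ∈ Ideal.span (Set.range h') := by
    have : ∀ F, Ideal.Quotient.mk (Ideal.span (Set.range h')) F =
        Ideal.Quotient.mk (Ideal.span (Set.range h')) (MvPolynomial.map C (ev F)) := by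
      have : (Ideal.Quotient.mk (Ideal.span (Set.range h'))) =
        ((Ideal.Quotient.mk (Ideal.span (Set.range h'))).comp (MvPolynomial.map C)).comp ev := by
        refine MvPolynomial.ringHom_ext (fun r => ?_) (fun i => ?_)
        · simp only [RingHom.comp_apply, hevC]
          have : (Ideal.Quotient.mk (Ideal.span (Set.range h'))).comp C =
            ((Ideal.Quotient.mk (Ideal.span (Set.range h'))).comp (MvPolynomial.map C)).comp φ := by
            refine MvPolynomial.ringHom_ext (fun r => ?_) (fun i => ?_)
            · simp only [RingHom.comp_apply, hφC, map_C]
            · simp only [RingHom.comp_apply, hφX]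
              symm
              rw [Ideal.Quotient.eq]
              exact Ideal.subset_span ⟨i, rfl⟩
          exact congrArg (fun g => g r) this
        · simp only [RingHom.comp_apply, hevX, map_X]
      intro F
      exact congrArg (fun g => g F) this
    intro F hF
    have := this F
    rwa [hF, map_zero, map_zero, Ideal.Quotient.eq_zero_iff_mem] at this
  have hsp' : ∀ F ∈ Ideal.span (Set.range h'), ev F = 0 := by
    have h0 : ∀ F : MvPolynomial κ Λ, ev (MvPolynomial.map C F) = F := by
      intro F
      have : ev.comp (MvPolynomial.map C) = RingHom.id _ := by
        refine MvPolynomial.ringHom_ext (fun r => ?_) (fun i => ?_)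
        · simp only [RingHom.comp_apply, map_C, hevC, hφC, RingHom.id_apply]
        · simp only [RingHom.comp_apply, map_X, hevX, RingHom.id_apply]
      exact congrArg (fun g => g F) this
    have : Ideal.span (Set.range h') ≤ RingHom.ker ev := by
      rw [Ideal.span_le]
      rintro _ ⟨j, rfl⟩
      rw [SetLike.mem_coe, RingHom.mem_ker]
      simp only [h', map_sub, h0, hevC, hφX, sub_self]
    exact fun F hF => this hF
  have hevm : ∀ m a, ev (monomial m a) = φ a * monomial m 1 := by
    intro m a
    have : (monomial m a : MvPolynomial κ (MvPolynomial κ Λ)) = C a * MvPolynomial.map C (monomial m 1) := by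
      rw [map_monomial, C_mul_monomial, map_one, mul_one]
    have h0 : ∀ F : MvPolynomial κ Λ, ev (MvPolynomial.map C F) = F := by
      intro F
      have : ev.comp (MvPolynomial.map C) = RingHom.id _ := by
        refine MvPolynomial.ringHom_ext (fun r => ?_) (fun i => ?_)
        · simp only [RingHom.comp_apply, map_C, hevC, hφC, RingHom.id_apply]
        · simp only [RingHom.comp_apply, map_X, hevX, RingHom.id_apply]
      exact congrArg (fun g => g F) this
    rw [this, map_mul, h0, hevC]
  refine FreeHom.of φ (fun m : {m : κ →₀ ℕ // ∀ j, m j < d j} => (monomial m.1 1 : MvPolynomial κ Λ)) ?_ ?_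
  · intro t a h0
    let F : MvPolynomial κ (MvPolynomial κ Λ) := ∑ m ∈ t, monomial m.1 (a m)
    have hc : ∀ m, coeff m F = ∑ m' ∈ t, if m'.1 = m then a m' else 0 := by
      intro m; simp only [F, coeff_sum, coeff_monomial]
    have hlow : Low d F := by
      intro m hm
      rw [hc] at hm
      obtain ⟨m', _, h1⟩ := Finset.exists_ne_zero_of_sum_ne_zero hm
      split_ifs at h1 with h2
      · rw [← h2]; exact m'.2
      · exact absurd rfl h1
    have hF0 : F = 0 := by
      refine nf_unique d h' hT' F hlow (hsp F ?_)
      simp only [F, map_sum, hevm]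
      exact h0
    intro m hm
    have := hc m.1
    rw [hF0, coeff_zero] at this
    simpa [← Subtype.ext_iff, hm] using this.symm
  · intro F
    obtain ⟨c, hc, hFc⟩ := nf_exists d h' hT' (MvPolynomial.map C F)
    have h0 : ev (MvPolynomial.map C F) = F := by
      have : ev.comp (MvPolynomial.map C) = RingHom.id _ := by
        refine MvPolynomial.ringHom_ext (fun r => ?_) (fun i => ?_)
        · simp only [RingHom.comp_apply, map_C, hevC, hφC, RingHom.id_apply]
        · simp only [RingHom.comp_apply, map_X, hevX, RingHom.id_apply]
      exact congrArg (fun g => g F) this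
    have h1 := hsp' _ hFc
    rw [map_sub, h0, sub_eq_zero] at h1
    refine ⟨c.support.subtype _, fun m => coeff m.1 c, ?_⟩
    rw [Finset.sum_subtype_of_mem (fun m => φ (coeff m c) * monomial m 1)
      (fun m hm => hc m (mem_support_iff.1 hm)), h1]
    conv_lhs => rw [c.as_sum, map_sum]
    exact Finset.sum_congr rfl fun m _ => hevm m _

end
end

section
open MvPolynomial
set_option linter.unusedSectionVars false

section
variable {κ : Type} [Fintype κ]

abbrev RH (A S : Type) [CommRing A] [CommRing S] := A →+* S
abbrev IdC (A : Type) [CommRing A] := Ideal A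

lemma TopW_sub {Λ : Type} [CommRing Λ] {d : κ → ℕ} {h : κ → MvPolynomial κ Λ} (hT : TopW d h)
    (c : κ → Λ) : TopW d (fun j => h j - C (c j)) := by
  classical
  intro j
  refine ⟨(hT j).1, ?_⟩
  have h2 : LTd (Finsupp.single j (d j)).degree (-C (c j) : MvPolynomial κ Λ) := by
    intro m hm
    rw [coeff_neg, coeff_C] at hm
    split_ifs at hm with h0
    · subst h0
      have := (hT j).1
      simpa using (by omega : 0 < d j)
    · simp at hm
  intro m hm
  refine (LTd.add (hT j).2 h2) m ?_
  rw [sub_right_comm, sub_eq_add_neg] at hm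
  exact hm

lemma prime_ext' {A B S S' W : Type} [CommRing A] [CommRing B] [CommRing S] [CommRing S']
    [CommRing W] (φ : A →+* S) (P : Ideal A) (mk : A →+* B) (hmk : ∀ a ∈ P, mk a = 0)
    (θ : S →+* S') (γ : B →+* S') (q : S →+* W) (hq : ∀ x, q x = 0 → x ∈ P.map φ)
    (ψ : S' →+* W) (J : Ideal S') (hJ : J.IsPrime)
    (h1 : ∀ a, θ (φ a) - γ (mk a) ∈ J) (h2 : ∀ x ∈ J, ψ x = 0)
    (h3 : ∀ x, ψ (θ x) = q x) : (P.map φ).IsPrime := by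
  have : P.map φ = J.comap θ := by
    refine le_antisymm ?_ ?_
    · rw [Ideal.map_le_iff_le_comap]
      intro p hp
      have := h1 p
      rw [hmk p hp, map_zero, sub_zero] at this
      exact this
    · intro x hx
      have := h2 _ (Ideal.mem_comap.1 hx)
      rw [h3] at this
      exact hq _ this
  rw [this]
  exact Ideal.IsPrime.comap _

lemma ext3 {κ τ ρ B W : Type} [CommRing B] [CommRing W]
    (α β : RH (MvPolynomial κ (MvPolynomial τ (MvPolynomial ρ B))) (W))
    (h1 : ∀ a, α (C (C (C a))) = β (C (C (C a)))) (h2 : ∀ a, α (C (C (X a))) = β (C (C (X a))))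
    (h3 : ∀ a, α (C (X a)) = β (C (X a))) (h4 : ∀ a, α (X a) = β (X a)) : ∀ x, α x = β x := by
  have : α = β := by
    refine MvPolynomial.ringHom_ext (fun r => ?_) h4
    have : α.comp C = β.comp C := by
      refine MvPolynomial.ringHom_ext (fun r => ?_) h3
      have : (α.comp C).comp C = (β.comp C).comp C := MvPolynomial.ringHom_ext h1 h2
      exact congrArg (fun g => g r) this
    exact congrArg (fun g => g r) this
  intro x; rw [this]

lemma exists_theta {B : Type} [CommRing B] (ν : RH (ℂ) (B)) (n : ℕ) (d : κ → ℕ)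
    (h : κ → MvPolynomial κ (MvPolynomial (Fin n) (MvPolynomial (κ ⊕ κ) ℂ))) (hT : TopW d h) :
    ∃ θ : RH (MvPolynomial κ (MvPolynomial (Fin n) (MvPolynomial (κ ⊕ κ) ℂ))) (MvPolynomial κ (MvPolynomial (Fin n) (MvPolynomial (κ ⊕ κ) B))), (∀ a, θ (C (C (C a))) = C (C (C (ν a)))) ∧
      (∀ a, θ (C (C (X a))) = C (C (X a))) ∧ (∀ a, θ (C (X a)) = C (X a)) ∧
      (∀ a, θ (X a) = X a) ∧ TopW d (fun j => θ (h j)) ∧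
      ∀ F, MvPolynomial.map constantCoeff (θ F) =
        MvPolynomial.map (MvPolynomial.map ν) (MvPolynomial.map constantCoeff F) := by
  refine ⟨MvPolynomial.map (MvPolynomial.map (MvPolynomial.map ν)), by simp, by simp, by simp,
    by simp, hT.map _, ?_⟩
  intro F
  rw [map_map, map_map]
  congr 2

lemma exists_psi {κ τ ρ B W : Type} [CommRing B] [CommRing W] (β : RH (B) (W))
    (a : ρ → W) (b : τ → W) (c : κ → W) :
    ∃ ψ : RH (MvPolynomial κ (MvPolynomial τ (MvPolynomial ρ B))) (W),
    (∀ a, ψ (C (C (C a))) = β a) ∧ (∀ i, ψ (C (C (X i))) = a i) ∧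
    (∀ i, ψ (C (X i)) = b i) ∧ (∀ i, ψ (X i) = c i) :=
  ⟨eval₂Hom (eval₂Hom (eval₂Hom β a) b) c, by simp, by simp, by simp, by simp⟩

lemma hJ_aux {B : Type} [CommRing B] [IsDomain B] (n : ℕ) (d : κ → ℕ) (ν : RH (ℂ) (B))
    (h : κ → MvPolynomial κ (MvPolynomial (Fin n) (MvPolynomial (κ ⊕ κ) ℂ))) (h0 : ∀ j, MvPolynomial.map constantCoeff (h j) =
      X j ^ d j + C (X (Sum.inl j) * X (Sum.inr j) ^ (d j - 1)))
    (θ : RH (MvPolynomial κ (MvPolynomial (Fin n) (MvPolynomial (κ ⊕ κ) ℂ))) (MvPolynomial κ (MvPolynomial (Fin n) (MvPolynomial (κ ⊕ κ) B)))) (t5 : TopW d (fun j => θ (h j)))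
    (t6 : ∀ F, MvPolynomial.map constantCoeff (θ F) =
        MvPolynomial.map (MvPolynomial.map ν) (MvPolynomial.map constantCoeff F))
    (hB : κ → MvPolynomial κ (MvPolynomial (Fin n) (MvPolynomial (κ ⊕ κ) B))) (c : κ → B) (hBe : ∀ j, hB j = θ (h j) - C (C (C (c j)))) :
    (Ideal.span (Set.range hB)).IsPrime := by
  have hTB : TopW d hB := by
    have := TopW_sub t5 (fun j => C (C (c j)))
    rwa [show hB = _ from funext hBe]
  refine dom_x n d hB hTB ?_
  refine dom_base c d _ (hTB.map _) ?_
  intro j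
  simp only [hBe, map_sub, t6, h0]
  simp

lemma gen_mem {κ B S : Type} [CommRing B] [CommRing S] (α β : MvPolynomial κ B →+* S)
    (J : Ideal S) (h1 : ∀ a, α (C a) - β (C a) ∈ J) (h2 : ∀ i, α (X i) - β (X i) ∈ J) :
    ∀ a, α a - β a ∈ J := by
  intro a
  rw [← Ideal.Quotient.eq]
  have : (Ideal.Quotient.mk J).comp α = (Ideal.Quotient.mk J).comp β := by
    refine MvPolynomial.ringHom_ext (fun r => ?_) (fun i => ?_)
    · rw [RingHom.comp_apply, RingHom.comp_apply, Ideal.Quotient.eq]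
      exact h1 r
    · rw [RingHom.comp_apply, RingHom.comp_apply, Ideal.Quotient.eq]
      exact h2 i
  exact congrArg (fun g => g a) this

lemma prime_R0 {B W : Type} [CommRing B] [IsDomain B] [CommRing W] (n : ℕ) (d : κ → ℕ)
    (h : κ → MvPolynomial κ (MvPolynomial (Fin n) (MvPolynomial (κ ⊕ κ) ℂ))) (hT : TopW d h)
    (h0 : ∀ j, MvPolynomial.map constantCoeff (h j) =
      X j ^ d j + C (X (Sum.inl j) * X (Sum.inr j) ^ (d j - 1)))
    (φ : RH (MvPolynomial κ ℂ) (MvPolynomial κ (MvPolynomial (Fin n) (MvPolynomial (κ ⊕ κ) ℂ))))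
    (hφC : ∀ a, φ (C a) = C (C (C a))) (hφX : ∀ j, φ (X j) = h j)
    (P : IdC (MvPolynomial κ ℂ)) (mk : RH (MvPolynomial κ ℂ) (B)) (hmk : ∀ a ∈ P, mk a = 0)
    (q : RH (MvPolynomial κ (MvPolynomial (Fin n) (MvPolynomial (κ ⊕ κ) ℂ))) (W)) (hq : ∀ x, q x = 0 → x ∈ P.map φ)
    (β : RH (B) (W)) (hβ : ∀ a, β (mk a) = q (φ a)) : (P.map φ).IsPrime := by
  obtain ⟨ν, hν⟩ : ∃ ν : RH (ℂ) (B), ∀ a, ν a = mk (C a) := ⟨mk.comp C, fun _ => rfl⟩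
  obtain ⟨θ, t1, t2, t3, t4, t5, t6⟩ := exists_theta ν n d h hT
  obtain ⟨hB, hBe⟩ : ∃ hB : κ → MvPolynomial κ (MvPolynomial (Fin n) (MvPolynomial (κ ⊕ κ) B)),
    ∀ j, hB j = θ (h j) - C (C (C (mk (X j)))) := ⟨_, fun _ => rfl⟩
  have hJ := hJ_aux n d ν h h0 θ t5 t6 hB (fun j => mk (X j)) hBe
  obtain ⟨ψ, p1, p2, p3, p4⟩ := exists_psi β (fun i : κ ⊕ κ => q (C (C (X i))))
    (fun i : Fin n => q (C (X i))) (fun i : κ => q (X i))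
  have h3 : ∀ x, ψ (θ x) = q x := by
    refine ext3 (ψ.comp θ) q ?_ ?_ ?_ ?_ <;> intro a <;> rw [RingHom.comp_apply]
    · rw [t1, p1, hν, hβ, hφC]
    · rw [t2, p2]
    · rw [t3, p3]
    · rw [t4, p4]
  obtain ⟨γ, hγ⟩ : ∃ γ : RH (B) (MvPolynomial κ (MvPolynomial (Fin n) (MvPolynomial (κ ⊕ κ) B))), ∀ a, γ a = C (C (C a)) := ⟨C.comp (C.comp C), fun _ => rfl⟩
  obtain ⟨J, hJe⟩ : ∃ J : IdC (MvPolynomial κ (MvPolynomial (Fin n) (MvPolynomial (κ ⊕ κ) B))), J = Ideal.span (Set.range hB) := ⟨_, rfl⟩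
  rw [← hJe] at hJ
  have h1 : ∀ a, θ (φ a) - γ (mk a) ∈ J := by
    refine gen_mem (S := MvPolynomial κ (MvPolynomial (Fin n) (MvPolynomial (κ ⊕ κ) B)))
      (θ.comp φ) (γ.comp mk) J ?_ ?_
    · intro r
      rw [RingHom.comp_apply, RingHom.comp_apply, hφC, t1, hν, hγ, sub_self]
      exact zero_mem J
    · intro i
      rw [RingHom.comp_apply, RingHom.comp_apply, hφX, hγ, hJe]
      exact Ideal.subset_span ⟨i, hBe i⟩
  have h2 : ∀ x ∈ J, ψ x = 0 := by
    have : J ≤ RingHom.ker ψ := by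
      rw [hJe, Ideal.span_le]
      rintro _ ⟨j, rfl⟩
      rw [SetLike.mem_coe, RingHom.mem_ker, hBe, map_sub, h3, p1, hβ, hφX, sub_self]
    exact fun x hx => this hx
  exact prime_ext' (S := MvPolynomial κ (MvPolynomial (Fin n) (MvPolynomial (κ ⊕ κ) ℂ)))
      (S' := MvPolynomial κ (MvPolynomial (Fin n) (MvPolynomial (κ ⊕ κ) B))) φ P mk hmk θ γ q hq ψ J hJ h1 h2 h3

lemma quot_facts {A S : Type} [CommRing A] [CommRing S] (φ : A →+* S) (P : Ideal A)
    (hP : P.IsPrime) : ∃ (B W : Type) (_ : CommRing B) (_ : IsDomain B) (_ : CommRing W)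
    (mk : A →+* B) (q : S →+* W) (β : RH (B) (W)), (∀ a ∈ P, mk a = 0) ∧
    (∀ x, q x = 0 → x ∈ P.map φ) ∧ ∀ a, β (mk a) = q (φ a) := by
  refine ⟨A ⧸ P, S ⧸ (P.map φ), inferInstance, inferInstance, inferInstance,
    Ideal.Quotient.mk P, Ideal.Quotient.mk _,
    Ideal.Quotient.lift P ((Ideal.Quotient.mk (P.map φ)).comp φ) ?_, ?_, ?_, ?_⟩
  · intro a ha
    rw [RingHom.comp_apply, Ideal.Quotient.eq_zero_iff_mem]
    exact Ideal.mem_map_of_mem _ ha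
  · intro a ha; exact Ideal.Quotient.eq_zero_iff_mem.2 ha
  · intro a ha; exact Ideal.Quotient.eq_zero_iff_mem.1 ha
  · intro a; rw [Ideal.Quotient.lift_mk]; rfl

lemma ext_R0 (n : ℕ) (d : κ → ℕ)
    (h : κ → MvPolynomial κ (MvPolynomial (Fin n) (MvPolynomial (κ ⊕ κ) ℂ))) (hT : TopW d h)
    (h0 : ∀ j, MvPolynomial.map constantCoeff (h j) =
      X j ^ d j + C (X (Sum.inl j) * X (Sum.inr j) ^ (d j - 1)))
    (φ : RH (MvPolynomial κ ℂ) (MvPolynomial κ (MvPolynomial (Fin n) (MvPolynomial (κ ⊕ κ) ℂ))))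
    (hφC : ∀ a, φ (C a) = C (C (C a))) (hφX : ∀ j, φ (X j) = h j) :
    FreeHom (A := MvPolynomial κ ℂ)
      (S := MvPolynomial κ (MvPolynomial (Fin n) (MvPolynomial (κ ⊕ κ) ℂ))) φ ∧ ∀ P : IdC (MvPolynomial κ ℂ), P.IsPrime → (P.map φ).IsPrime := by
  constructor
  · have e : φ = (eval₂Hom C h).comp ((MvPolynomial.map C).comp (MvPolynomial.map C)) := by
      refine MvPolynomial.ringHom_ext (fun r => ?_) (fun i => ?_)
      · simp [hφC]
      · simp [hφX]
    rw [e]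
    exact (free_mapC.comp free_mapC).comp (free_low d h hT)
  · intro P hP
    obtain ⟨B, W, _, _, _, mk, q, β, h1, h2, h3⟩ := quot_facts (S := MvPolynomial κ (MvPolynomial (Fin n) (MvPolynomial (κ ⊕ κ) ℂ))) φ P hP
    exact prime_R0 n d h hT h0 φ hφC hφX P mk h1 q h2 β h3
end
end

section
open MvPolynomial
set_option linter.unusedSectionVars false

lemma descend {A R S : Type} [CommRing A] [CommRing R] [CommRing S] (ψ : A →+* R) (ι : R →+* S)
    (ρ : S →+* R) (hρ : ∀ x, ρ (ι x) = x) (Q : Ideal A) :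
    Q.map ψ = (Q.map (ι.comp ψ)).comap ι := by
  refine le_antisymm ?_ ?_
  · rw [← Ideal.map_map]
    exact Ideal.le_comap_map
  · intro x hx
    have h1 := Ideal.mem_map_of_mem ρ (Ideal.mem_comap.1 hx)
    rw [hρ, Ideal.map_map, ← RingHom.comp_assoc] at h1
    have : (ρ.comp ι) = RingHom.id R := RingHom.ext hρ
    rwa [this, RingHom.id_comp] at h1

lemma descend_primary {A R S : Type} [CommRing A] [CommRing R] [CommRing S] [IsNoetherianRing A]
    (ψ : A →+* R) (ι : R →+* S)
    (ρ : S →+* R) (hρ : ∀ x, ρ (ι x) = x) (φ : A →+* S) (hφ : ∀ a, φ a = ι (ψ a))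
    (hF : FreeHom φ) (hp : ∀ P : Ideal A, P.IsPrime → (P.map φ).IsPrime) :
    (∀ Q : Ideal A, Q.IsPrimary → (Q.map ψ).IsPrimary) ∧
    ∀ (l : Type) (J : l → Ideal A), (⨅ j, J j).map ψ = ⨅ j, (J j).map ψ := by
  have e : φ = ι.comp ψ := RingHom.ext hφ
  subst e
  constructor
  · intro Q hQ
    rw [descend ψ ι ρ hρ]
    exact Ideal.IsPrimary.comap (hF.primary Q hQ (hp _ (Ideal.isPrime_radical hQ))) _
  · intro l J
    rw [descend ψ ι ρ hρ, hF.iInf, Ideal.comap_iInf]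
    exact iInf_congr fun j => (descend ψ ι ρ hρ _).symm

section
variable {κ : Type} [Fintype κ] {Λ : Type} [CommRing Λ]

lemma LTd_pow {τ : Type} (u v : τ → MvPolynomial κ Λ) (h1 : ∀ i, LTd 1 (u i - v i))
    (h2 : ∀ i, LTd 2 (v i)) (m : τ →₀ ℕ) :
    LTd m.degree ((m.prod fun i k => u i ^ k) - m.prod fun i k => v i ^ k) ∧
    LTd (m.degree + 1) (m.prod fun i k => v i ^ k) := by
  classical
  have h1' : LTd (0 + 1) (1 : MvPolynomial κ Λ) := by
    simpa using LTd_monomial (0 : κ →₀ ℕ) (1 : Λ)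
  induction m using Finsupp.induction_linear with
  | zero =>
    refine ⟨?_, ?_⟩
    · intro m hm; simp at hm
    · simpa using h1'
  | add f g hf hg =>
    rw [Finsupp.prod_add_index' (by simp) (by intros; ring), Finsupp.prod_add_index' (by simp) (by intros; ring), map_add]
    generalize (f.prod fun i k => u i ^ k) = a at *
    generalize (f.prod fun i k => v i ^ k) = b at *
    generalize (g.prod fun i k => u i ^ k) = c at *
    generalize (g.prod fun i k => v i ^ k) = d at *
    refine ⟨?_, ?_⟩
    · have hc : LTd (g.degree + 1) c := by
        have := LTd.add (hg.1.mono (Nat.le_succ _)) hg.2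
        simpa using this
      have : a * c - b * d = (a - b) * c + (c - d) * b := by ring
      rw [this]
      refine LTd.add (hf.1.mul hc) ?_
      have := hg.1.mul hf.2
      rwa [add_comm] at this
    · have := hf.2.mul hg.2
      exact this.mono (by omega)
  | single i k =>
    simp only [Finsupp.prod_single_index, pow_zero]
    rw [Finsupp.degree_single]
    induction k with
    | zero => exact ⟨fun m hm => by simp at hm, by simpa using h1'⟩
    | succ k ih =>
      refine ⟨?_, ?_⟩
      · have hu : LTd (1 + 1) (u i) := by
          have := LTd.add ((h1 i).mono (Nat.le_succ _)) (h2 i)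
          simpa using this
        have : u i ^ (k + 1) - v i ^ (k + 1) = (u i ^ k - v i ^ k) * u i + (u i - v i) * v i ^ k := by
          ring
        rw [this]
        refine LTd.add (ih.1.mul hu) ?_
        have := (h1 i).mul ih.2
        rwa [add_comm] at this
      · rw [pow_succ]
        have := ih.2.mul (h2 i)
        exact this.mono (by omega)

lemma LTd_sum {ι : Type} (s : Finset ι) (n : ℕ) (f : ι → MvPolynomial κ Λ)
    (h : ∀ i ∈ s, LTd n (f i)) : LTd n (∑ i ∈ s, f i) := by
  classical
  induction s using Finset.induction_on with
  | empty => intro m hm; simp at hm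
  | insert a s ha ih =>
    rw [Finset.sum_insert ha]
    exact LTd.add (h a (by simp)) (ih fun i hi => h i (by simp [hi]))

lemma LTd_eval {τ : Type} (ν : ℂ →+* Λ) (u v : τ → MvPolynomial κ Λ)
    (h1 : ∀ i, LTd 1 (u i - v i)) (h2 : ∀ i, LTd 2 (v i)) (d : ℕ) (g : MvPolynomial τ ℂ)
    (hg : g.IsHomogeneous d) :
    LTd d (eval₂ (C.comp ν) u g - eval₂ (C.comp ν) v g) := by
  classical
  rw [eval₂_eq, eval₂_eq, ← Finset.sum_sub_distrib]
  refine LTd_sum _ _ _ fun m hm => ?_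
  have hd : m.degree = d := by
    have := hg (mem_support_iff.1 hm)
    rw [Finsupp.degree_eq_weight_one]; exact this
  have := (LTd_pow u v h1 h2 m).1
  rw [hd, Finsupp.prod, Finsupp.prod] at this
  rw [← mul_sub, mul_comm]
  have hc : LTd (0 + 1) ((C.comp ν) (coeff m g) : MvPolynomial κ Λ) := by
    simpa using LTd_monomial (0 : κ →₀ ℕ) (ν (coeff m g))
  exact this.mul hc
end

section
variable {κ : Type} [Fintype κ]

lemma topW_of {Λ : Type} [CommRing Λ] (n : ℕ) (xx : Fin n → Λ) (d : κ → ℕ) (hd : ∀ j, 1 ≤ d j) (g : κ → MvPolynomial (Fin n) ℂ)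
    (hg : ∀ j, (g j).IsHomogeneous (d j))
    (φ : Fin n → MvPolynomial (κ ⊕ (κ ⊕ κ)) ℂ) (h1 : ∀ i, (φ i).IsHomogeneous 1)
    (h2 : ∀ j, aeval φ (g j) = X (Sum.inl j) ^ d j +
      X (Sum.inr (Sum.inl j)) * X (Sum.inr (Sum.inr j)) ^ (d j - 1))
    (ν : ℂ →+* Λ)
    (ξ : RH (MvPolynomial (κ ⊕ (κ ⊕ κ)) ℂ) (MvPolynomial κ Λ))
    (x1 : ∀ a, ξ (C a) = C (ν a)) (x2 : ∀ j, ξ (X (Sum.inl j)) = X j)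
    (x3 : ∀ j, ∃ c, ξ (X (Sum.inr j)) = C c)
    (u : Fin n → MvPolynomial κ Λ) (hu : ∀ i, u i = C (xx i) + ξ (φ i)) :
    TopW d (fun j => eval₂ (C.comp ν) u (g j)) := by
  classical
  obtain ⟨ζ, z1, z2, z3⟩ : ∃ ζ : RH (MvPolynomial (κ ⊕ (κ ⊕ κ)) ℂ) (MvPolynomial κ Λ),
      (∀ a, ζ (C a) = C (ν a)) ∧ (∀ j, ζ (X (Sum.inl j)) = X j) ∧ ∀ j, ζ (X (Sum.inr j)) = 0 :=
    ⟨eval₂Hom (C.comp ν) (Sum.elim X 0), by simp, by simp, by simp⟩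
  have hC : ∀ c : Λ,
      LTd (0 + 1) (C c : MvPolynomial κ Λ) := fun c => by
    simpa using LTd_monomial (0 : κ →₀ ℕ) c
  have hv2 : ∀ i, LTd 2 (ζ (φ i)) := by
    intro i
    rw [lin_eq _ (h1 i), map_sum]
    refine LTd_sum _ _ _ fun a _ => ?_
    rw [map_mul, z1, mul_comm]
    refine LTd.mul (b := 0) ?_ (hC _)
    cases a with
    | inl j =>
      rw [z2]
      have := LTd_monomial (Finsupp.single j 1) (1 : Λ)
      rwa [Finsupp.degree_single] at this
    | inr j => rw [z3]; intro m hm; simp at hm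
  have hv1 : ∀ i, LTd 1 (u i - ζ (φ i)) := by
    intro i
    rw [hu, add_sub_assoc]
    refine LTd.add (hC _) ?_
    rw [lin_eq _ (h1 i), map_sum, map_sum, ← Finset.sum_sub_distrib]
    refine LTd_sum _ _ _ fun a _ => ?_
    rw [map_mul, map_mul, z1, x1, ← mul_sub, mul_comm]
    refine LTd.mul (b := 0) ?_ (hC _)
    cases a with
    | inl j =>
      rw [z2, x2]
      intro m hm; simp at hm
    | inr j =>
      obtain ⟨c, hc⟩ := x3 j
      rw [z3, hc, sub_zero]; exact hC _
  intro j
  refine ⟨hd j, ?_⟩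
  have := LTd_eval ν u (fun i => ζ (φ i)) hv1 hv2 (d j) (g j) (hg j)
  have e : eval₂ (C.comp ν) (fun i => ζ (φ i)) (g j) = ζ (aeval φ (g j)) := by
    obtain ⟨χ, hχ⟩ : ∃ χ : RH (MvPolynomial (Fin n) ℂ) (MvPolynomial κ Λ), χ = eval₂Hom (C.comp ν) (fun i => ζ (φ i)) :=
      ⟨_, rfl⟩
    have : χ = ζ.comp (aeval φ : MvPolynomial (Fin n) ℂ →ₐ[ℂ] _).toRingHom := by
      rw [hχ]
      refine MvPolynomial.ringHom_ext (fun r => ?_) (fun i => ?_)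
      · rw [RingHom.comp_apply]
        simp only [coe_eval₂Hom, eval₂_C, AlgHom.toRingHom_eq_coe, RingHom.coe_coe, algHom_C]
        exact (z1 r).symm
      · rw [RingHom.comp_apply]
        simp only [coe_eval₂Hom, eval₂_X, AlgHom.toRingHom_eq_coe, RingHom.coe_coe, aeval_X]
    have h3 := congrArg (fun q => q (g j)) (hχ.symm.trans this)
    exact h3
  rw [e, h2, map_add, map_mul, map_pow, z2, z3, zero_mul, add_zero] at this
  unfold TopM
  rw [Finsupp.degree_single, ← X_pow_eq_monomial]
  exact this

lemma ext_R (n : ℕ) (d : κ → ℕ) (hd : ∀ j, 1 ≤ d j) (g : κ → MvPolynomial (Fin n) ℂ)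
    (hg : ∀ j, (g j).IsHomogeneous (d j))
    (φ : Fin n → MvPolynomial (κ ⊕ (κ ⊕ κ)) ℂ) (h1 : ∀ i, (φ i).IsHomogeneous 1)
    (h2 : ∀ j, aeval φ (g j) = X (Sum.inl j) ^ d j +
      X (Sum.inr (Sum.inl j)) * X (Sum.inr (Sum.inr j)) ^ (d j - 1))
    (ψ : RH (MvPolynomial κ ℂ) (MvPolynomial (Fin n) ℂ)) (hψC : ∀ a, ψ (C a) = C a)
    (hψX : ∀ j, ψ (X j) = g j) :
    (∀ Q : IdC (MvPolynomial κ ℂ), Q.IsPrimary → (Q.map ψ).IsPrimary) ∧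
    ∀ (l : Type) (J : l → IdC (MvPolynomial κ ℂ)), (⨅ j, J j).map ψ = ⨅ j, (J j).map ψ := by
  obtain ⟨ν, hν⟩ : ∃ ν : RH ℂ (MvPolynomial (Fin n) (MvPolynomial (κ ⊕ κ) ℂ)), ∀ a, ν a = C (C a) :=
    ⟨C.comp C, fun _ => rfl⟩
  obtain ⟨ξ, x1, x2, x3⟩ : ∃ ξ : RH (MvPolynomial (κ ⊕ (κ ⊕ κ)) ℂ) (MvPolynomial κ (MvPolynomial (Fin n) (MvPolynomial (κ ⊕ κ) ℂ))),
      (∀ a, ξ (C a) = C (ν a)) ∧ (∀ j, ξ (X (Sum.inl j)) = X j) ∧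
      ∀ j, ξ (X (Sum.inr j)) = C (C (X j)) :=
    ⟨eval₂Hom (C.comp ν) (Sum.elim X (fun j => C (C (X j)))), by simp, by simp, by simp⟩
  obtain ⟨u, hu⟩ : ∃ u : Fin n → MvPolynomial κ (MvPolynomial (Fin n) (MvPolynomial (κ ⊕ κ) ℂ)), ∀ i, u i = C (X i) + ξ (φ i) := ⟨_, fun _ => rfl⟩
  have hT := topW_of n X d hd g hg φ h1 h2 ν ξ x1 x2 (fun j => ⟨_, x3 j⟩) u hu
  obtain ⟨ι, i1, i2, i3⟩ : ∃ ι : RH (MvPolynomial (Fin n) ℂ) (MvPolynomial κ (MvPolynomial (Fin n) (MvPolynomial (κ ⊕ κ) ℂ))), (∀ F, ι F = eval₂ (C.comp ν) u F) ∧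
      (∀ a, ι (C a) = C (C (C a))) ∧ ∀ i, ι (X i) = u i :=
    ⟨eval₂Hom (C.comp ν) u, fun _ => rfl, by simp [hν], by simp⟩
  obtain ⟨ρ, r1, r2, r3, r4⟩ := exists_psi (C : RH ℂ (MvPolynomial (Fin n) ℂ)) (fun _ : κ ⊕ κ => 0)
    (fun i : Fin n => X i) (fun _ : κ => 0)
  have hρξ : ∀ i, ρ (ξ (φ i)) = 0 := by
    intro i
    rw [lin_eq _ (h1 i), map_sum, map_sum]
    refine Finset.sum_eq_zero fun a _ => ?_
    rw [map_mul, map_mul]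
    rcases a with j | j
    · rw [x2, r4, mul_zero]
    · rw [x3, r2, mul_zero]
  have hρ : ∀ x, ρ (ι x) = x := by
    have : ρ.comp ι = RingHom.id _ := by
      refine MvPolynomial.ringHom_ext (fun r => ?_) (fun i => ?_)
      · rw [RingHom.comp_apply, i2, r1, RingHom.id_apply]
      · rw [RingHom.comp_apply, i3, hu, map_add, r3, hρξ, add_zero, RingHom.id_apply]
    intro x
    exact congrArg (fun q => q x) this
  obtain ⟨c, hc1, hc2, hc3⟩ : ∃ c : RH (MvPolynomial κ (MvPolynomial (Fin n) (MvPolynomial (κ ⊕ κ) ℂ))) (MvPolynomial κ (MvPolynomial (κ ⊕ κ) ℂ)),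
      (∀ F, MvPolynomial.map constantCoeff F = c F) ∧ (∀ a, c (C a) = C (constantCoeff a)) ∧
      ∀ i, c (X i) = X i :=
    ⟨MvPolynomial.map constantCoeff, fun _ => rfl, by simp, by simp⟩
  have hcι : ∀ F, c (ι F) = c (ξ (aeval φ F)) := by
    have : c.comp ι = (c.comp ξ).comp (aeval φ : MvPolynomial (Fin n) ℂ →ₐ[ℂ] _).toRingHom := by
      refine MvPolynomial.ringHom_ext (fun r => ?_) (fun i => ?_)
      · rw [RingHom.comp_apply, RingHom.comp_apply, RingHom.comp_apply]
        simp only [AlgHom.toRingHom_eq_coe, RingHom.coe_coe, algHom_C]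
        rw [algebraMap_eq, i2, x1, hν]
      · rw [RingHom.comp_apply, RingHom.comp_apply, RingHom.comp_apply]
        simp only [AlgHom.toRingHom_eq_coe, RingHom.coe_coe, aeval_X]
        rw [i3, hu, map_add, hc2, constantCoeff_X, C_0, zero_add]
    intro x
    exact congrArg (fun q => q x) this
  obtain ⟨Φ, hΦ⟩ : ∃ Φ : RH (MvPolynomial κ ℂ) (MvPolynomial κ (MvPolynomial (Fin n) (MvPolynomial (κ ⊕ κ) ℂ))), ∀ a, Φ a = ι (ψ a) :=
    ⟨ι.comp ψ, fun _ => rfl⟩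
  have hT' : TopW d (fun j => ι (g j)) := by
    intro j; have := hT j; simp only [i1]; exact this
  obtain ⟨f1, f2⟩ := ext_R0 n d (fun j => ι (g j)) hT' (by
    intro j
    rw [hc1, hcι, h2]
    simp only [map_add, map_mul, map_pow, x2, x3, hc3, hc2, constantCoeff_C]) Φ
    (by intro a; rw [hΦ, hψC, i2]) (by intro j; rw [hΦ, hψX])
  exact descend_primary (A := MvPolynomial κ ℂ) (R := MvPolynomial (Fin n) ℂ)
    (S := MvPolynomial κ (MvPolynomial (Fin n) (MvPolynomial (κ ⊕ κ) ℂ))) ψ ι ρ hρ Φ hΦ f1 f2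
end
end

section
open MvPolynomial
set_option linter.unusedSectionVars false

lemma part3 (r : ℕ) (hr : 1 ≤ r) : ∃ N : ℕ → ℕ, ∀ (n : ℕ) (κ : Type) [Fintype κ] (d : κ → ℕ)
    (g : κ → MvPolynomial (Fin n) ℂ), (∀ j, 1 ≤ d j ∧ d j ≤ r ∧ (g j).IsHomogeneous (d j)) →
    Strong (N (Fintype.card κ)) d g →
    ∀ (ψ : RH (MvPolynomial κ ℂ) (MvPolynomial (Fin n) ℂ)), (∀ a, ψ (C a) = C a) →
    (∀ j, ψ (X j) = g j) → 
    (∀ Q : IdC (MvPolynomial κ ℂ), Q.IsPrimary → (Q.map ψ).IsPrimary) ∧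
    ∀ (l : Type) (J : l → IdC (MvPolynomial κ ℂ)), (⨅ j, J j).map ψ = ⨅ j, (J j).map ψ := by
  have hU := Uni_all r hr
  choose N hN using fun s : ℕ => hU s (s + (s + s))
  refine ⟨N, ?_⟩
  intro n κ _ d g hg hS ψ hψC hψX
  have e : κ ⊕ (κ ⊕ κ) ≃ Fin (Fintype.card κ + (Fintype.card κ + Fintype.card κ)) :=
    Fintype.equivFinOfCardEq (by simp)
  obtain ⟨φ, p1, p2⟩ := hN (Fintype.card κ) (Fin n) κ d g le_rfl (fun j => (hg j).1) (fun j => (hg j).2.1)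
    (fun j => (hg j).2.2) hS (fun j => rename e (X (Sum.inl j) ^ d j +
      X (Sum.inr (Sum.inl j)) * X (Sum.inr (Sum.inr j)) ^ (d j - 1))) (by
        intro j
        refine IsHomogeneous.rename_isHomogeneous ?_
        refine IsHomogeneous.add ?_ ?_
        · have := (isHomogeneous_X ℂ (Sum.inl j : κ ⊕ (κ ⊕ κ))).pow (d j)
          rwa [one_mul] at this
        · have := (isHomogeneous_X ℂ (Sum.inr (Sum.inl j) : κ ⊕ (κ ⊕ κ))).mul
            ((isHomogeneous_X ℂ (Sum.inr (Sum.inr j) : κ ⊕ (κ ⊕ κ))).pow (d j - 1))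
          rwa [one_mul, Nat.add_sub_cancel' (hg j).1] at this)
  refine ext_R n d (fun j => (hg j).1) g (fun j => (hg j).2.2)
    (fun i => rename e.symm (φ i)) (fun i => (p1 i).rename_isHomogeneous) ?_ ψ hψC hψX
  intro j
  have : aeval (fun i => rename e.symm (φ i)) (g j) = rename e.symm (aeval φ (g j)) := by
    rw [← comp_aeval]; rfl
  rw [this, p2, rename_rename]
  simp
end

section
open MvPolynomial
set_option linter.unusedSectionVars false

structure GB {E EK L : Type} [CommRing E] [CommRing EK] [CommRing L] (U : Filter ℕ)
    (g : E →+* EK) (ev : ℕ → E →+* L) : Prop where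
  surj : Function.Surjective g
  ne : ∀ x, g x ≠ 0 → ∀ᶠ i in U, ev i x ≠ 0
  zero : ∀ x, g x = 0 → ∀ᶠ i in U, ev i x = 0
  lift : ∀ Z : Finset E, ∃ (C : Type) (_ : CommRing C) (θ : C →+* E),
    (∀ z ∈ Z, ∃ c, θ c = z) ∧ ∀ᶠ i in U, (∀ c, g (θ c) = 0 → ev i (θ c) = 0) ∧
      Function.Surjective (fun c => ev i (θ c))

theorem map_supp_eq {E A B σ : Type} [CommRing E] [CommRing A] [CommRing B] (a : E →+* A)
    (b : E →+* B) (q : MvPolynomial σ E)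
    (h : ∀ d ∈ q.support, a (coeff d q) = 0 ↔ b (coeff d q) = 0) :
    (map a q).support = (map b q).support := by
  ext d
  rw [mem_support_iff, mem_support_iff, coeff_map, coeff_map]
  by_cases hd : d ∈ q.support
  · exact not_congr (h d hd)
  · rw [notMem_support_iff.1 hd]; simp

theorem GB.supp {E EK L : Type} [CommRing E] [CommRing EK] [CommRing L] {U : Filter ℕ}
    {g : E →+* EK} {ev : ℕ → E →+* L} (h : GB U g ev) {σ : Type} (q : MvPolynomial σ E) :
    ∀ᶠ i in U, (map (ev i) q).support = (map g q).support := by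
  have : ∀ᶠ i in U, ∀ d ∈ q.support, ev i (coeff d q) = 0 ↔ g (coeff d q) = 0 := by
    rw [Filter.eventually_all_finset]
    intro d _
    by_cases hd : g (coeff d q) = 0
    · filter_upwards [h.zero _ hd] with i hi
      simp [hi, hd]
    · filter_upwards [h.ne _ hd] with i hi
      simp [hi, hd]
  filter_upwards [this] with i hi
  exact map_supp_eq _ _ _ hi

theorem mdeg_eq {A B σ : Type} [CommRing A] [CommRing B] (m : MonomialOrder σ)
    (p : MvPolynomial σ A) (q : MvPolynomial σ B) (h : p.support = q.support) :
    m.degree p = m.degree q := by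
  unfold MonomialOrder.degree; rw [h]

theorem GB.exists_map {E EK L : Type} [CommRing E] [CommRing EK] [CommRing L] {U : Filter ℕ}
    {g : E →+* EK} {ev : ℕ → E →+* L} (h : GB U g ev) {σ : Type} (p : MvPolynomial σ EK) :
    ∃ q : MvPolynomial σ E, map g q = p := map_surjective g h.surj p

theorem core_alg {C₀ EK L σ : Type} [CommRing C₀] [CommRing EK] [CommRing L] [IsDomain EK]
    [IsDomain L] (m : MonomialOrder σ) (γ : C₀ →+* EK) (ev : C₀ →+* L)
    (hs : Function.Surjective ev) (hk : ∀ c, γ c = 0 → ev c = 0)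
    (J : Ideal (MvPolynomial σ C₀)) {ι : Type} (q : ι → MvPolynomial σ C₀)
    (hq : ∀ l, q l ∈ J) (hl : ∀ l, ev (coeff (m.degree (map γ (q l))) (q l)) ≠ 0)
    (H : ∀ f ∈ J, map γ f ≠ 0 → ∃ l, m.degree (map γ (q l)) ≤ m.degree (map γ f)) :
    ∀ f ∈ J, map ev f ≠ 0 → ∃ l, m.degree (map γ (q l)) ≤ m.degree (map ev f) := by
  suffices ∀ (s : m.syn) (f), f ∈ J → m.toSyn (m.degree (map γ f)) = s → map ev f ≠ 0 →
      ∃ l, m.degree (map γ (q l)) ≤ m.degree (map ev f) from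
    fun f hf => this _ f hf rfl
  intro s
  induction s using WellFoundedLT.induction with
  | ind s IH =>
  intro f hf hs' hne
  have hγ : map γ f ≠ 0 := by
    intro h0
    apply hne
    ext d
    rw [coeff_map, coeff_zero]
    apply hk
    rw [← coeff_map, h0, coeff_zero]
  obtain ⟨l, hl'⟩ := H f hf hγ
  set D := m.degree (map γ f) with hD
  by_cases hc : ev (coeff D f) = 0
  swap
  · refine ⟨l, ?_⟩
    have : m.degree (map ev f) = D := by
      apply m.toSyn.injective
      apply le_antisymm
      · rw [MonomialOrder.degree_le_iff]
        intro b hb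
        rw [mem_support_iff, coeff_map] at hb
        by_contra hlt
        push Not at hlt
        apply hb
        apply hk
        rw [← coeff_map]
        exact MonomialOrder.coeff_eq_zero_of_lt hlt
      · apply MonomialOrder.le_degree
        rw [mem_support_iff, coeff_map]; exact hc
    rw [this]; exact hl'
  · set δ := m.degree (map γ (q l)) with hδ
    set f' : MvPolynomial σ C₀ := C (coeff δ (q l)) * f - monomial (D - δ) (coeff D f) * q l with hf'
    have e1 : map ev f' = C (ev (coeff δ (q l))) * map ev f := by
      rw [hf', map_sub, map_mul, map_mul, map_C, map_monomial, hc, monomial_zero, zero_mul, sub_zero]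
    have e1n : map ev f' ≠ 0 := by
      rw [e1]
      exact mul_ne_zero (by rw [Ne, C_eq_zero]; exact hl l) hne
    have e2 : m.degree (map ev f') = m.degree (map ev f) := by
      rw [e1, MonomialOrder.degree_mul (by rw [Ne, C_eq_zero]; exact hl l) hne,
        MonomialOrder.degree_C, zero_add]
    have hJ : f' ∈ J := J.sub_mem (J.mul_mem_left _ hf) (J.mul_mem_left _ (hq l))
    have hγ' : map γ f' ≠ 0 := by
      intro h0
      apply e1n
      ext d
      rw [coeff_map, coeff_zero]
      apply hk
      rw [← coeff_map, h0, coeff_zero]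
    have hlt : m.toSyn (m.degree (map γ f')) < s := by
      have hle : m.toSyn (m.degree (map γ f')) ≤ m.toSyn D := by
        rw [hf', map_sub, map_mul, map_mul, map_C, map_monomial]
        refine MonomialOrder.degree_sub_le.trans (sup_le ?_ ?_)
        · refine MonomialOrder.degree_mul_le.trans ?_
          rw [MonomialOrder.degree_C, zero_add]
        · refine MonomialOrder.degree_mul_le.trans ?_
          rw [map_add]
          refine (add_le_add_left (MonomialOrder.degree_monomial_le _) _).trans ?_
          rw [← map_add, ← hδ, tsub_add_cancel_of_le hl']
      have hcz : coeff D (map γ f') = 0 := by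
        have : coeff D (monomial (D - δ) (γ (coeff D f)) * map γ (q l))
            = γ (coeff D f) * γ (coeff δ (q l)) := by
          rw [coeff_monomial_mul', if_pos tsub_le_self, coeff_map, tsub_tsub_cancel_of_le hl']
        rw [hf', map_sub, map_mul, map_mul, map_C, map_monomial, coeff_sub, coeff_C_mul, this,
          coeff_map]
        ring
      rw [← hs']
      refine lt_of_le_of_ne hle ?_
      intro heq
      have heq' := m.toSyn.injective heq
      rw [← heq'] at hcz
      exact hγ' (MonomialOrder.coeff_degree_eq_zero_iff.1 hcz)
    obtain ⟨l', h'⟩ := IH _ hlt f' hJ rfl e1n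
    exact ⟨l', by rw [← e2]; exact h'⟩

theorem dickson {σ : Type} [Finite σ] (s : Set (σ →₀ ℕ)) :
    ∃ t : Finset (σ →₀ ℕ), (∀ d ∈ t, d ∈ s) ∧ ∀ d ∈ s, ∃ e ∈ t, e ≤ d := by
  have hanti : IsAntichain (· ≤ ·) {d | Minimal (· ∈ s) d} := setOfPred_minimal_antichain _
  have hfin := WellQuasiOrderedLE.finite_of_isAntichain hanti
  refine ⟨hfin.toFinset, fun d hd => ?_, fun d hd => ?_⟩
  · rw [Set.Finite.mem_toFinset] at hd
    exact hd.1
  · obtain ⟨e, he, h⟩ := exists_minimal_le_of_wellFoundedLT (· ∈ s) d hd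
    exact ⟨e, by rw [Set.Finite.mem_toFinset]; exact h, he⟩

theorem GB.core {E EK L : Type} [CommRing E] [CommRing EK] [CommRing L] [IsDomain EK]
    [IsDomain L] {U : Filter ℕ}
    {g : E →+* EK} {ev : ℕ → E →+* L} (h : GB U g ev) {σ : Type} [Finite σ] (m : MonomialOrder σ)
    {ι : Type} [Fintype ι] (f : ι → MvPolynomial σ E) :
    ∃ (l : ℕ) (q : Fin l → MvPolynomial σ E), (∀ j, q j ∈ Ideal.span (Set.range f)) ∧
      (∀ j, map g (q j) ≠ 0) ∧
      (∀ p ∈ Ideal.span (Set.range fun a => map g (f a)), p ≠ 0 →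
        ∃ j, m.degree (map g (q j)) ≤ m.degree p) ∧
      ∀ᶠ i in U, (∀ j, (map (ev i) (q j)).support = (map g (q j)).support) ∧
        ∀ F ∈ Ideal.span (Set.range fun a => map (ev i) (f a)), F ≠ 0 →
          ∃ j, m.degree (map g (q j)) ≤ m.degree F := by
  classical
  have hmap : ∀ {E' : Type} [CommRing E'] (φ : E →+* E'),
      Ideal.span (Set.range fun a => map φ (f a)) = (Ideal.span (Set.range f)).map (map φ) := by
    intro E' _ φ
    rw [Ideal.map_span, ← Set.range_comp]; rfl
  obtain ⟨t, ht1, ht2⟩ := dickson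
    {d | ∃ p ∈ Ideal.span (Set.range fun a => map g (f a)), p ≠ 0 ∧ m.degree p = d}
  have ht3 : ∀ d : t, ∃ q ∈ Ideal.span (Set.range f), map g q ≠ 0 ∧ m.degree (map g q) = d := by
    intro d
    obtain ⟨p, hp, hp0, hpd⟩ := ht1 _ d.2
    rw [hmap] at hp
    obtain ⟨q, hq, rfl⟩ := (Ideal.mem_map_iff_of_surjective _ (map_surjective g h.surj)).1 hp
    exact ⟨q, hq, hp0, hpd⟩
  choose q0 hq0 hq1 hq2 using ht3
  let en := t.equivFin
  refine ⟨t.card, fun j => q0 (en.symm j), fun j => hq0 _, fun j => hq1 _, ?_, ?_⟩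
  · intro p hp hp0
    obtain ⟨e, he, hle⟩ := ht2 _ ⟨p, hp, hp0, rfl⟩
    refine ⟨en ⟨e, he⟩, ?_⟩
    simp only [Equiv.symm_apply_apply]
    rw [hq2]; exact hle
  · set q : Fin t.card → MvPolynomial σ E := fun j => q0 (en.symm j) with hq
    have hqm : ∀ j, ∃ c : ι → MvPolynomial σ E, ∑ a, c a * f a = q j := by
      intro j
      exact Ideal.mem_span_range_iff_exists_fun.1 (hq0 _)
    choose c hc using hqm
    let coefs : MvPolynomial σ E → Finset E := fun p => p.support.image (fun d => coeff d p)
    let Z : Finset E := (Finset.univ.biUnion fun a => coefs (f a)) ∪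
      (Finset.univ.biUnion fun j => Finset.univ.biUnion fun a => coefs (c j a))
    obtain ⟨C₀, _, θ, hθ, hi⟩ := h.lift Z
    have hl : ∀ p : MvPolynomial σ E, coefs p ⊆ Z → ∃ p', map θ p' = p := by
      intro p hp
      have : p ∈ Set.range (map θ : MvPolynomial σ C₀ → MvPolynomial σ E) := by
        rw [MvPolynomial.mem_range_map_iff_coeffs_subset]
        intro x hx
        obtain ⟨d, hd, rfl⟩ := MvPolynomial.mem_coeffs_iff.1 hx
        obtain ⟨y, hy⟩ := hθ (coeff d p) (hp (Finset.mem_image_of_mem _ hd))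
        exact ⟨y, hy⟩
      exact this
    have hf' : ∀ a, ∃ p', map θ p' = f a := by
      intro a
      apply hl
      intro x hx
      exact Finset.mem_union_left _ (Finset.mem_biUnion.2 ⟨a, Finset.mem_univ _, hx⟩)
    choose f' hf' using hf'
    have hc' : ∀ j a, ∃ p', map θ p' = c j a := by
      intro j a
      apply hl
      intro x hx
      exact Finset.mem_union_right _ (Finset.mem_biUnion.2 ⟨j, Finset.mem_univ _,
        Finset.mem_biUnion.2 ⟨a, Finset.mem_univ _, hx⟩⟩)
    choose c' hc' using hc'
    have hsup : ∀ᶠ i in U, ∀ j, (map (ev i) (q j)).support = (map g (q j)).support := by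
      rw [Filter.eventually_all]
      intro j
      exact h.supp _
    filter_upwards [hi, hsup] with i hi hsup
    refine ⟨hsup, fun F hF hF0 => ?_⟩
    set q' : Fin t.card → MvPolynomial σ C₀ := fun j => ∑ a, c' j a * f' a with hq'
    have hqq : ∀ j, map θ (q' j) = q j := by
      intro j
      rw [hq', ← hc j, map_sum]
      refine Finset.sum_congr rfl fun a _ => ?_
      rw [map_mul, hc', hf']
    have hmm : ∀ p : MvPolynomial σ C₀, map g (map θ p) = map (g.comp θ) p := fun p => map_map _ _ _
    have hme : ∀ p : MvPolynomial σ C₀, map (ev i) (map θ p) = map ((ev i).comp θ) p :=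
      fun p => map_map _ _ _
    have key := core_alg m (g.comp θ) ((ev i).comp θ) hi.2 hi.1 (Ideal.span (Set.range f')) q'
      (fun l => Ideal.mem_span_range_iff_exists_fun.2 ⟨_, rfl⟩) ?_ ?_
    · have hF' : F ∈ (Ideal.span (Set.range f')).map (map ((ev i).comp θ)) := by
        rw [Ideal.map_span, ← Set.range_comp]
        convert hF using 3
        funext a
        rw [← hf' a, hme]; rfl
      obtain ⟨f0, hf0, rfl⟩ := (Ideal.mem_map_iff_of_surjective _
        (map_surjective ((ev i).comp θ) hi.2)).1 hF'
      obtain ⟨l, hl⟩ := key f0 hf0 hF0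
      refine ⟨l, ?_⟩
      rw [← hmm, hqq] at hl
      exact hl
    · intro l
      have h1 : m.degree (map g (q l)) ∈ (map g (q l)).support :=
        MonomialOrder.degree_mem_support (hq1 _)
      rw [← hsup, mem_support_iff, coeff_map, ← hqq l, coeff_map, hmm] at h1
      exact h1
    · intro p hp hp0
      have h2 : map g (map θ p) ∈ Ideal.span (Set.range fun a => map g (f a)) := by
        rw [hmap]
        apply Ideal.mem_map_of_mem
        have := Ideal.mem_map_of_mem (map θ) hp
        rw [Ideal.map_span, ← Set.range_comp] at this
        convert this using 3
        funext a
        rw [← hf' a]; rfl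
      rw [← hmm] at hp0
      obtain ⟨e, he, hle⟩ := ht2 _ ⟨_, h2, hp0, rfl⟩
      refine ⟨en ⟨e, he⟩, ?_⟩
      rw [← hmm, hqq, ← hmm]
      simp only [hq, Equiv.symm_apply_apply]
      rw [hq2]; exact hle

theorem GB.poly {E EK L : Type} [CommRing E] [CommRing EK] [CommRing L] {U : Filter ℕ}
    {g : E →+* EK} {ev : ℕ → E →+* L} (h : GB U g ev) (S : Type) :
    GB U (map g : MvPolynomial S E →+* MvPolynomial S EK) (fun i => map (ev i)) where
  surj := map_surjective g h.surj
  ne x hx := by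
    filter_upwards [h.supp x] with i hi
    rw [Ne, ← support_eq_empty, hi, support_eq_empty]; exact hx
  zero x hx := by
    filter_upwards [h.supp x] with i hi
    rw [← support_eq_empty, hi, support_eq_empty]; exact hx
  lift Z := by
    classical
    obtain ⟨C₀, _, θ, hθ, hi⟩ := h.lift
      (Z.biUnion fun p => p.support.image (fun d => coeff d p))
    refine ⟨MvPolynomial S C₀, inferInstance, map θ, fun z hz => ?_, ?_⟩
    · have : z ∈ Set.range (map θ : MvPolynomial S C₀ → MvPolynomial S E) := by
        rw [MvPolynomial.mem_range_map_iff_coeffs_subset]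
        intro x hx
        obtain ⟨d, hd, rfl⟩ := MvPolynomial.mem_coeffs_iff.1 hx
        obtain ⟨y, hy⟩ := hθ (coeff d z)
          (Finset.mem_biUnion.2 ⟨z, hz, Finset.mem_image_of_mem _ hd⟩)
        exact ⟨y, hy⟩
      exact this
    · filter_upwards [hi] with i hi
      refine ⟨fun c hc => ?_, fun y => ?_⟩
      · ext d
        have := congrArg (coeff d) hc
        rw [coeff_map, coeff_map, coeff_zero] at this
        rw [coeff_map, coeff_map, coeff_zero]
        exact hi.1 _ this
      · have hs : Function.Surjective ((ev i).comp θ) := hi.2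
        obtain ⟨x, hx⟩ := map_surjective ((ev i).comp θ) hs y
        refine ⟨x, ?_⟩
        simp only [map_map]
        exact hx

theorem GB_base {K : Type} [Field K] (U : Ultrafilter ℕ) (g : (ℕ → ℂ) →+* K)
    (hs : Function.Surjective g) (hz : ∀ x, g x = 0 ↔ ∀ᶠ i in (U : Filter ℕ), x i = 0) :
    GB (U : Filter ℕ) g (fun i => Pi.evalRingHom (fun _ => ℂ) i) where
  surj := hs
  zero x hx := (hz x).1 hx
  ne x hx := by
    rw [Ne, hz] at hx
    exact (Ultrafilter.eventually_not).2 hx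
  lift Z := by
    classical
    let θ : MvPolynomial Z ℂ →+* (ℕ → ℂ) := (aeval (fun z : Z => z.1)).toRingHom
    have hX : ∀ z : Z, θ (X z) = z.1 := fun z => aeval_X _ _
    have hC : ∀ c : ℂ, θ (C c) = fun _ => c := fun z => by
      show aeval _ (C z) = _
      rw [aeval_C]; rfl
    refine ⟨MvPolynomial Z ℂ, inferInstance, θ, fun z hz => ⟨X ⟨z, hz⟩, hX _⟩, ?_⟩
    obtain ⟨t, ht⟩ := (isNoetherian_def.1 (inferInstance : IsNoetherian (MvPolynomial Z ℂ) (MvPolynomial Z ℂ)))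
      (RingHom.ker (g.comp θ))
    have : ∀ᶠ i in (U : Filter ℕ), ∀ c ∈ t, θ c i = 0 := by
      rw [Filter.eventually_all_finset]
      intro c hc
      rw [← hz]
      have : c ∈ RingHom.ker (g.comp θ) := by rw [← ht]; exact Submodule.subset_span hc
      exact this
    filter_upwards [this] with i hi
    refine ⟨fun c hc => ?_, fun y => ⟨C y, ?_⟩⟩
    · have h1 : RingHom.ker (g.comp θ) ≤ RingHom.ker ((Pi.evalRingHom (fun _ => ℂ) i).comp θ) := by
        rw [← ht]
        exact Ideal.span_le.2 fun c hc => hi c hc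
      exact h1 hc
    · show θ (C y) i = y
      rw [hC]

theorem exists_GB : ∃ (K : Type) (_ : Field K) (_ : CharZero K) (g : (ℕ → ℂ) →+* K),
    GB (Filter.hyperfilter ℕ : Filter ℕ) g (fun i => Pi.evalRingHom (fun _ => ℂ) i) := by
  refine ⟨Filter.Germ (Filter.hyperfilter ℕ : Filter ℕ) ℂ, inferInstance, ?_,
    Filter.Germ.coeRingHom _, GB_base _ _ ?_ ?_⟩
  · have : Algebra ℂ (Filter.Germ (Filter.hyperfilter ℕ : Filter ℕ) ℂ) :=
      ((Filter.Germ.coeRingHom (Filter.hyperfilter ℕ : Filter ℕ)).comp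
        (Pi.constRingHom ℕ ℂ)).toAlgebra
    exact charZero_of_injective_algebraMap (algebraMap ℂ _).injective
  · intro x
    induction x using Filter.Germ.inductionOn with
    | _ x => exact ⟨x, rfl⟩
  · intro x
    exact Filter.Germ.coe_eq
end

section
open MvPolynomial
set_option linter.unusedSectionVars false

theorem GB.core' {E EK L : Type} [CommRing E] [CommRing EK] [CommRing L] [IsDomain EK]
    [IsDomain L] {U : Filter ℕ}
    {g : E →+* EK} {ev : ℕ → E →+* L} (h : GB U g ev) {σ : Type} [Finite σ] (m : MonomialOrder σ)
    (J : Ideal (MvPolynomial σ E)) (hJ : J.FG) :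
    ∃ (l : ℕ) (q : Fin l → MvPolynomial σ E), (∀ j, q j ∈ J) ∧
      (∀ j, map g (q j) ≠ 0) ∧
      (∀ p ∈ J.map (map g), p ≠ 0 →
        ∃ j, m.degree (map g (q j)) ≤ m.degree p) ∧
      ∀ᶠ i in U, (∀ j, (map (ev i) (q j)).support = (map g (q j)).support) ∧
        ∀ F ∈ J.map (map (ev i)), F ≠ 0 →
          ∃ j, m.degree (map g (q j)) ≤ m.degree F := by
  obtain ⟨t, rfl⟩ := hJ
  have hr : (t : Set (MvPolynomial σ E)) = Set.range (fun x : t => x.1) := by simp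
  have := h.core m (fun x : t => x.1)
  have hmap : ∀ {E' : Type} [CommRing E'] (φ : E →+* E'),
      Ideal.span (Set.range fun a : t => map φ a.1) =
        (Ideal.span (t : Set (MvPolynomial σ E))).map (map φ) := by
    intro E' _ φ
    rw [Ideal.map_span, hr, ← Set.range_comp]; rfl
  simp only [hmap, ← hr] at this
  exact this

theorem GB.mem {E EK L : Type} [CommRing E] [CommRing EK] [CommRing L] {U : Filter ℕ}
    {g : E →+* EK} {ev : ℕ → E →+* L} (h : GB U g ev) {σ : Type}
    (J : Ideal (MvPolynomial σ E)) (p : MvPolynomial σ E) (hp : map g p ∈ J.map (map g)) :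
    ∀ᶠ i in U, map (ev i) p ∈ J.map (map (ev i)) := by
  obtain ⟨q, hq, hqp⟩ := (Ideal.mem_map_iff_of_surjective _ (map_surjective g h.surj)).1 hp
  have : map g (p - q) = 0 := by rw [map_sub, hqp, sub_self]
  filter_upwards [(h.poly σ).zero _ this] with i hi
  rw [map_sub, sub_eq_zero] at hi
  rw [hi]
  exact Ideal.mem_map_of_mem _ hq

theorem GB.le {E EK L : Type} [CommRing E] [CommRing EK] [CommRing L] {U : Filter ℕ}
    {g : E →+* EK} {ev : ℕ → E →+* L} (h : GB U g ev) {σ : Type}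
    (I J : Ideal (MvPolynomial σ E)) (hI : I.FG) (hp : I.map (map g) ≤ J.map (map g)) :
    ∀ᶠ i in U, I.map (map (ev i)) ≤ J.map (map (ev i)) := by
  obtain ⟨t, rfl⟩ := hI
  have : ∀ᶠ i in U, ∀ p ∈ t, map (ev i) p ∈ J.map (map (ev i)) := by
    rw [Filter.eventually_all_finset]
    intro p hpt
    exact h.mem J p (hp (Ideal.mem_map_of_mem _ (Submodule.subset_span hpt)))
  filter_upwards [this] with i hi
  rw [Ideal.map_le_iff_le_comap]
  exact Ideal.span_le.2 fun p hp => hi p hp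

theorem GB.exists_lift {E EK L : Type} [CommRing E] [CommRing EK] [CommRing L] {U : Filter ℕ}
    {g : E →+* EK} {ev : ℕ → E →+* L} (h : GB U g ev) {σ : Type}
    (I : Ideal (MvPolynomial σ EK)) (hI : I.FG) :
    ∃ J : Ideal (MvPolynomial σ E), J.FG ∧ J.map (map g) = I := by
  classical
  obtain ⟨t, rfl⟩ := hI
  choose f hf using h.exists_map (σ := σ)
  refine ⟨Ideal.span (t.image f : Set _), ⟨t.image f, rfl⟩, ?_⟩
  rw [Ideal.map_span, Finset.coe_image, ← Set.image_comp]
  have : (map g ∘ f) = id := funext hf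
  congr 1
  convert Set.image_id _

theorem elim_order (σ : Type) [Finite σ] : ∃ m : MonomialOrder.{0, 0} (Option σ),
    ∀ d e, m.toSyn d ≤ m.toSyn e → e none = 0 → d none = 0 := by
  obtain ⟨s, ⟨e⟩⟩ := Finite.exists_equiv_fin σ
  let _ : LinearOrder (Option σ) := LinearOrder.lift'
    (fun o : Option σ => (o.elim 0 (fun a => (e a).succ) : Fin (s+1))) (by
      intro a b hab
      cases a <;> cases b
      · rfl
      · simp only [Option.elim] at hab
        exact absurd hab.symm (Fin.succ_ne_zero _)
      · simp only [Option.elim] at hab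
        exact absurd hab (Fin.succ_ne_zero _)
      · simp only [Option.elim] at hab
        exact congrArg some (e.injective (Fin.succ_injective _ hab)))
  refine ⟨MonomialOrder.lex, fun d e' hle he => ?_⟩
  by_contra hd
  rw [MonomialOrder.lex_le_iff] at hle
  refine absurd hle (not_le.2 ?_)
  rw [Finsupp.Lex.lt_iff]
  refine ⟨none, fun j hj => ?_, ?_⟩
  · exfalso
    exact Fin.not_lt_zero _ hj
  · show e' none < d none
    omega

/-- substituting `c` for the extra variable -/
theorem exists_subst {R σ : Type} [CommRing R] (c : R) :
    ∃ π : MvPolynomial (Option σ) R →+* MvPolynomial σ R,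
      (∀ p, π (rename some p) = p) ∧ π (X none) = C c := by
  refine ⟨(aeval (fun o : Option σ => o.elim (C c) X)).toRingHom, fun p => ?_, ?_⟩
  · show aeval _ (rename some p) = p
    rw [aeval_rename]
    exact aeval_X_left_apply p
  · exact aeval_X _ _

theorem exists_rename_some {R σ : Type} [CommRing R] (p : MvPolynomial (Option σ) R)
    (h : ∀ d ∈ p.support, d none = 0) : ∃ r, rename some r = p := by
  apply exists_rename_eq_of_vars_subset_range p some (Option.some_injective _)
  intro o ho
  cases o with
  | none =>
    obtain ⟨d, hd, hn⟩ := (mem_vars_iff_mem_support _).1 ho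
    exact absurd (h d hd) (Finsupp.mem_support_iff.1 hn)
  | some a => exact ⟨a, rfl⟩

noncomputable def NI {R σ : Type} [CommRing R] (Q1 Q2 : Ideal (MvPolynomial σ R)) :
    Ideal (MvPolynomial (Option σ) R) :=
  Ideal.span {X none} * Q1.map (rename some : MvPolynomial σ R →ₐ[R] MvPolynomial (Option σ) R).toRingHom ⊔
    Ideal.span {1 - X none} * Q2.map (rename some : MvPolynomial σ R →ₐ[R] MvPolynomial (Option σ) R).toRingHom

theorem NI_map {R R' σ : Type} [CommRing R] [CommRing R'] (φ : R →+* R')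
    (Q1 Q2 : Ideal (MvPolynomial σ R)) :
    (NI Q1 Q2).map (map φ) = NI (Q1.map (map φ)) (Q2.map (map φ)) := by
  have hc : (map φ).comp (rename some : MvPolynomial σ R →ₐ[R] MvPolynomial (Option σ) R).toRingHom
      = (rename some : MvPolynomial σ R' →ₐ[R'] MvPolynomial (Option σ) R').toRingHom.comp (map φ) := by
    refine MvPolynomial.ringHom_ext (fun r => ?_) (fun i => ?_) <;> simp
  unfold NI
  rw [Ideal.map_sup, Ideal.map_mul, Ideal.map_mul, Ideal.map_span, Ideal.map_span,
    Set.image_singleton, Set.image_singleton, Ideal.map_map, Ideal.map_map, hc, Ideal.map_map,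
    Ideal.map_map, map_X, map_sub, map_one, map_X]

theorem NI_mem {R σ : Type} [CommRing R] (Q1 Q2 : Ideal (MvPolynomial σ R)) (F) (h1 : F ∈ Q1)
    (h2 : F ∈ Q2) : rename some F ∈ NI Q1 Q2 := by
  have : rename some F = X none * rename some F + (1 - X none) * rename some F := by ring
  rw [this]
  refine Ideal.add_mem _ (Ideal.mem_sup_left ?_) (Ideal.mem_sup_right ?_)
  · exact Ideal.mul_mem_mul (Ideal.mem_span_singleton_self _) (Ideal.mem_map_of_mem _ h1)
  · exact Ideal.mul_mem_mul (Ideal.mem_span_singleton_self _) (Ideal.mem_map_of_mem _ h2)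

theorem NI_of {R σ : Type} [CommRing R] (Q1 Q2 : Ideal (MvPolynomial σ R)) (F)
    (h : rename some F ∈ NI Q1 Q2) : F ∈ Q1 ∧ F ∈ Q2 := by
  obtain ⟨π0, h0, h0'⟩ := exists_subst (σ := σ) (0 : R)
  obtain ⟨π1, h1, h1'⟩ := exists_subst (σ := σ) (1 : R)
  have k0 : π0.comp (rename some : MvPolynomial σ R →ₐ[R] MvPolynomial (Option σ) R).toRingHom = RingHom.id _ :=
    RingHom.ext h0
  have k1 : π1.comp (rename some : MvPolynomial σ R →ₐ[R] MvPolynomial (Option σ) R).toRingHom = RingHom.id _ :=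
    RingHom.ext h1
  have m0 := Ideal.mem_map_of_mem π0 h
  have m1 := Ideal.mem_map_of_mem π1 h
  unfold NI at m0 m1
  rw [h0, Ideal.map_sup, Ideal.map_mul, Ideal.map_mul, Ideal.map_span, Ideal.map_span,
    Set.image_singleton, Set.image_singleton, Ideal.map_map, Ideal.map_map, k0, Ideal.map_id,
    Ideal.map_id, map_sub, map_one, h0'] at m0
  rw [h1, Ideal.map_sup, Ideal.map_mul, Ideal.map_mul, Ideal.map_span, Ideal.map_span,
    Set.image_singleton, Set.image_singleton, Ideal.map_map, Ideal.map_map, k1, Ideal.map_id,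
    Ideal.map_id, map_sub, map_one, h1'] at m1
  simp at m0 m1
  exact ⟨m1, m0⟩

theorem NI_FG {R σ : Type} [CommRing R] (Q1 Q2 : Ideal (MvPolynomial σ R)) (h1 : Q1.FG)
    (h2 : Q2.FG) : (NI Q1 Q2).FG := by
  unfold NI
  refine Submodule.FG.sup ?_ ?_
  · exact Submodule.FG.mul ⟨{X none}, by simp⟩ (h1.map _)
  · exact Submodule.FG.mul ⟨{1 - X none}, by simp⟩ (h2.map _)

theorem GB.inf {E EK L : Type} [CommRing E] [CommRing EK] [Field L] [IsDomain EK]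
    {U : Filter ℕ} {g : E →+* EK} {ev : ℕ → E →+* L} (h : GB U g ev) {σ : Type} [Finite σ]
    (Q1 Q2 I : Ideal (MvPolynomial σ E)) (h1 : Q1.FG) (h2 : Q2.FG)
    (hI : Q1.map (map g) ⊓ Q2.map (map g) ≤ I.map (map g)) :
    ∀ᶠ i in U, Q1.map (map (ev i)) ⊓ Q2.map (map (ev i)) ≤ I.map (map (ev i)) := by
  obtain ⟨m, hm⟩ := elim_order σ
  obtain ⟨l, q, hq, hq0, -, hi⟩ := h.core' m (NI Q1 Q2) (NI_FG _ _ h1 h2)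
  obtain ⟨π, hπ, -⟩ := exists_subst (σ := σ) (0 : L)
  have key : ∀ᶠ i in U, ∀ j, m.degree (map g (q j)) none = 0 →
      π (map (ev i) (q j)) ∈ I.map (map (ev i)) := by
    rw [Filter.eventually_all]
    intro j
    by_cases hd : m.degree (map g (q j)) none = 0
    swap
    · exact Filter.Eventually.of_forall fun i hi => absurd hi hd
    have hd' : ∀ d ∈ (map g (q j)).support, d none = 0 := fun d hds =>
      hm _ _ (MonomialOrder.le_degree hds) hd
    obtain ⟨r, hr⟩ := exists_rename_some _ hd'
    obtain ⟨r', rfl⟩ := h.exists_map r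
    have hrI : map g r' ∈ I.map (map g) := by
      apply hI
      have := Ideal.mem_map_of_mem (map g) (hq j)
      rw [← hr, NI_map] at this
      exact NI_of _ _ _ this
    rw [← map_rename] at hr
    have h0 : map g (rename some r' - q j) = 0 := by rw [map_sub, hr, sub_self]
    filter_upwards [h.mem I r' hrI, (h.poly _).zero _ h0] with i hi1 hi2 _
    rw [map_sub, sub_eq_zero, map_rename] at hi2
    rw [← hi2, hπ]
    exact hi1
  filter_upwards [hi, key] with i hi key
  rintro F ⟨hF1, hF2⟩
  have hFN := NI_mem _ _ F hF1 hF2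
  rw [← NI_map] at hFN
  have hdeg : ∀ j, m.degree (map (ev i) (q j)) = m.degree (map g (q j)) := fun j =>
    mdeg_eq m _ _ (hi.1 j)
  have hne : ∀ j, map (ev i) (q j) ≠ 0 := fun j h0 => by
    have := hi.1 j
    rw [h0, support_zero] at this
    exact hq0 j (support_eq_empty.1 this.symm)
  obtain ⟨c, r, hcr, hc, hr⟩ := m.div (b := fun j => map (ev i) (q j))
    (fun j => (MonomialOrder.leadingCoeff_ne_zero_iff.2 (hne j)).isUnit) (rename some F)
  have hsum : Finsupp.linearCombination _ (fun j => map (ev i) (q j)) c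
      = ∑ j, c j * map (ev i) (q j) := by
    rw [Finsupp.linearCombination_apply, Finsupp.sum_fintype]
    · rfl
    · intro j; exact zero_smul _ _
  rw [hsum] at hcr
  have hr0 : r = 0 := by
    by_contra hr0
    have hrN : r ∈ (NI Q1 Q2).map (map (ev i)) := by
      have : r = rename some F - ∑ j, c j * map (ev i) (q j) := by rw [hcr]; ring
      rw [this]
      refine Ideal.sub_mem _ hFN (Ideal.sum_mem _ fun j _ => Ideal.mul_mem_left _ _ ?_)
      exact Ideal.mem_map_of_mem _ (hq j)
    obtain ⟨j, hj⟩ := hi.2 r hrN hr0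
    exact hr _ (MonomialOrder.degree_mem_support hr0) j (by rw [hdeg]; exact hj)
  rw [hr0, add_zero] at hcr
  have hF := congrArg π hcr
  rw [hπ, map_sum] at hF
  rw [hF]
  refine Ideal.sum_mem _ fun j _ => ?_
  rw [map_mul]
  by_cases hcj : c j = 0
  · rw [hcj, map_zero, zero_mul]; exact Ideal.zero_mem _
  refine Ideal.mul_mem_left _ _ (key j ?_)
  have hFd : m.degree (rename some F) none = 0 := by
    by_cases hF0 : rename some F = 0
    · rw [hF0, MonomialOrder.degree_zero]; rfl
    have := MonomialOrder.degree_mem_support (m := m) hF0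
    classical
    rw [support_rename_of_injective (Option.some_injective _), Finset.mem_image] at this
    obtain ⟨d, -, hd⟩ := this
    rw [← hd]
    exact Finsupp.mapDomain_of_notMem_range _ _ (by simp)
  have := hm _ _ (hc j) hFd
  rw [MonomialOrder.degree_mul (hne j) hcj, hdeg] at this
  exact (Nat.add_eq_zero_iff.1 this).1

theorem GB.iInf {E EK L : Type} [CommRing E] [Field EK] [Field L]
    {U : Filter ℕ} {g : E →+* EK} {ev : ℕ → E →+* L} (h : GB U g ev) {σ : Type} [Finite σ]
    (l : ℕ) (Q : Fin l → Ideal (MvPolynomial σ E)) (hQ : ∀ j, (Q j).FG)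
    (I : Ideal (MvPolynomial σ E)) (hI : ⨅ j, (Q j).map (map g) ≤ I.map (map g)) :
    ∀ᶠ i in U, ⨅ j, (Q j).map (map (ev i)) ≤ I.map (map (ev i)) := by
  classical
  have key : ∀ s : Finset (Fin l), ∃ J : Ideal (MvPolynomial σ E), J.FG ∧
      J.map (map g) = ⨅ j ∈ s, (Q j).map (map g) ∧
      ∀ᶠ i in U, ⨅ j ∈ s, (Q j).map (map (ev i)) ≤ J.map (map (ev i)) := by
    intro s
    induction s using Finset.induction_on with
    | empty =>
      refine ⟨⊤, ⟨{1}, by simp⟩, by simp [Ideal.map_top], by simp [Ideal.map_top]⟩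
    | insert a s ha ih =>
      obtain ⟨J, hJ, hJ1, hJ2⟩ := ih
      obtain ⟨J', hJ', hJ'1⟩ := h.exists_lift ((Q a).map (map g) ⊓ J.map (map g))
        ((isNoetherianRing_iff_ideal_fg _).1 inferInstance _)
      refine ⟨J', hJ', ?_, ?_⟩
      · rw [hJ'1, Finset.iInf_insert, hJ1]
      · filter_upwards [hJ2, h.inf (Q a) J J' (hQ a) hJ hJ'1.ge] with i hi1 hi2
        rw [Finset.iInf_insert]
        exact (inf_le_inf_left _ hi1).trans hi2
  obtain ⟨J, hJ, hJ1, hJ2⟩ := key Finset.univ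
  simp only [Finset.mem_univ, iInf_pos] at hJ1 hJ2
  filter_upwards [hJ2, h.le J I hJ (by rw [hJ1]; exact hI)] with i hi1 hi2
  exact hi1.trans hi2

theorem colon_le {R : Type} [CommRing R] (Q : Ideal R) (x : R) (hx : ∀ a, x * a ∈ Q → a ∈ Q) :
    Q ⊓ Ideal.span {x} ≤ Ideal.span {x} * Q := by
  rintro F ⟨h1, h2⟩
  obtain ⟨a, rfl⟩ := Ideal.mem_span_singleton'.1 h2
  rw [mul_comm] at h1
  rw [mul_comm a x]
  exact Ideal.mul_mem_mul (Ideal.mem_span_singleton_self _) (hx a h1)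

theorem le_colon {R : Type} [CommRing R] [IsDomain R] (Q : Ideal R) (x : R) (hx0 : x ≠ 0)
    (h : Q ⊓ Ideal.span {x} ≤ Ideal.span {x} * Q) : ∀ a, x * a ∈ Q → a ∈ Q := by
  intro a ha
  have := h ⟨ha, Ideal.mul_mem_right _ _ (Ideal.mem_span_singleton_self _)⟩
  obtain ⟨b, hb, hab⟩ := Ideal.mem_span_singleton_mul.1 this
  rw [← mul_left_cancel₀ hx0 hab]
  exact hb

theorem map_span_mul {R S : Type} [CommRing R] [CommRing S] (φ : R →+* S) (x : R) (Q : Ideal R) :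
    (Ideal.span {x} * Q).map φ = Ideal.span {φ x} * Q.map φ := by
  rw [Ideal.map_mul, Ideal.map_span, Set.image_singleton]

theorem map_span_sing {R S : Type} [CommRing R] [CommRing S] (φ : R →+* S) (x : R) :
    (Ideal.span {x}).map φ = Ideal.span {φ x} := by
  rw [Ideal.map_span, Set.image_singleton]

theorem GB.colon {E EK L : Type} [CommRing E] [CommRing EK] [Field L] [IsDomain EK]
    {U : Filter ℕ} {g : E →+* EK} {ev : ℕ → E →+* L} (h : GB U g ev) {σ : Type} [Finite σ]
    (Q : Ideal (MvPolynomial σ E)) (hQ : Q.FG) (x : MvPolynomial σ E) (hx0 : map g x ≠ 0)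
    (hx : ∀ a, map g x * a ∈ Q.map (map g) → a ∈ Q.map (map g)) :
    ∀ᶠ i in U, ∀ a, map (ev i) x * a ∈ Q.map (map (ev i)) → a ∈ Q.map (map (ev i)) := by
  have hle : Q.map (map g) ⊓ (Ideal.span {x}).map (map g) ≤ (Ideal.span {x} * Q).map (map g) := by
    rw [map_span_mul (map g) x Q, map_span_sing (map g) x]
    exact colon_le _ _ hx
  filter_upwards [h.inf Q (Ideal.span {x}) (Ideal.span {x} * Q) hQ ⟨{x}, by simp⟩ hle,
    (h.poly σ).ne _ hx0] with i hi hne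
  rw [map_span_mul (map (ev i)) x Q, map_span_sing (map (ev i)) x] at hi
  exact le_colon _ _ hne hi
end

section
open MvPolynomial
set_option linter.unusedSectionVars false

noncomputable def NE {σ S' S : Type} (e : σ ≃ S' ⊕ S) (R : Type) [CommRing R] :
    MvPolynomial σ R ≃+* MvPolynomial S' (MvPolynomial S R) :=
  (renameEquiv R e).toRingEquiv.trans (sumAlgEquiv R S' S).toRingEquiv

theorem NE_X {σ S' S : Type} (e : σ ≃ S' ⊕ S) (R : Type) [CommRing R] (a : σ) :
    NE e R (X a) = Sum.elim (fun b => X b) (fun b => C (X b)) (e a) := by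
  show sumAlgEquiv R S' S (renameEquiv R e (X a)) = _
  rw [renameEquiv_apply, rename_X]
  cases e a <;> simp

theorem NE_C {σ S' S : Type} (e : σ ≃ S' ⊕ S) (R : Type) [CommRing R] (a : R) :
    NE e R (C a) = C (C a) := by
  show sumAlgEquiv R S' S (renameEquiv R e (C a)) = _
  rw [renameEquiv_apply, rename_C]
  simp

theorem NE_map {σ S' S : Type} (e : σ ≃ S' ⊕ S) {R R' : Type} [CommRing R] [CommRing R']
    (φ : R →+* R') (p : MvPolynomial σ R) : NE e R' (map φ p) = map (map φ) (NE e R p) := by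
  have : ((NE e R').toRingHom.comp (map φ) : MvPolynomial σ R →+* _)
      = (map (map φ)).comp (NE e R).toRingHom := by
    refine MvPolynomial.ringHom_ext (fun r => ?_) (fun i => ?_)
    · show NE e R' (map φ (C r)) = map (map φ) (NE e R (C r))
      rw [map_C, NE_C, NE_C, map_C, map_C]
    · show NE e R' (map φ (X i)) = map (map φ) (NE e R (X i))
      rw [map_X, NE_X, NE_X]
      cases e i <;> simp
  exact RingHom.congr_fun this p

theorem ideal_NE {A B A' B' : Type} [CommRing A] [CommRing B] [CommRing A'] [CommRing B']
    (e : A ≃+* B) (e' : A' ≃+* B') (φ : A →+* A') (ψ : B →+* B')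
    (h : ∀ p, e' (φ p) = ψ (e p)) (Q : Ideal B) :
    (Q.comap e.toRingHom).map φ = (Q.map ψ).comap e'.toRingHom := by
  have h1 : Q.comap e.toRingHom = Q.map e.symm.toRingHom := by
    exact (Ideal.map_symm e).symm
  have h2 : (Q.map ψ).comap e'.toRingHom = (Q.map ψ).map e'.symm.toRingHom :=
    (Ideal.map_symm e').symm
  rw [h1, h2, Ideal.map_map, Ideal.map_map]
  congr 1
  refine RingHom.ext fun b => ?_
  show φ (e.symm b) = e'.symm (ψ b)
  apply e'.injective
  rw [h, e.apply_symm_apply, e'.apply_symm_apply]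

theorem ideal_NE_FG {A B : Type} [CommRing A] [CommRing B] (e : A ≃+* B) (Q : Ideal B)
    (hQ : Q.FG) : (Q.comap e.toRingHom).FG := by
  have h1 : Q.comap e.toRingHom = Q.map e.symm.toRingHom := by
    exact (Ideal.map_symm e).symm
  rw [h1]
  exact hQ.map _

theorem colon_tr {A B : Type} [CommRing A] [CommRing B] (e : A ≃+* B) (Q : Ideal B) (x : A)
    (h : ∀ a, e x * a ∈ Q → a ∈ Q) : ∀ a, x * a ∈ Q.comap e.toRingHom → a ∈ Q.comap e.toRingHom := by
  intro a ha
  apply h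
  rw [Ideal.mem_comap] at ha
  have : e.toRingHom (x * a) = e x * e a := map_mul e x a
  rw [this] at ha
  exact ha

theorem colon_tr' {A B : Type} [CommRing A] [CommRing B] (e : A ≃+* B) (Q : Ideal B) (x : A)
    (h : ∀ a, x * a ∈ Q.comap e.toRingHom → a ∈ Q.comap e.toRingHom) : ∀ a, e x * a ∈ Q → a ∈ Q := by
  intro a ha
  have := h (e.symm a) (by
    rw [Ideal.mem_comap]
    have : e.toRingHom (x * e.symm a) = e x * e (e.symm a) := map_mul e x _
    rw [this, e.apply_symm_apply]
    exact ha)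
  rw [Ideal.mem_comap] at this
  have h2 : e.toRingHom (e.symm a) = a := e.apply_symm_apply a
  rwa [h2] at this

theorem GB.colonN {E EK L : Type} [CommRing E] [CommRing EK] [Field L] [IsDomain EK]
    {U : Filter ℕ} {g : E →+* EK} {ev : ℕ → E →+* L} (h : GB U g ev) {S' S : Type} [Finite S']
    [Finite S]
    (Q : Ideal (MvPolynomial S' (MvPolynomial S E))) (hQ : Q.FG)
    (x : MvPolynomial S' (MvPolynomial S E)) (hx0 : map (map g) x ≠ 0)
    (hx : ∀ a, map (map g) x * a ∈ Q.map (map (map g)) → a ∈ Q.map (map (map g))) :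
    ∀ᶠ i in U, ∀ a, map (map (ev i)) x * a ∈ Q.map (map (map (ev i))) →
      a ∈ Q.map (map (map (ev i))) := by
  obtain ⟨y, rfl⟩ := (NE (Equiv.refl (S' ⊕ S)) E).surjective x
  rw [← NE_map] at hx hx0
  have hne : map g y ≠ 0 := by
    rintro h0
    rw [h0, map_zero] at hx0
    exact hx0 rfl
  have h1 := colon_tr _ _ _ hx
  rw [← ideal_NE (NE (Equiv.refl (S' ⊕ S)) E) (NE (Equiv.refl (S' ⊕ S)) EK) (map g) (map (map g))
    (fun p => NE_map _ _ _)] at h1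
  filter_upwards [h.colon _ (ideal_NE_FG (NE (Equiv.refl (S' ⊕ S)) E) Q hQ) y hne h1] with i hi
  rw [ideal_NE (NE (Equiv.refl (S' ⊕ S)) E) (NE (Equiv.refl (S' ⊕ S)) L) (map (ev i))
    (map (map (ev i))) (fun p => NE_map _ _ _)] at hi
  rw [← NE_map]
  exact colon_tr' _ _ _ hi

theorem tf_alg {T σ : Type} [CommRing T] [IsDomain T] (m : MonomialOrder σ)
    (J : Ideal (MvPolynomial σ T)) {l : ℕ} (q : Fin l → MvPolynomial σ T)
    (hq : ∀ j, q j ∈ J)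
    (H : ∀ f ∈ J, f ≠ 0 → ∃ j, m.degree (q j) ≤ m.degree f) (c : T) (hc : c ≠ 0) :
    ∀ a, C c * a ∈ J → ∃ k : ℕ, C ((∏ j, m.leadingCoeff (q j)) ^ k) * a ∈ J := by
  suffices ∀ (s : m.syn) (a), m.toSyn (m.degree a) = s → C c * a ∈ J →
      ∃ k : ℕ, C ((∏ j, m.leadingCoeff (q j)) ^ k) * a ∈ J from
    fun a ha => this _ a rfl ha
  intro s
  induction s using WellFoundedLT.induction with
  | ind s IH =>
  intro a hs ha
  by_cases ha0 : a = 0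
  · refine ⟨0, ?_⟩
    rw [ha0, mul_zero]; exact J.zero_mem
  have hcC : (C c : MvPolynomial σ T) ≠ 0 := by rw [Ne, C_eq_zero]; exact hc
  obtain ⟨j, hj⟩ := H _ ha (mul_ne_zero hcC ha0)
  rw [MonomialOrder.degree_mul hcC ha0, MonomialOrder.degree_C, zero_add] at hj
  set a' : MvPolynomial σ T := C (m.leadingCoeff (q j)) * a
    - monomial (m.degree a - m.degree (q j)) (m.leadingCoeff a) * q j with ha'
  have hca' : C c * a' ∈ J := by
    have : C c * a' = C (m.leadingCoeff (q j)) * (C c * a)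
      - C c * monomial (m.degree a - m.degree (q j)) (m.leadingCoeff a) * q j := by
      rw [ha']; ring
    rw [this]
    exact J.sub_mem (J.mul_mem_left _ ha) (J.mul_mem_left _ (hq j))
  have hfin : (∃ k : ℕ, C ((∏ j, m.leadingCoeff (q j)) ^ k) * a' ∈ J) →
      ∃ k : ℕ, C ((∏ j, m.leadingCoeff (q j)) ^ k) * a ∈ J := by
    rintro ⟨k, hk⟩
    obtain ⟨w, hw⟩ : m.leadingCoeff (q j) ∣ ∏ j, m.leadingCoeff (q j) :=
      Finset.dvd_prod_of_mem _ (Finset.mem_univ j)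
    refine ⟨k + 1, ?_⟩
    have : C ((∏ j, m.leadingCoeff (q j)) ^ (k + 1)) * a =
        C w * (C ((∏ j, m.leadingCoeff (q j)) ^ k) * a')
        + C w * C ((∏ j, m.leadingCoeff (q j)) ^ k)
          * monomial (m.degree a - m.degree (q j)) (m.leadingCoeff a) * q j := by
      rw [pow_succ, C_mul, ha']
      nth_rewrite 2 [hw]
      rw [C_mul]
      ring
    rw [this]
    exact J.add_mem (J.mul_mem_left _ hk) (J.mul_mem_left _ (hq j))
  by_cases ha'0 : a' = 0
  · refine hfin ⟨0, ?_⟩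
    rw [ha'0, mul_zero]; exact J.zero_mem
  refine hfin (IH (m.toSyn (m.degree a')) ?_ a' rfl hca')
  have hle : m.toSyn (m.degree a') ≤ m.toSyn (m.degree a) := by
    rw [ha']
    refine MonomialOrder.degree_sub_le.trans (sup_le ?_ ?_)
    · refine MonomialOrder.degree_mul_le.trans ?_
      rw [MonomialOrder.degree_C, zero_add]
    · refine MonomialOrder.degree_mul_le.trans ?_
      rw [map_add]
      refine (add_le_add_left (MonomialOrder.degree_monomial_le _) _).trans ?_
      rw [← map_add, tsub_add_cancel_of_le hj]
  have hcz : coeff (m.degree a) a' = 0 := by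
    have : coeff (m.degree a) (monomial (m.degree a - m.degree (q j)) (m.leadingCoeff a) * q j)
        = m.leadingCoeff a * m.leadingCoeff (q j) := by
      rw [coeff_monomial_mul', if_pos tsub_le_self, tsub_tsub_cancel_of_le hj]
      rfl
    rw [ha', coeff_sub, coeff_C_mul, this]
    show m.leadingCoeff (q j) * m.leadingCoeff a - _ = 0
    ring
  rw [← hs]
  refine lt_of_le_of_ne hle ?_
  intro heq
  have heq' := m.toSyn.injective heq
  rw [← heq'] at hcz
  exact ha'0 (MonomialOrder.coeff_degree_eq_zero_iff.1 hcz)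

/-- torsion-free-ness over the base -/
def TF {T σ : Type} [CommRing T] (J : Ideal (MvPolynomial σ T)) : Prop :=
  ∀ (c : T) (a : MvPolynomial σ T), c ≠ 0 → C c * a ∈ J → a ∈ J

theorem pow_colon {R : Type} [CommRing R] (Q : Ideal R) (x : R) (h : ∀ a, x * a ∈ Q → a ∈ Q) (k : ℕ) :
    ∀ a, x ^ k * a ∈ Q → a ∈ Q := by
  induction k with
  | zero => intro a ha; rwa [pow_zero, one_mul] at ha
  | succ k ih =>
    intro a ha
    rw [pow_succ, mul_assoc] at ha
    exact h _ (ih _ ha)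

theorem TF_of {T σ : Type} [CommRing T] [IsDomain T] (m : MonomialOrder σ)
    (J : Ideal (MvPolynomial σ T)) {l : ℕ} (q : Fin l → MvPolynomial σ T)
    (hq : ∀ j, q j ∈ J)
    (H : ∀ f ∈ J, f ≠ 0 → ∃ j, m.degree (q j) ≤ m.degree f)
    (h : ∀ a, C (∏ j, m.leadingCoeff (q j)) * a ∈ J → a ∈ J) : TF J := by
  intro c a hc ha
  obtain ⟨k, hk⟩ := tf_alg m J q hq H c hc a ha
  rw [C_pow] at hk
  exact pow_colon J _ h k a hk

theorem GB.tf {E EK L : Type} [CommRing E] [CommRing EK] [Field L] [IsDomain EK]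
    {U : Filter ℕ} {g : E →+* EK} {ev : ℕ → E →+* L} (h : GB U g ev) {S' S : Type} [Finite S']
    [Finite S]
    (Q : Ideal (MvPolynomial S' (MvPolynomial S E))) (hQ : Q.FG)
    (hT : TF (Q.map (map (map g)))) (h1 : (1 : MvPolynomial S' (MvPolynomial S EK)) ∉ Q.map (map (map g))) :
    ∀ᶠ i in U, TF (Q.map (map (map (ev i)))) ∧
      (1 : MvPolynomial S' (MvPolynomial S L)) ∉ Q.map (map (map (ev i))) := by
  obtain ⟨m, -⟩ : ∃ m : MonomialOrder.{0, 0} S', True := by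
    obtain ⟨s, ⟨e⟩⟩ := Finite.exists_equiv_fin S'
    let _ : LinearOrder S' := LinearOrder.lift' e e.injective
    exact ⟨MonomialOrder.lex, trivial⟩
  obtain ⟨l, q, hq, hq0, -, hi⟩ := (h.poly S).core' m Q hQ
  set x : MvPolynomial S E := ∏ j, coeff (m.degree (map (map g) (q j))) (q j) with hx
  have hx' : map g x = ∏ j, m.leadingCoeff (map (map g) (q j)) := by
    rw [hx, map_prod]
    refine Finset.prod_congr rfl fun j _ => ?_
    rw [← coeff_map]; rfl
  have hx0 : map g x ≠ 0 := by
    rw [hx', Finset.prod_ne_zero_iff]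
    intro j _
    exact MonomialOrder.leadingCoeff_ne_zero_iff.2 (hq0 j)
  have hcol := h.colonN Q hQ (C x) (by rw [map_C, Ne, C_eq_zero]; exact hx0) (by
    intro a ha
    rw [map_C] at ha
    exact hT _ _ hx0 ha)
  filter_upwards [hi, hcol] with i hi hcol
  have hdeg : ∀ j, m.degree (map (map (ev i)) (q j)) = m.degree (map (map g) (q j)) := fun j =>
    mdeg_eq m _ _ (hi.1 j)
  constructor
  · refine TF_of m _ (fun j => map (map (ev i)) (q j)) (fun j => Ideal.mem_map_of_mem _ (hq j))
      (fun f hf hf0 => ?_) ?_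
    · obtain ⟨j, hj⟩ := hi.2 f hf hf0
      exact ⟨j, by rw [hdeg]; exact hj⟩
    · intro a ha
      apply hcol
      rw [map_C, hx, map_prod]
      convert ha using 4 with j
      rw [← coeff_map, ← hdeg]; rfl
  · intro h1i
    obtain ⟨j, hj⟩ := hi.2 1 h1i one_ne_zero
    rw [MonomialOrder.degree_one, nonpos_iff_eq_zero] at hj
    apply h1
    have h2 := MonomialOrder.eq_C_of_degree_eq_zero hj
    refine hT (m.leadingCoeff (map (map g) (q j))) 1 (MonomialOrder.leadingCoeff_ne_zero_iff.2 (hq0 j)) ?_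
    rw [mul_one, ← h2]
    exact Ideal.mem_map_of_mem _ (hq j)
end

section
open MvPolynomial
set_option linter.unusedSectionVars false

theorem cert_red {T σ : Type} [CommRing T] (P : Ideal (MvPolynomial σ T)) (h0 : T)
    (θ : MvPolynomial σ T) (r : σ → Polynomial T)
    (hr : ∀ j, C h0 * X j - Polynomial.aeval θ (r j) ∈ P) (b : MvPolynomial σ T) :
    ∃ (e : ℕ) (R : Polynomial T), C h0 ^ e * b - Polynomial.aeval θ R ∈ P := by
  induction b using MvPolynomial.induction_on with
  | C a =>
    refine ⟨0, Polynomial.C a, ?_⟩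
    rw [Polynomial.aeval_C, pow_zero, one_mul]
    have : (algebraMap T (MvPolynomial σ T)) a = C a := rfl
    rw [this, sub_self]; exact P.zero_mem
  | add p q hp hq =>
    obtain ⟨e1, R1, h1⟩ := hp
    obtain ⟨e2, R2, h2⟩ := hq
    refine ⟨e1 + e2, Polynomial.C (h0 ^ e2) * R1 + Polynomial.C (h0 ^ e1) * R2, ?_⟩
    have hC : ∀ k, Polynomial.aeval θ (Polynomial.C (h0 ^ k)) = C h0 ^ k := fun k => by
      rw [Polynomial.aeval_C, map_pow]; rfl
    rw [map_add, map_mul, map_mul, hC, hC]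
    have : C h0 ^ (e1 + e2) * (p + q) - (C h0 ^ e2 * Polynomial.aeval θ R1 + C h0 ^ e1 * Polynomial.aeval θ R2)
      = C h0 ^ e2 * (C h0 ^ e1 * p - Polynomial.aeval θ R1) +
        C h0 ^ e1 * (C h0 ^ e2 * q - Polynomial.aeval θ R2) := by ring
    rw [this]
    exact P.add_mem (P.mul_mem_left _ h1) (P.mul_mem_left _ h2)
  | mul_X p j hp =>
    obtain ⟨e, R, h⟩ := hp
    refine ⟨e + 1, R * r j, ?_⟩
    rw [map_mul]
    have : C h0 ^ (e + 1) * (p * X j) - Polynomial.aeval θ R * Polynomial.aeval θ (r j)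
      = C h0 * X j * (C h0 ^ e * p - Polynomial.aeval θ R)
        + Polynomial.aeval θ R * (C h0 * X j - Polynomial.aeval θ (r j)) := by ring
    rw [this]
    exact P.add_mem (P.mul_mem_left _ h) (P.mul_mem_left _ (hr j))

theorem clear_den {T : Type} [CommRing T] [IsDomain T] (p : Polynomial (FractionRing T)) :
    ∃ (c : T) (q : Polynomial T), c ≠ 0 ∧
      q.map (algebraMap T (FractionRing T)) = Polynomial.C (algebraMap T (FractionRing T) c) * p := by
  obtain ⟨b, hb0, hb⟩ := IsLocalization.integerNormalization_spec (nonZeroDivisors T) p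
  refine ⟨b, _, nonZeroDivisors.ne_zero hb0, hb.trans ?_⟩
  rw [← algebraMap_smul (FractionRing T) (b : T) p, Polynomial.smul_eq_C_mul]

theorem two_cases {T : Type} [CommRing T] [IsDomain T] (μ R : Polynomial T)
    (hirr : Irreducible (μ.map (algebraMap T (FractionRing T)))) :
    (∃ c : T, c ≠ 0 ∧ ∃ W, Polynomial.C c * R = μ * W) ∨
      ∃ c : T, c ≠ 0 ∧ ∃ A B, A * R + B * μ = Polynomial.C c := by
  have inj : Function.Injective (Polynomial.map (algebraMap T (FractionRing T))) :=
    Polynomial.map_injective _ (IsFractionRing.injective T (FractionRing T))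
  rcases EuclideanDomain.dvd_or_coprime _ (R.map (algebraMap T (FractionRing T))) hirr with
    ⟨W', hW⟩ | ⟨B', A', hAB⟩
  · left
    obtain ⟨c, W, hc, hcW⟩ := clear_den W'
    refine ⟨c, hc, W, inj ?_⟩
    rw [Polynomial.map_mul, Polynomial.map_mul, hcW, hW, Polynomial.map_C]
    ring
  · right
    obtain ⟨c, A, hc, hcA⟩ := clear_den A'
    obtain ⟨d, B, hd, hdB⟩ := clear_den B'
    refine ⟨c * d, mul_ne_zero hc hd, Polynomial.C d * A, Polynomial.C c * B, inj ?_⟩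
    simp only [Polynomial.map_mul, Polynomial.map_add, Polynomial.map_C, hcA, hdB, map_mul]
    linear_combination (Polynomial.C ((algebraMap T (FractionRing T)) c) *
      Polynomial.C ((algebraMap T (FractionRing T)) d)) * hAB

theorem cert_primary {T σ : Type} [CommRing T] [IsDomain T] (Q : Ideal (MvPolynomial σ T))
    (hTF : TF Q) (h1 : (1 : MvPolynomial σ T) ∉ Q) (h0 : T) (hh0 : h0 ≠ 0)
    (θ : MvPolynomial σ T) (r : σ → Polynomial T) (μ : Polynomial T)
    (hr : ∀ j, C h0 * X j - Polynomial.aeval θ (r j) ∈ Q.radical)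
    (hμ : Polynomial.aeval θ μ ∈ Q.radical)
    (hirr : Irreducible (μ.map (algebraMap T (FractionRing T)))) : Q.IsPrimary := by
  rw [Ideal.isPrimary_iff]
  refine ⟨(Ideal.ne_top_iff_one Q).2 h1, fun {a b} hab => ?_⟩
  obtain ⟨e, R, hR⟩ := cert_red Q.radical h0 θ r hr b
  have hC : ∀ c, Polynomial.aeval θ (Polynomial.C c) = C c := fun c => Polynomial.aeval_C _ _
  rcases two_cases μ R hirr with ⟨c, hc, W, hW⟩ | ⟨c, hc, A, B, hAB⟩
  · right
    have h2 := congrArg (Polynomial.aeval θ) hW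
    rw [map_mul, map_mul, hC] at h2
    have h3 : C (c * h0 ^ e) * b ∈ Q.radical := by
      have : C (c * h0 ^ e) * b = C c * (C h0 ^ e * b - Polynomial.aeval θ R) +
          Polynomial.aeval θ W * Polynomial.aeval θ μ := by
        rw [C_mul, C_pow]; linear_combination h2
      rw [this]
      exact Ideal.add_mem _ (Ideal.mul_mem_left _ _ hR) (Ideal.mul_mem_left _ _ hμ)
    obtain ⟨M, hM⟩ := h3
    rw [mul_pow, ← C_pow] at hM
    exact ⟨M, hTF _ _ (pow_ne_zero _ (mul_ne_zero hc (pow_ne_zero _ hh0))) hM⟩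
  · left
    have h2 := congrArg (Polynomial.aeval θ) hAB
    rw [map_add, map_mul, map_mul, hC] at h2
    have h3 : C c - (Polynomial.aeval θ A * C h0 ^ e) * b ∈ Q.radical := by
      have : C c - (Polynomial.aeval θ A * C h0 ^ e) * b =
        Polynomial.aeval θ B * Polynomial.aeval θ μ
        - Polynomial.aeval θ A * (C h0 ^ e * b - Polynomial.aeval θ R) := by
        linear_combination -h2
      rw [this]
      exact Ideal.sub_mem _ (Ideal.mul_mem_left _ _ hμ) (Ideal.mul_mem_left _ _ hR)
    obtain ⟨M, hM⟩ := h3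
    set w := Polynomial.aeval θ A * C h0 ^ e
    obtain ⟨z, hz⟩ : C c - (C c - w * b) ∣ C c ^ M - (C c - w * b) ^ M := sub_dvd_pow_sub_pow _ _ _
    refine hTF (c ^ M) a (pow_ne_zero _ hc) ?_
    rw [C_pow]
    have : C c ^ M * a = a * (C c - w * b) ^ M + w * z * (a * b) := by
      linear_combination a * hz
    rw [this]
    exact Ideal.add_mem _ (Ideal.mul_mem_left _ _ hM) (Ideal.mul_mem_left _ _ hab)
end

section
open MvPolynomial
set_option linter.unusedSectionVars false

theorem bdd_family {σ : Type} [Finite σ] (D : ℕ) (a : ℕ → MvPolynomial σ ℂ)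
    (ha : ∀ i, (a i).totalDegree ≤ D) :
    ∃ p : MvPolynomial σ (ℕ → ℂ), ∀ i, map (Pi.evalRingHom (fun _ => ℂ) i) p = a i := by
  classical
  have _ := Fintype.ofFinite σ
  let B : Finset (σ →₀ ℕ) := (Finset.range (D + 1)).biUnion
    (fun n => Finset.finsuppAntidiag Finset.univ n)
  have hB : ∀ d : σ →₀ ℕ, d.sum (fun _ x => x) ≤ D → d ∈ B := by
    intro d hd
    refine Finset.mem_biUnion.2 ⟨d.sum (fun _ x => x), Finset.mem_range.2 (by omega), ?_⟩
    rw [Finset.mem_finsuppAntidiag']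
    exact ⟨rfl, Finset.subset_univ _⟩
  refine ⟨∑ d ∈ B, monomial d (fun i => coeff d (a i)), fun i => ?_⟩
  ext d
  rw [map_sum, coeff_sum]
  simp only [map_monomial, coeff_monomial]
  rw [Finset.sum_ite_eq']
  split_ifs with h
  · rfl
  · symm
    by_contra hne
    apply h
    apply hB
    exact (le_totalDegree (mem_support_iff.2 hne)).trans (ha i)

theorem tdeg_supp {A B σ : Type} [CommRing A] [CommRing B] (p : MvPolynomial σ A)
    (q : MvPolynomial σ B) (h : p.support = q.support) : p.totalDegree = q.totalDegree := by
  unfold totalDegree; rw [h]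

theorem tdeg_unit {F σ : Type} [Field F] (p : MvPolynomial σ F) (h0 : p ≠ 0) :
    IsUnit p ↔ p.totalDegree = 0 := by
  constructor
  · intro h
    obtain ⟨c, hc, rfl⟩ := (MvPolynomial.isUnit_iff_eq_C_of_isReduced).1 h
    exact totalDegree_C _
  · intro h
    rw [totalDegree_eq_zero_iff_eq_C] at h
    rw [h] at h0 ⊢
    refine IsUnit.map C (IsUnit.mk0 _ ?_)
    intro h1
    rw [h1] at h0; simp at h0

theorem GB.irred {K : Type} [Field K] {U : Ultrafilter ℕ} {g : (ℕ → ℂ) →+* K}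
    (h : GB (U : Filter ℕ) g (fun i => Pi.evalRingHom (fun _ => ℂ) i)) {σ : Type} [Finite σ]
    (p : MvPolynomial σ (ℕ → ℂ)) (hp : Irreducible (map g p)) :
    ∀ᶠ i in (U : Filter ℕ), Irreducible (map (Pi.evalRingHom (fun _ => ℂ) i) p) := by
  classical
  by_contra hcon
  have hcon : ∀ᶠ i in (U : Filter ℕ), ¬ Irreducible (map (Pi.evalRingHom (fun _ => ℂ) i) p) :=
    Ultrafilter.eventually_not.2 hcon
  have hD : (map g p).totalDegree ≠ 0 := fun h0 =>
    hp.not_isUnit ((tdeg_unit _ hp.ne_zero).2 h0)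
  set D := (map g p).totalDegree
  have key : ∀ i, ∃ a b : MvPolynomial σ ℂ, a.totalDegree ≤ D ∧ b.totalDegree ≤ D ∧
      (¬ Irreducible (map (Pi.evalRingHom (fun _ => ℂ) i) p) →
        (map (Pi.evalRingHom (fun _ => ℂ) i) p).support = (map g p).support →
          map (Pi.evalRingHom (fun _ => ℂ) i) p = a * b ∧ a.totalDegree ≠ 0 ∧
            b.totalDegree ≠ 0) := by
    intro i
    by_cases hi : ¬ Irreducible (map (Pi.evalRingHom (fun _ => ℂ) i) p) ∧
        (map (Pi.evalRingHom (fun _ => ℂ) i) p).support = (map g p).support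
    swap
    · refine ⟨0, 0, by simp, by simp, fun h1 h2 => absurd ⟨h1, h2⟩ hi⟩
    obtain ⟨h1, h2⟩ := hi
    set P := map (Pi.evalRingHom (fun _ => ℂ) i) p
    have hPd : P.totalDegree = D := tdeg_supp _ _ h2
    have hP0 : P ≠ 0 := by
      intro h0
      rw [h0, totalDegree_zero] at hPd
      exact hD hPd.symm
    have hPu : ¬ IsUnit P := by
      rw [tdeg_unit _ hP0, hPd]; exact hD
    rw [irreducible_iff] at h1
    push Not at h1
    obtain ⟨a, b, hab, hau, hbu⟩ := h1 hPu
    have ha0 : a ≠ 0 := by rintro rfl; rw [zero_mul] at hab; exact hP0 hab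
    have hb0 : b ≠ 0 := by rintro rfl; rw [mul_zero] at hab; exact hP0 hab
    rw [tdeg_unit _ ha0] at hau
    rw [tdeg_unit _ hb0] at hbu
    have hs : a.totalDegree + b.totalDegree = D := by
      rw [← totalDegree_mul_of_isDomain ha0 hb0, ← hab, hPd]
    exact ⟨a, b, by omega, by omega, fun _ _ => ⟨hab, hau, hbu⟩⟩
  choose a b ha hb hab using key
  obtain ⟨a', ha'⟩ := bdd_family D a ha
  obtain ⟨b', hb'⟩ := bdd_family D b hb
  have hfac : ∀ᶠ i in (U : Filter ℕ), map (Pi.evalRingHom (fun _ => ℂ) i) p = a i * b i ∧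
      (a i).totalDegree ≠ 0 ∧ (b i).totalDegree ≠ 0 := by
    filter_upwards [hcon, h.supp p] with i h1 h2
    exact hab i h1 h2
  have hz : map g (p - a' * b') = 0 := by
    by_contra hne
    have := (h.poly σ).ne _ hne
    obtain ⟨i, hi1, hi2⟩ := (this.and hfac).exists
    apply hi1
    show map _ (p - a' * b') = 0
    rw [map_sub, map_mul, ha', hb', hi2.1, sub_self]
  rw [map_sub, map_mul, sub_eq_zero] at hz
  have hun : ∀ c : MvPolynomial σ (ℕ → ℂ), IsUnit (map g c) →
      ∀ᶠ i in (U : Filter ℕ), (map (Pi.evalRingHom (fun _ => ℂ) i) c).totalDegree = 0 := by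
    intro c hc
    filter_upwards [h.supp c] with i hi
    rw [tdeg_supp _ _ hi]
    exact (tdeg_unit _ hc.ne_zero).1 hc
  rcases hp.isUnit_or_isUnit hz with h1 | h1
  · obtain ⟨i, hi1, hi2⟩ := ((hun _ h1).and hfac).exists
    rw [ha'] at hi1
    exact hi2.2.1 hi1
  · obtain ⟨i, hi1, hi2⟩ := ((hun _ h1).and hfac).exists
    rw [hb'] at hi1
    exact hi2.2.2 hi1

theorem opt_map {S R R' : Type} [CommRing R] [CommRing R'] (φ : R →+* R')
    (p : MvPolynomial (Option S) R) :
    optionEquivLeft R' S (map φ p) = (optionEquivLeft R S p).map (map φ) := by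
  have : ((optionEquivLeft R' S).toRingEquiv.toRingHom.comp (map φ)) =
      (Polynomial.mapRingHom (map φ)).comp (optionEquivLeft R S).toRingEquiv.toRingHom := by
    refine MvPolynomial.ringHom_ext (fun r => ?_) (fun i => ?_)
    · show optionEquivLeft R' S (map φ (C r)) = (optionEquivLeft R S (C r)).map (map φ)
      rw [map_C, optionEquivLeft_C, optionEquivLeft_C, Polynomial.map_C, map_C]
    · show optionEquivLeft R' S (map φ (X i)) = (optionEquivLeft R S (X i)).map (map φ)
      cases i <;> simp
  exact RingHom.congr_fun this p

theorem gauss {T : Type} [CommRing T] [IsDomain T] [UniqueFactorizationMonoid T]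
    (μ : Polynomial T) (hμ : μ.natDegree ≠ 0) :
    Irreducible μ ↔ μ.IsPrimitive ∧ Irreducible (μ.map (algebraMap T (FractionRing T))) := by
  classical
  have _ : StrongNormalizationMonoid T := UniqueFactorizationMonoid.strongNormalizationMonoid
  have _ : NormalizedGCDMonoid T := UniqueFactorizationMonoid.toNormalizedGCDMonoid T
  constructor
  · intro h
    have hp := h.isPrimitive hμ
    exact ⟨hp, (hp.irreducible_iff_irreducible_map_fraction_map (K := FractionRing T)).1 h⟩
  · rintro ⟨hp, h⟩
    exact (hp.irreducible_iff_irreducible_map_fraction_map (K := FractionRing T)).2 h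

theorem GB.irredP {K : Type} [Field K] {U : Ultrafilter ℕ} {g : (ℕ → ℂ) →+* K}
    (h : GB (U : Filter ℕ) g (fun i => Pi.evalRingHom (fun _ => ℂ) i)) {S : Type} [Finite S]
    (μ : Polynomial (MvPolynomial S (ℕ → ℂ))) (hp : Irreducible (μ.map (map g)))
    (hd : (μ.map (map g)).natDegree ≠ 0) :
    ∀ᶠ i in (U : Filter ℕ), Irreducible ((μ.map (map (Pi.evalRingHom (fun _ => ℂ) i))).map
      (algebraMap (MvPolynomial S ℂ) (FractionRing (MvPolynomial S ℂ)))) := by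
  have h1 : ∀ᶠ i in (U : Filter ℕ),
      Irreducible (μ.map (map (Pi.evalRingHom (fun _ => ℂ) i))) := by
    obtain ⟨p, rfl⟩ := (optionEquivLeft (ℕ → ℂ) S).surjective μ
    rw [← opt_map, MulEquiv.irreducible_iff (optionEquivLeft K S)] at hp
    filter_upwards [h.irred p hp] with i hi
    rw [← opt_map, MulEquiv.irreducible_iff (optionEquivLeft ℂ S)]
    exact hi
  have h2 : map g (μ.coeff (μ.map (map g)).natDegree) ≠ 0 := by
    rw [← Polynomial.coeff_map]
    exact Polynomial.leadingCoeff_ne_zero.2 hp.ne_zero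
  filter_upwards [h1, (h.poly S).ne _ h2] with i hi1 hi2
  refine ((gauss _ ?_).1 hi1).2
  rw [← Polynomial.coeff_map] at hi2
  have := Polynomial.le_natDegree_of_ne_zero hi2
  omega
end

section
open MvPolynomial
set_option linter.unusedSectionVars false

theorem prim_part {T : Type} [CommRing T] [IsDomain T] [UniqueFactorizationMonoid T]
    (ν : Polynomial T) (hν : Irreducible (ν.map (algebraMap T (FractionRing T)))) :
    ∃ (c : T) (μ : Polynomial T), c ≠ 0 ∧ ν = Polynomial.C c * μ ∧ Irreducible μ ∧
      μ.natDegree ≠ 0 := by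
  classical
  have _ : StrongNormalizationMonoid T := UniqueFactorizationMonoid.strongNormalizationMonoid
  have _ : NormalizedGCDMonoid T := UniqueFactorizationMonoid.toNormalizedGCDMonoid T
  have h0 : ν ≠ 0 := by
    rintro rfl
    rw [Polynomial.map_zero] at hν
    exact hν.ne_zero rfl
  have hc : ν.content ≠ 0 := by rwa [Ne, Polynomial.content_eq_zero_iff]
  have hd : ν.primPart.natDegree ≠ 0 := by
    rw [Polynomial.natDegree_primPart]
    intro hd
    apply hν.not_isUnit
    rw [Polynomial.isUnit_iff_degree_eq_zero, Polynomial.degree_map_eq_of_injective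
      (IsFractionRing.injective T (FractionRing T)), Polynomial.degree_eq_natDegree h0, hd]
    rfl
  refine ⟨ν.content, ν.primPart, hc, ν.eq_C_content_mul_primPart, ?_, hd⟩
  rw [gauss _ hd]
  refine ⟨ν.isPrimitive_primPart, ?_⟩
  rw [ν.eq_C_content_mul_primPart, Polynomial.map_mul, Polynomial.map_C] at hν
  have hu : IsUnit (Polynomial.C (algebraMap T (FractionRing T) ν.content)) := by
    rw [Polynomial.isUnit_C]
    refine IsUnit.mk0 _ ?_
    rw [Ne, IsFractionRing.to_map_eq_zero_iff]
    exact hc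
  exact (irreducible_isUnit_mul hu).1 hν

attribute [local instance] FractionRing.liftAlgebra

theorem cert_exists {T B ι : Type} [CommRing T] [IsDomain T] [UniqueFactorizationMonoid T]
    [CharZero T] [CommRing B] [IsDomain B] [Algebra T B]
    (hinj : Function.Injective (algebraMap T B)) [Fintype ι] (x : ι → B)
    (hgen : ∀ b, b ∈ Algebra.adjoin T (Set.range x)) (halg : ∀ j, IsAlgebraic T (x j)) :
    ∃ (h0 : T) (b : B) (r : ι → Polynomial T) (μ : Polynomial T), h0 ≠ 0 ∧ Irreducible μ ∧
      μ.natDegree ≠ 0 ∧ (∀ j, algebraMap T B h0 * x j = Polynomial.aeval b (r j)) ∧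
      Polynomial.aeval b μ = 0 := by
  classical
  have hBM := IsFractionRing.injective B (FractionRing B)
  have hTM : Function.Injective (algebraMap T (FractionRing B)) := by
    rw [IsScalarTower.algebraMap_eq T B (FractionRing B)]
    exact hBM.comp hinj
  have _ : FaithfulSMul T (FractionRing B) := (faithfulSMul_iff_algebraMap_injective _ _).2 hTM
  have _ : CharZero (FractionRing T) :=
    charZero_of_injective_algebraMap (IsFractionRing.injective T (FractionRing T))
  have hint : ∀ j, IsIntegral (FractionRing T) (algebraMap B (FractionRing B) (x j)) := by
    intro j
    apply IsAlgebraic.isIntegral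
    rw [← IsFractionRing.isAlgebraic_iff T (FractionRing T) (FractionRing B)]
    exact (isAlgebraic_algebraMap_iff hBM).2 (halg j)
  have hfin : FiniteDimensional (FractionRing T) (IntermediateField.adjoin (FractionRing T)
      (Set.range fun j => algebraMap B (FractionRing B) (x j))) := by
    refine IntermediateField.finiteDimensional_adjoin ?_
    rintro _ ⟨j, rfl⟩
    exact hint j
  have htop : IntermediateField.adjoin (FractionRing T)
      (Set.range fun j => algebraMap B (FractionRing B) (x j)) = ⊤ := by
    rw [eq_top_iff]
    rintro m -
    have hb : ∀ b : B, algebraMap B (FractionRing B) b ∈ IntermediateField.adjoin (FractionRing T)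
        (Set.range fun j => algebraMap B (FractionRing B) (x j)) := by
      intro b
      have := hgen b
      induction this using Algebra.adjoin_induction with
      | mem y hy =>
        obtain ⟨j, rfl⟩ := hy
        exact IntermediateField.subset_adjoin _ _ ⟨j, rfl⟩
      | algebraMap t =>
        rw [← IsScalarTower.algebraMap_apply T B, IsScalarTower.algebraMap_apply T (FractionRing T)]
        exact IntermediateField.algebraMap_mem _ _
      | add a b _ _ ha hb => rw [map_add]; exact add_mem ha hb
      | mul a b _ _ ha hb => rw [map_mul]; exact mul_mem ha hb
    obtain ⟨a, c, -, rfl⟩ := IsFractionRing.div_surjective (A := B) m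
    exact div_mem (hb a) (hb c)
  have hfd : FiniteDimensional (FractionRing T) (FractionRing B) := by
    rw [htop] at hfin
    exact Module.Finite.equiv (IntermediateField.topEquiv (F := FractionRing T)
      (E := FractionRing B)).toLinearEquiv
  obtain ⟨α, hα⟩ := Field.exists_primitive_element (FractionRing T) (FractionRing B)
  -- scale α into B
  obtain ⟨b, t, ht, hbt⟩ : ∃ (b : B) (t : T), t ≠ 0 ∧
      algebraMap B (FractionRing B) b = algebraMap T (FractionRing B) t * α := by
    obtain ⟨a, c, hc, rfl⟩ := IsFractionRing.div_surjective (A := B) α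
    have hcalg : IsAlgebraic T c := by
      rw [← isAlgebraic_algebraMap_iff hBM, IsFractionRing.isAlgebraic_iff T (FractionRing T)]
      exact Algebra.IsAlgebraic.isAlgebraic _
    obtain ⟨t, ht, c', hc'⟩ := hcalg.exists_nonzero_dvd hc
    refine ⟨a * c', t, ht, ?_⟩
    have hc0 : algebraMap B (FractionRing B) c ≠ 0 := by
      rw [Ne, IsFractionRing.to_map_eq_zero_iff]
      exact nonZeroDivisors.ne_zero hc
    rw [IsScalarTower.algebraMap_apply T B, hc', map_mul, map_mul]
    field_simp
  have hβ : IntermediateField.adjoin (FractionRing T) {algebraMap B (FractionRing B) b} = ⊤ := by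
    rw [eq_top_iff, ← hα, IntermediateField.adjoin_simple_le_iff]
    have h1 : algebraMap T (FractionRing B) t ≠ 0 := by
      rw [Ne, map_eq_zero_iff _ hTM]; exact ht
    have : α = algebraMap B (FractionRing B) b / algebraMap T (FractionRing B) t := by
      rw [hbt]; field_simp
    rw [this]
    refine div_mem (IntermediateField.mem_adjoin_simple_self _ _) ?_
    rw [IsScalarTower.algebraMap_apply T (FractionRing T)]
    exact IntermediateField.algebraMap_mem _ _
  have hae : ∀ p : Polynomial T, algebraMap B (FractionRing B) (Polynomial.aeval b p) =
      Polynomial.aeval (algebraMap B (FractionRing B) b)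
        (p.map (algebraMap T (FractionRing T))) := by
    intro p
    rw [Polynomial.aeval_map_algebraMap, Polynomial.aeval_algebraMap_apply]
  have hbint : IsIntegral (FractionRing T) (algebraMap B (FractionRing B) b) :=
    IsIntegral.of_finite _ _
  have hrep : ∀ y : FractionRing B, ∃ p : Polynomial (FractionRing T),
      Polynomial.aeval (algebraMap B (FractionRing B) b) p = y := by
    intro y
    have hy : y ∈ (IntermediateField.adjoin (FractionRing T)
      {algebraMap B (FractionRing B) b}).toSubalgebra := by rw [hβ]; trivial
    rw [IntermediateField.adjoin_simple_toSubalgebra_of_isAlgebraic hbint.isAlgebraic,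
      Algebra.adjoin_singleton_eq_range_aeval] at hy
    exact hy
  have hcl : ∀ j, ∃ (c : T) (q : Polynomial T), c ≠ 0 ∧
      algebraMap T B c * x j = Polynomial.aeval b q := by
    intro j
    obtain ⟨p, hp⟩ := hrep (algebraMap B (FractionRing B) (x j))
    obtain ⟨c, q, hc, hq⟩ := clear_den p
    refine ⟨c, q, hc, hBM ?_⟩
    rw [hae, hq, map_mul, map_mul, hp, Polynomial.aeval_C, ← IsScalarTower.algebraMap_apply,
      ← IsScalarTower.algebraMap_apply]
  choose c q hc hq using hcl
  obtain ⟨d, ν, hd, hν⟩ := clear_den (minpoly (FractionRing T) (algebraMap B (FractionRing B) b))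
  have hirr : Irreducible (ν.map (algebraMap T (FractionRing T))) := by
    rw [hν]
    refine (irreducible_isUnit_mul ?_).2 (minpoly.irreducible hbint)
    rw [Polynomial.isUnit_C]
    refine IsUnit.mk0 _ ?_
    rw [Ne, IsFractionRing.to_map_eq_zero_iff]
    exact hd
  obtain ⟨e, μ, he, hνμ, hμ, hμd⟩ := prim_part ν hirr
  refine ⟨∏ j, c j, b, fun j => Polynomial.C (∏ k ∈ Finset.univ.erase j, c k) * q j, μ,
    Finset.prod_ne_zero_iff.2 fun j _ => hc j, hμ, hμd, fun j => ?_, ?_⟩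
  · rw [map_mul, ← hq j, Polynomial.aeval_C, ← mul_assoc, ← map_mul,
      Finset.prod_erase_mul _ _ (Finset.mem_univ j)]
  · have h1 : Polynomial.aeval b ν = 0 := by
      apply hBM
      rw [hae, hν, map_mul, minpoly.aeval, mul_zero, map_zero]
    rw [hνμ, map_mul, Polynomial.aeval_C] at h1
    refine (mul_eq_zero.1 h1).resolve_left ?_
    rw [map_eq_zero_iff _ hinj]
    exact he
end

section
open MvPolynomial
set_option linter.unusedSectionVars false

theorem cert_hom {T A ι : Type} [CommRing T] [IsDomain T] [UniqueFactorizationMonoid T]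
    [CharZero T] [CommRing A] [IsDomain A] [Fintype ι] (φ : MvPolynomial ι T →+* A)
    (hs : Function.Surjective φ) (hinj : ∀ c, φ (C c) = 0 → c = 0)
    (halg : ∀ j, ∃ p : Polynomial T, p ≠ 0 ∧ p.eval₂ (φ.comp C) (φ (X j)) = 0) :
    ∃ (h0 : T) (θ : MvPolynomial ι T) (r : ι → Polynomial T) (μ : Polynomial T), h0 ≠ 0 ∧
      Irreducible μ ∧ μ.natDegree ≠ 0 ∧
      (∀ j, φ (C h0 * X j - Polynomial.aeval θ (r j)) = 0) ∧
      φ (Polynomial.aeval θ μ) = 0 := by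
  let _ : Algebra T A := (φ.comp C).toAlgebra
  have hT : ∀ c, algebraMap T A c = φ (C c) := fun c => rfl
  obtain ⟨Φ, hΦ⟩ : ∃ Φ : MvPolynomial ι T →ₐ[T] A, ∀ p, Φ p = φ p :=
    ⟨{ φ with commutes' := fun c => rfl }, fun p => rfl⟩
  have hi : Function.Injective (algebraMap T A) := by
    rw [injective_iff_map_eq_zero]
    exact hinj
  obtain ⟨h0, b, r, μ, h1, h2, h3, h4, h5⟩ := cert_exists hi (fun j => Φ (X j)) (fun b => by
    obtain ⟨p, rfl⟩ := hs b
    rw [← hΦ, Algebra.adjoin_range_eq_range_aeval]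
    refine ⟨p, ?_⟩
    show aeval (fun j => Φ (X j)) p = Φ p
    congr 1
    refine MvPolynomial.algHom_ext fun j => ?_
    rw [aeval_X]) (fun j => by
    obtain ⟨p, hp, h⟩ := halg j
    refine ⟨p, hp, ?_⟩
    rw [hΦ]
    exact h)
  obtain ⟨θ, rfl⟩ := hs b
  refine ⟨h0, θ, r, μ, h1, h2, h3, fun j => ?_, ?_⟩
  · have := h4 j
    rw [map_sub, map_mul, sub_eq_zero, ← hT, ← hΦ (X j), this, ← hΦ, ← hΦ,
      Polynomial.aeval_algHom_apply]
  · rw [← hΦ, ← h5, ← hΦ, Polynomial.aeval_algHom_apply]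

theorem alg_sel {K A σ : Type} [Field K] [CommRing A] [IsDomain A] [Algebra K A] [Finite σ]
    (x : σ → A) : ∃ s : Set σ, (∀ c : MvPolynomial s K, aeval (fun b : s => x b) c = 0 → c = 0) ∧
      ∀ a, a ∉ s → ∃ p : Polynomial (MvPolynomial s K), p ≠ 0 ∧
        p.eval₂ (aeval (fun b : s => x b) : MvPolynomial s K →ₐ[K] A).toRingHom (x a) = 0 := by
  classical
  obtain ⟨s, hs⟩ := (Set.toFinite {s : Set σ | AlgebraicIndependent K (fun b : s => x b)}).exists_maximal
    ⟨∅, by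
      show AlgebraicIndependent K _
      rw [algebraicIndependent_empty_type_iff]
      exact (algebraMap K A).injective⟩
  have hsI : AlgebraicIndependent K (fun b : s => x b) := hs.1
  refine ⟨s, fun c hc => ?_, fun a ha => ?_⟩
  · exact (injective_iff_map_eq_zero _).1 hsI c hc
  · by_contra hcon
    push Not at hcon
    refine ha (hs.2 (y := insert a s) ?_ (Set.subset_insert a s) (Set.mem_insert a s))
    show AlgebraicIndepOn K x (insert a s)
    rw [AlgebraicIndepOn.insert_iff ha]
    refine ⟨hsI, ?_⟩
    rintro ⟨p, hp, hpx⟩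
    have hsI' : AlgebraicIndepOn K x s := hsI
    obtain ⟨E, hE⟩ : ∃ E : MvPolynomial s K ≃ₐ[K] Algebra.adjoin K (x '' s),
        ∀ q, (E q : A) = aeval (fun b : s => x b) q :=
      ⟨hsI'.aevalEquiv, fun q => hsI'.algebraMap_aevalEquiv q⟩
    refine hcon (p.map (E.symm : Algebra.adjoin K (x '' s) →+* MvPolynomial s K)) ?_ ?_
    · rw [Ne, Polynomial.map_eq_zero_iff]
      · exact hp
      · exact E.symm.injective
    · rw [Polynomial.eval₂_map, ← hpx, Polynomial.aeval_def]
      congr 1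
      refine RingHom.ext fun y => ?_
      show aeval (fun b : s => x b) (E.symm y) = (y : A)
      rw [← hE, E.apply_symm_apply]

theorem cert_field {K σ : Type} [Field K] [CharZero K] [Finite σ]
    (P : Ideal (MvPolynomial σ K)) (hP : P.IsPrime) :
    ∃ (S' S : Type) (_ : Fintype S') (_ : Fintype S) (e : σ ≃ S' ⊕ S) (h0 : MvPolynomial S K)
      (θ : MvPolynomial S' (MvPolynomial S K)) (r : S' → Polynomial (MvPolynomial S K))
      (μ : Polynomial (MvPolynomial S K)), h0 ≠ 0 ∧ Irreducible μ ∧ μ.natDegree ≠ 0 ∧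
      (∀ c : MvPolynomial S K, (NE e K).symm (C c) ∈ P → c = 0) ∧
      (∀ j, (NE e K).symm (C h0 * X j - Polynomial.aeval θ (r j)) ∈ P) ∧
      (NE e K).symm (Polynomial.aeval θ μ) ∈ P := by
  classical
  have := Fintype.ofFinite σ
  obtain ⟨s, h1, h2⟩ := alg_sel (K := K) (fun a : σ => Ideal.Quotient.mk P (X a))
  obtain ⟨e, he⟩ : ∃ e : σ ≃ ((sᶜ : Set σ) : Type) ⊕ s, ∀ t, e.symm t = Sum.elim (fun b => b.1) (fun b => b.1) t :=
    ⟨(Equiv.Set.sumCompl s).symm.trans (Equiv.sumComm _ _), by rintro (b | b) <;> rfl⟩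
  have hX : ∀ b : (sᶜ : Set σ), (NE e K).symm (X b) = X b.1 := by
    intro b
    have : e b.1 = Sum.inl b := (e.symm_apply_eq.1 (he (Sum.inl b))).symm
    rw [RingEquiv.symm_apply_eq, NE_X, this]
    rfl
  have hXs : ∀ b : s, (NE e K).symm (C (X b)) = X b.1 := by
    intro b
    have : e b.1 = Sum.inr b := (e.symm_apply_eq.1 (he (Sum.inr b))).symm
    rw [RingEquiv.symm_apply_eq, NE_X, this]
    rfl
  have hCC : ∀ a : K, (NE e K).symm (C (C a)) = C a := by
    intro a
    rw [RingEquiv.symm_apply_eq, NE_C]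
  obtain ⟨φ, hφ⟩ : ∃ φ : MvPolynomial (sᶜ : Set σ) (MvPolynomial s K) →+* MvPolynomial σ K ⧸ P,
      ∀ p, φ p = Ideal.Quotient.mk P ((NE e K).symm p) :=
    ⟨(Ideal.Quotient.mk P).comp (NE e K).symm.toRingHom, fun p => rfl⟩
  have hφC : φ.comp C = (aeval (fun b : s => Ideal.Quotient.mk P (X b.1)) :
      MvPolynomial s K →ₐ[K] MvPolynomial σ K ⧸ P).toRingHom := by
    refine MvPolynomial.ringHom_ext (fun a => ?_) (fun b => ?_)
    · show φ (C (C a)) = aeval (fun b : s => Ideal.Quotient.mk P (X b.1)) (C a)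
      rw [hφ, hCC, aeval_C]
      rfl
    · show φ (C (X b)) = aeval (fun b : s => Ideal.Quotient.mk P (X b.1)) (X b)
      rw [hφ, hXs, aeval_X]
  have hφC' : ∀ c, φ (C c) = aeval (fun b : s => Ideal.Quotient.mk P (X b.1)) c :=
    fun c => RingHom.congr_fun hφC c
  obtain ⟨h0, θ, r, μ, c1, c2, c3, c4, c5⟩ := cert_hom φ (fun y => by
      obtain ⟨z, rfl⟩ := Ideal.Quotient.mk_surjective y
      refine ⟨NE e K z, ?_⟩
      rw [hφ, RingEquiv.symm_apply_apply])
    (fun c hc => h1 c (by rw [← hφC', hc]))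
    (fun j => by
      obtain ⟨p, hp, hp'⟩ := h2 j.1 j.2
      refine ⟨p, hp, ?_⟩
      rw [hφC, hφ, hX]
      exact hp')
  refine ⟨_, _, inferInstance, inferInstance, e, h0, θ, r, μ, c1, c2, c3, fun c hc => ?_,
    fun j => ?_, ?_⟩
  · apply h1 c
    rw [← hφC', hφ, Ideal.Quotient.eq_zero_iff_mem]
    exact hc
  · rw [← Ideal.Quotient.eq_zero_iff_mem, ← hφ]
    exact c4 j
  · rw [← Ideal.Quotient.eq_zero_iff_mem, ← hφ]
    exact c5
end

section
open MvPolynomial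
set_option linter.unusedSectionVars false

theorem GB.rad {E EK L : Type} [CommRing E] [CommRing EK] [CommRing L] {U : Filter ℕ}
    {g : E →+* EK} {ev : ℕ → E →+* L} (h : GB U g ev) {σ : Type}
    (J : Ideal (MvPolynomial σ E)) (p : MvPolynomial σ E)
    (hp : map g p ∈ (J.map (map g)).radical) :
    ∀ᶠ i in U, map (ev i) p ∈ (J.map (map (ev i))).radical := by
  obtain ⟨n, hn⟩ := hp
  rw [← map_pow] at hn
  filter_upwards [h.mem J _ hn] with i hi
  refine ⟨n, ?_⟩
  rw [← map_pow]
  exact hi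

theorem map_paeval {R R' σ : Type} [CommRing R] [CommRing R'] (φ : R →+* R')
    (θ : MvPolynomial σ R) (p : Polynomial R) :
    map φ (Polynomial.aeval θ p) = Polynomial.aeval (map φ θ) (p.map φ) := by
  rw [Polynomial.aeval_def, Polynomial.aeval_def, Polynomial.hom_eval₂, Polynomial.eval₂_map]
  congr 1
  refine RingHom.ext fun a => ?_
  exact map_C φ a

theorem map_cert {R R' σ : Type} [CommRing R] [CommRing R'] (φ : R →+* R') (h0 : R) (j : σ)
    (θ : MvPolynomial σ R) (p : Polynomial R) :
    map φ (C h0 * X j - Polynomial.aeval θ p) =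
      C (φ h0) * X j - Polynomial.aeval (map φ θ) (p.map φ) := by
  rw [map_sub, map_mul, map_C, map_X, map_paeval]

theorem GB.primN {K : Type} [Field K] {U : Ultrafilter ℕ} {g : (ℕ → ℂ) →+* K}
    (h : GB (U : Filter ℕ) g (fun i => Pi.evalRingHom (fun _ => ℂ) i)) {S' S : Type} [Finite S']
    [Finite S]
    (Q : Ideal (MvPolynomial S' (MvPolynomial S (ℕ → ℂ)))) (hQ : Q.FG)
    (hT : TF (Q.map (map (map g))))
    (h1 : (1 : MvPolynomial S' (MvPolynomial S K)) ∉ Q.map (map (map g)))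
    (h0 : MvPolynomial S K) (hh0 : h0 ≠ 0) (θ : MvPolynomial S' (MvPolynomial S K))
    (r : S' → Polynomial (MvPolynomial S K)) (μ : Polynomial (MvPolynomial S K))
    (hr : ∀ j, C h0 * X j - Polynomial.aeval θ (r j) ∈ (Q.map (map (map g))).radical)
    (hμ : Polynomial.aeval θ μ ∈ (Q.map (map (map g))).radical)
    (hirr : Irreducible μ) (hd : μ.natDegree ≠ 0) :
    ∀ᶠ i in (U : Filter ℕ), (Q.map (map (map (Pi.evalRingHom (fun _ => ℂ) i)))).IsPrimary := by
  obtain ⟨h0, rfl⟩ := (h.poly S).surj h0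
  obtain ⟨θ, rfl⟩ := ((h.poly S).poly S').surj θ
  obtain ⟨μ, rfl⟩ := Polynomial.map_surjective _ (h.poly S).surj μ
  choose r' hr' using fun j => Polynomial.map_surjective _ (h.poly S).surj (r j)
  obtain rfl : (fun j => (r' j).map (map g)) = r := funext hr'
  have hr2 : ∀ᶠ i in (U : Filter ℕ), ∀ j, _ := Filter.eventually_all.2 fun j =>
    (h.poly S).rad Q (C h0 * X j - Polynomial.aeval θ (r' j)) (by rw [map_cert]; exact hr j)
  filter_upwards [h.tf Q hQ hT h1, hr2, (h.poly S).rad Q (Polynomial.aeval θ μ)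
    (by rw [map_paeval]; exact hμ), h.irredP μ hirr hd, (h.poly S).ne h0 hh0] with i h2 h3 h4 h5 h6
  refine cert_primary _ h2.1 h2.2 _ h6 (map (map (Pi.evalRingHom (fun _ => ℂ) i)) θ)
    (fun j => (r' j).map (map (Pi.evalRingHom (fun _ => ℂ) i))) _ (fun j => ?_) ?_ h5
  · rw [← map_cert]; exact h3 j
  · rw [← map_paeval]; exact h4

theorem prim_iso {A B : Type} [CommRing A] [CommRing B] (e : A ≃+* B) (Q : Ideal B)
    (h : (Q.comap e.toRingHom).IsPrimary) : Q.IsPrimary := by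
  have h1 : Q = (Q.comap e.toRingHom).comap e.symm.toRingHom := by
    ext y
    rw [Ideal.mem_comap, Ideal.mem_comap]
    show y ∈ Q ↔ e (e.symm y) ∈ Q
    rw [e.apply_symm_apply]
  rw [h1]
  exact h.comap _

theorem rad_iso {A B : Type} [CommRing A] [CommRing B] (e : A ≃+* B) (Q : Ideal B) (y : B)
    (h : e.symm y ∈ (Q.comap e.toRingHom).radical) : y ∈ Q.radical := by
  rw [← Ideal.comap_radical, Ideal.mem_comap] at h
  have : e.toRingHom (e.symm y) = y := e.apply_symm_apply y
  rwa [this] at h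

theorem rad_iso' {A B : Type} [CommRing A] [CommRing B] (e : A ≃+* B) (Q : Ideal B) (y : B)
    (h : y ∈ Q.radical) : e.symm y ∈ (Q.comap e.toRingHom).radical := by
  rw [← Ideal.comap_radical, Ideal.mem_comap]
  have : e.toRingHom (e.symm y) = y := e.apply_symm_apply y
  rwa [this]

theorem exists_iso {A B : Type} [CommRing A] [CommRing B] (e : A ≃+* B) (Q : Ideal A)
    (hQ : Q.FG) : ∃ Q' : Ideal B, Q'.FG ∧ Q = Q'.comap e.toRingHom := by
  refine ⟨Q.map e.toRingHom, hQ.map _, ?_⟩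
  exact (Ideal.comap_map_of_bijective e.toRingHom e.bijective).symm

theorem GB.prim {K : Type} [Field K] [CharZero K] {U : Ultrafilter ℕ} {g : (ℕ → ℂ) →+* K}
    (h : GB (U : Filter ℕ) g (fun i => Pi.evalRingHom (fun _ => ℂ) i)) {σ : Type} [Finite σ]
    (Q : Ideal (MvPolynomial σ (ℕ → ℂ))) (hQ : Q.FG) (hP : (Q.map (map g)).IsPrimary) :
    ∀ᶠ i in (U : Filter ℕ), (Q.map (map (Pi.evalRingHom (fun _ => ℂ) i))).IsPrimary := by
  obtain ⟨S', S, _, _, e, h0, θ, r, μ, c1, c2, c3, c4, c5, c6⟩ :=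
    cert_field _ (Ideal.isPrime_radical hP)
  obtain ⟨Q', hQ', rfl⟩ := exists_iso (NE e (ℕ → ℂ)) Q hQ
  rw [ideal_NE (NE e (ℕ → ℂ)) (NE e K) (map g) (map (map g)) (fun p => NE_map _ _ _)]
    at hP c4 c5 c6
  have hP' := prim_iso _ _ hP
  have hT : TF (Q'.map (map (map g))) := by
    intro c a hc hca
    rw [mul_comm] at hca
    refine (((Ideal.isPrimary_iff).1 hP').2 hca).resolve_right fun hr => ?_
    exact hc (c4 c (rad_iso' _ _ _ hr))
  have h1 : (1 : MvPolynomial S' (MvPolynomial S K)) ∉ Q'.map (map (map g)) :=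
    (Ideal.ne_top_iff_one _).1 ((Ideal.isPrimary_iff).1 hP').1
  filter_upwards [h.primN Q' hQ' hT h1 h0 c1 θ r μ (fun j => rad_iso _ _ _ (c5 j))
    (rad_iso _ _ _ c6) c2 c3] with i hi
  rw [ideal_NE (NE e (ℕ → ℂ)) (NE e ℂ) (map (Pi.evalRingHom (fun _ => ℂ) i))
    (map (map (Pi.evalRingHom (fun _ => ℂ) i))) (fun p => NE_map _ _ _)]
  exact hi.comap _
end

section
open MvPolynomial
set_option linter.unusedSectionVars false

def Bdd (M : ℕ) {σ : Type} (I : Ideal (MvPolynomial σ ℂ)) : Prop :=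
  ∃ l ≤ M, ∃ Q : Fin l → Ideal (MvPolynomial σ ℂ), I = ⨅ j, Q j ∧ ∀ j, (Q j).IsPrimary ∧
    ∃ gens : Finset (MvPolynomial σ ℂ), gens.card ≤ M ∧ (∀ g ∈ gens, g.totalDegree ≤ M) ∧
      Q j = Ideal.span (gens : Set (MvPolynomial σ ℂ))

theorem lasker_fin {R : Type} [CommRing R] [IsNoetherianRing R] (I : Ideal R) :
    ∃ (l : ℕ) (Q : Fin l → Ideal R), I = ⨅ j, Q j ∧ ∀ j, (Q j).IsPrimary := by
  classical
  obtain ⟨s, hs, hp⟩ := Submodule.isLasker R R I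
  refine ⟨s.card, fun j => (s.equivFin.symm j).1, ?_, fun j => hp (s.equivFin.symm j).2⟩
  rw [← hs, Finset.inf_eq_iInf]
  refine le_antisymm (le_iInf fun j => ?_) (le_iInf₂ fun J hJ => ?_)
  · exact iInf₂_le_of_le _ (s.equivFin.symm j).2 le_rfl
  · refine iInf_le_of_le (s.equivFin ⟨J, hJ⟩) ?_
    show ((s.equivFin.symm (s.equivFin ⟨J, hJ⟩)).1 : Ideal R) ≤ J
    rw [Equiv.symm_apply_apply]

theorem tdeg_map_le {R R' σ : Type} [CommRing R] [CommRing R'] (φ : R →+* R')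
    (p : MvPolynomial σ R) : (map φ p).totalDegree ≤ p.totalDegree :=
  Finset.sup_mono (support_map_subset φ p)

theorem fg_bound {R σ : Type} [CommRing R] (Q : Ideal (MvPolynomial σ R)) (hQ : Q.FG) :
    ∃ M : ℕ, ∀ (φ : R →+* ℂ), ∃ gens : Finset (MvPolynomial σ ℂ), gens.card ≤ M ∧
      (∀ g ∈ gens, g.totalDegree ≤ M) ∧
      Q.map (map φ) = Ideal.span (gens : Set (MvPolynomial σ ℂ)) := by
  classical
  obtain ⟨t, rfl⟩ := hQ
  refine ⟨max t.card (t.sup totalDegree), fun φ => ⟨t.image (map φ), ?_, ?_, ?_⟩⟩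
  · exact Finset.card_image_le.trans (le_max_left _ _)
  · intro q hq
    obtain ⟨p, hp, rfl⟩ := Finset.mem_image.1 hq
    exact (tdeg_map_le φ p).trans ((Finset.le_sup (f := totalDegree) hp).trans (le_max_right _ _))
  · rw [Finset.coe_image]
    exact Ideal.map_span _ _

theorem part2 (σ : Type) [Finite σ] (k r : ℕ) : ∃ M : ℕ, ∀ f : Fin k → MvPolynomial σ ℂ,
    (∀ j, (f j).totalDegree ≤ r) → Bdd M (Ideal.span (Set.range f)) := by
  classical
  by_contra hcon
  push Not at hcon
  choose f hf hnot using hcon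
  choose F hF using fun j => bdd_family r (fun i => f i j) (fun i => hf i j)
  obtain ⟨K, _, _, g, h⟩ := exists_GB
  have hIF : (Ideal.span (Set.range F)).FG := by
    refine ⟨Finset.univ.image F, ?_⟩
    rw [Finset.coe_image, Finset.coe_univ, Set.image_univ]
  obtain ⟨l, Q, hIQ, hQp⟩ := lasker_fin ((Ideal.span (Set.range F)).map (map g))
  have hlift : ∀ j, ∃ J : Ideal (MvPolynomial σ (ℕ → ℂ)), J.FG ∧ J.map (map g) = Q j := fun j =>
    h.exists_lift (Q j) ((isNoetherianRing_iff_ideal_fg _).1 inferInstance _)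
  choose J hJ hJQ using hlift
  obtain rfl : (fun j => (J j).map (map g)) = Q := funext hJQ
  choose M hM using fun j => fg_bound (J j) (hJ j)
  have e1 : ∀ᶠ i in (Filter.hyperfilter ℕ : Filter ℕ), ∀ j, _ :=
    Filter.eventually_all.2 fun j => h.prim (J j) (hJ j) (hQp j)
  have e2 : ∀ᶠ i in (Filter.hyperfilter ℕ : Filter ℕ), ∀ j, _ :=
    Filter.eventually_all.2 fun j => h.le _ (J j) hIF (hIQ.le.trans (iInf_le _ j))
  have e3 := h.iInf l J hJ _ hIQ.ge
  have e4 : ∀ᶠ i in (Filter.hyperfilter ℕ : Filter ℕ), max l (Finset.univ.sup M) ≤ i :=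
    Filter.hyperfilter_le_cofinite (Nat.cofinite_eq_atTop ▸ Filter.eventually_ge_atTop _)
  obtain ⟨i, h1, h2, h3, h4⟩ := (e1.and (e2.and (e3.and e4))).exists
  apply hnot i
  have hfi : Ideal.span (Set.range (f i)) =
      (Ideal.span (Set.range F)).map (map (Pi.evalRingHom (fun _ => ℂ) i)) := by
    rw [Ideal.map_span, ← Set.range_comp]
    congr 2
    funext j
    exact (hF j i).symm
  refine ⟨l, (le_max_left _ _).trans h4,
    fun j => (J j).map (map (Pi.evalRingHom (fun _ => ℂ) i)), ?_, fun j => ⟨h1 j, ?_⟩⟩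
  · rw [hfi]
    exact le_antisymm (le_iInf h2) h3
  · obtain ⟨gens, g1, g2, g3⟩ := hM j (Pi.evalRingHom (fun _ => ℂ) i)
    have hMi : M j ≤ i :=
      (Finset.le_sup (f := M) (Finset.mem_univ j)).trans ((le_max_right _ _).trans h4)
    exact ⟨gens, g1.trans hMi, fun g hg => (g2 g hg).trans hMi, g3⟩
end

section
open MvPolynomial
set_option linter.unusedSectionVars false

theorem low_rep {κ σ : Type} [Fintype κ] (w : κ → ℕ) (g : κ → MvPolynomial σ ℂ)
    (hw : ∀ j, 1 ≤ w j ∧ (g j).IsHomogeneous (w j)) (d : ℕ) (p : MvPolynomial κ ℂ)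
    (hp : (aeval g p).IsHomogeneous d) :
    ∃ p' : MvPolynomial κ ℂ, p'.totalDegree ≤ d ∧ aeval g p' = aeval g p := by
  classical
  have hm : ∀ (m : κ →₀ ℕ) (c : ℂ), (aeval g (monomial m c)).IsHomogeneous (∑ j, m j * w j) := by
    intro m c
    rw [aeval_monomial, Finsupp.prod_fintype _ _ (fun j => pow_zero _), ← zero_add (∑ j, m j * w j)]
    refine (isHomogeneous_C σ c).mul (IsHomogeneous.prod _ _ _ fun j _ => ?_)
    rw [mul_comm]
    exact (hw j).2.pow _
  refine ⟨∑ m ∈ p.support.filter (fun m => d = ∑ j, m j * w j), monomial m (coeff m p), ?_, ?_⟩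
  · refine totalDegree_finsetSum_le fun m hm' => ?_
    rw [Finset.mem_filter] at hm'
    refine (totalDegree_monomial_le m _).trans ?_
    rw [hm'.2, Finsupp.sum_fintype _ _ (fun _ => rfl)]
    exact Finset.sum_le_sum fun j _ => Nat.le_mul_of_pos_right _ (hw j).1
  · have h1 : homogeneousComponent d (aeval g p) = aeval g p := by
      rw [homogeneousComponent_of_mem hp, if_pos rfl]
    rw [← h1]
    conv_rhs => rw [p.as_sum, map_sum, map_sum]
    rw [map_sum, Finset.sum_filter]
    refine Finset.sum_congr rfl fun m _ => ?_
    rw [homogeneousComponent_of_mem (hm m (coeff m p))]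

theorem aeval_tdeg {κ σ : Type} (r : ℕ) (g : κ → MvPolynomial σ ℂ)
    (hg : ∀ j, (g j).totalDegree ≤ r) (p : MvPolynomial κ ℂ) :
    (aeval g p).totalDegree ≤ p.totalDegree * r := by
  classical
  conv_lhs => rw [p.as_sum, map_sum]
  refine totalDegree_finsetSum_le fun m hm => ?_
  rw [aeval_monomial]
  refine (totalDegree_mul _ _).trans ?_
  have h0 : (algebraMap ℂ (MvPolynomial σ ℂ) (coeff m p)).totalDegree = 0 := totalDegree_C _
  rw [h0, zero_add]
  refine (totalDegree_finsetProd _ _).trans ?_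
  have h1 := le_totalDegree hm
  refine le_trans ?_ (Nat.mul_le_mul_right r h1)
  rw [Finsupp.sum, Finset.sum_mul]
  refine Finset.sum_le_sum fun j _ => ?_
  exact (totalDegree_pow _ _).trans (Nat.mul_le_mul_left _ (hg j))

theorem part2' (k r B : ℕ) : ∃ M : ℕ, ∀ (κ : Type) [Fintype κ], Fintype.card κ ≤ B →
    ∀ f : Fin k → MvPolynomial κ ℂ,
    (∀ j, (f j).totalDegree ≤ r) → Bdd M (Ideal.span (Set.range f)) := by
  classical
  choose M hM using fun s : ℕ => part2 (Fin s) k r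
  refine ⟨(Finset.range (B + 1)).sup M, fun κ _ hκ f hf => ?_⟩
  have e := Fintype.equivFin κ
  obtain ⟨E, hE⟩ : ∃ E : MvPolynomial (Fin (Fintype.card κ)) ℂ ≃+* MvPolynomial κ ℂ,
      (∀ p, (E p).totalDegree ≤ p.totalDegree) ∧ (∀ p, (E.symm p).totalDegree ≤ p.totalDegree) :=
    ⟨(renameEquiv ℂ e.symm).toRingEquiv, fun p => totalDegree_rename_le _ _,
      fun p => totalDegree_rename_le _ _⟩
  have hle : M (Fintype.card κ) ≤ (Finset.range (B + 1)).sup M :=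
    Finset.le_sup (f := M) (Finset.mem_range.2 (by omega))
  obtain ⟨l, hl, Q, h1, h2⟩ := hM (Fintype.card κ) (fun j => E.symm (f j))
    (fun j => (hE.2 _).trans (hf j))
  refine ⟨l, hl.trans hle, fun j => (Q j).comap E.symm.toRingHom, ?_, fun j => ?_⟩
  · rw [← Ideal.comap_iInf, ← h1]
    have : (Ideal.span (Set.range fun j => E.symm (f j))) =
        (Ideal.span (Set.range f)).map E.symm.toRingHom := by
      rw [Ideal.map_span, ← Set.range_comp]
      rfl
    rw [this]
    exact (Ideal.comap_map_of_bijective E.symm.toRingHom E.symm.bijective).symm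
  · obtain ⟨hp, gens, g1, g2, g3⟩ := h2 j
    refine ⟨hp.comap _, gens.image E, Finset.card_image_le.trans (g1.trans hle), ?_, ?_⟩
    · intro q hq
      obtain ⟨p, hp, rfl⟩ := Finset.mem_image.1 hq
      exact (hE.1 p).trans ((g2 p hp).trans hle)
    · have h3 : (Q j).comap E.symm.toRingHom = (Q j).map E.toRingHom := (Ideal.map_symm E.symm).symm
      beta_reduce
      rw [h3, g3, Ideal.map_span, Finset.coe_image]
      rfl

theorem main_kr (k r : ℕ) : ∃ L G D : ℕ, ∀ (n : ℕ)
      (Q : Fin k → MvPolynomial (Fin (n + 1)) ℂ),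
      (∀ j, ∃ e ≤ r, (Q j).IsHomogeneous e) →
      ∃ (l : ℕ) (_ : l ≤ L)
        (I : Fin l → Ideal (MvPolynomial (Fin (n + 1)) ℂ)),
        Ideal.span (Set.range Q) = ⨅ j, I j ∧
        ∀ j, (I j).IsPrimary ∧
          ∃ gens : Finset (MvPolynomial (Fin (n + 1)) ℂ),
            gens.card ≤ G ∧ (∀ g ∈ gens, g.totalDegree ≤ D) ∧
            I j = Ideal.span (gens : Set (MvPolynomial (Fin (n + 1)) ℂ)) := by
  classical
  obtain ⟨N, hN⟩ := part3 (max r 1) (le_max_right _ _)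
  obtain ⟨B, hB⟩ := small_subalg N (max r 1) k
  obtain ⟨M, hM⟩ := part2' k (max r 1) B
  refine ⟨M, M, M * max r 1, fun n Q hQ => ?_⟩
  choose e he hQe using hQ
  obtain ⟨κ, _, d, g, h1, h2, h3, h4⟩ := hB (Fin (n + 1)) {j : Fin k // 1 ≤ e j}
    (fun j => e j.1) (fun j => Q j.1)
    ((Fintype.card_subtype_le _).trans (by rw [Fintype.card_fin]))
    (fun j => ⟨j.2, (he j.1).trans (le_max_left _ _), hQe j.1⟩)
  obtain ⟨c1, c2⟩ := hN (n + 1) κ d g h2 h3 (aeval g : MvPolynomial κ ℂ →ₐ[ℂ] _).toRingHom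
    (fun a => aeval_C g a) (fun j => aeval_X g j)
  have hrep : ∀ j, ∃ p : MvPolynomial κ ℂ, p.totalDegree ≤ max r 1 ∧ aeval g p = Q j := by
    intro j
    by_cases hj : 1 ≤ e j
    · have := h4 ⟨j, hj⟩
      rw [Algebra.adjoin_range_eq_range_aeval] at this
      obtain ⟨p, hp⟩ := this
      have hp' : aeval g p = Q j := hp
      obtain ⟨p', hd, hp2⟩ := low_rep d g (fun i => ⟨(h2 i).1, (h2 i).2.2⟩) (e j) p
        (by rw [hp']; exact hQe j)
      exact ⟨p', hd.trans ((he j).trans (le_max_left _ _)), hp2.trans hp'⟩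
    · have h0 : e j = 0 := by omega
      have := hQe j
      rw [h0] at this
      refine ⟨C (coeff 0 (Q j)), by rw [totalDegree_C]; exact Nat.zero_le _, ?_⟩
      rw [aeval_C]
      exact (totalDegree_eq_zero_iff_eq_C.1 (Nat.le_zero.1 this.totalDegree_le)).symm
  choose p hpd hpQ using hrep
  obtain ⟨l, hl, J, hJ, hJp⟩ := hM κ h1 p hpd
  refine ⟨l, hl, fun j => (J j).map (aeval g : MvPolynomial κ ℂ →ₐ[ℂ] _).toRingHom, ?_,
    fun j => ⟨c1 _ (hJp j).1, ?_⟩⟩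
  · rw [← c2, ← hJ, Ideal.map_span, ← Set.range_comp]
    congr 2
    funext j
    exact (hpQ j).symm
  · obtain ⟨-, gens, g1, g2, g3⟩ := hJp j
    refine ⟨gens.image (aeval g), Finset.card_image_le.trans g1, ?_, ?_⟩
    · intro q hq
      obtain ⟨p, hp, rfl⟩ := Finset.mem_image.1 hq
      exact (aeval_tdeg (max r 1) g (fun i => (h2 i).2.2.totalDegree_le.trans (h2 i).2.1) p).trans
        (Nat.mul_le_mul_right _ (g2 p hp))
    · beta_reduce
      rw [g3, Ideal.map_span, Finset.coe_image]
      rfl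

theorem exists_bounded_primary_decomposition :
    ∃ L G D : ℕ × ℕ → ℕ, ∀ (n k r : ℕ)
      (Q : Fin k → MvPolynomial (Fin (n + 1)) ℂ),
      (∀ j, ∃ e ≤ r, (Q j).IsHomogeneous e) →
      ∃ (l : ℕ) (_ : l ≤ L (k, r))
        (I : Fin l → Ideal (MvPolynomial (Fin (n + 1)) ℂ)),
        Ideal.span (Set.range Q) = ⨅ j, I j ∧
        ∀ j, (I j).IsPrimary ∧
          ∃ gens : Finset (MvPolynomial (Fin (n + 1)) ℂ),
            gens.card ≤ G (k, r) ∧ (∀ g ∈ gens, g.totalDegree ≤ D (k, r)) ∧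
            I j = Ideal.span (gens : Set (MvPolynomial (Fin (n + 1)) ℂ)) := by
  choose L G D h using fun x : ℕ × ℕ => main_kr x.1 x.2
  exact ⟨L, G, D, fun n k r Q hQ => h (k, r) n Q hQ⟩
end
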